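/- Assume (SA), that f is nondecreasing on [0,∞), and that there exists α > 2 such that ρ(x) = |x|^{−α} for all |x| ≥ 1. Then there exists exactly one entire large solution of (E). -/

import Mathlib

open MeasureTheory Filter Set

noncomputable def laplacian {D : ℕ} (u : EuclideanSpace ℝ (Fin D) → ℝ)
    (x : EuclideanSpace ℝ (Fin D)) : ℝ :=
  ∑ i, fderiv ℝ (fun y => fderiv ℝ u y (EuclideanSpace.single i 1)) x (EuclideanSpace.single i 1)

/-- An entire large solution of `Δu = ρ f(u)`, `u > 0` in `ℝ^D`. -/
def IsELS {D : ℕ} (ρ : EuclideanSpace ℝ (Fin D) → ℝ) (f : ℝ → ℝ)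
    (u : EuclideanSpace ℝ (Fin D) → ℝ) : Prop :=
  ContDiff ℝ 2 u ∧ (∀ x, 0 < u x) ∧
    (∀ x, laplacian u x = ρ x * f (u x)) ∧
    Tendsto u (cocompact _) atTop

open scoped Topology

/-- Euclidean space of dimension `D`. -/
abbrev Euc (D : ℕ) := EuclideanSpace ℝ (Fin D)

/-- The `i`-th standard basis vector. -/
noncomputable abbrev basisVec {D : ℕ} (i : Fin D) : Euc D := EuclideanSpace.single i 1

section Calculus

variable {D : ℕ}

theorem differentiableAt_fderiv_of_contDiffAt {u : Euc D → ℝ} {x : Euc D}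
    (h : ContDiffAt ℝ 2 u x) : DifferentiableAt ℝ (fderiv ℝ u) x :=
  (h.fderiv_right (m := 1) (by norm_num)).differentiableAt (by norm_num)

theorem laplacian_eq_sum {u : Euc D → ℝ} {x : Euc D} (h : ContDiffAt ℝ 2 u x) :
    laplacian u x = ∑ i, fderiv ℝ (fderiv ℝ u) x (basisVec i) (basisVec i) := by
  unfold laplacian
  refine Finset.sum_congr rfl fun i _ => ?_
  rw [fderiv_clm_apply (differentiableAt_fderiv_of_contDiffAt h) (by fun_prop)]
  simp

theorem laplacian_congr {u v : Euc D → ℝ} {x : Euc D} (h : u =ᶠ[𝓝 x] v) :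
    laplacian u x = laplacian v x := by
  unfold laplacian
  refine Finset.sum_congr rfl fun i _ => ?_
  have : (fun y => fderiv ℝ u y (basisVec i)) =ᶠ[𝓝 x] fun y => fderiv ℝ v y (basisVec i) := by
    filter_upwards [h.eventuallyEq_nhds] with y hy
    rw [hy.fderiv_eq]
  rw [this.fderiv_eq]

theorem fderiv_eventually_add {u v : Euc D → ℝ} {x : Euc D}
    (hu : ContDiffAt ℝ 2 u x) (hv : ContDiffAt ℝ 2 v x) :
    fderiv ℝ (fun y => u y + v y) =ᶠ[𝓝 x] fun y => fderiv ℝ u y + fderiv ℝ v y := by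
  filter_upwards [hu.eventually (by simp), hv.eventually (by simp)] with y h1 h2
  exact fderiv_add (h1.differentiableAt (by norm_num)) (h2.differentiableAt (by norm_num))

theorem laplacian_add {u v : Euc D → ℝ} {x : Euc D}
    (hu : ContDiffAt ℝ 2 u x) (hv : ContDiffAt ℝ 2 v x) :
    laplacian (fun y => u y + v y) x = laplacian u x + laplacian v x := by
  rw [laplacian_eq_sum hu, laplacian_eq_sum hv, laplacian_eq_sum (hu.add hv),
    ← Finset.sum_add_distrib]
  refine Finset.sum_congr rfl fun i _ => ?_
  rw [(fderiv_eventually_add hu hv).fderiv_eq, fderiv_fun_add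
    (differentiableAt_fderiv_of_contDiffAt hu) (differentiableAt_fderiv_of_contDiffAt hv)]
  simp

theorem laplacian_const_mul (c : ℝ) {u : Euc D → ℝ} {x : Euc D} (hu : ContDiffAt ℝ 2 u x) :
    laplacian (fun y => c * u y) x = c * laplacian u x := by
  rw [laplacian_eq_sum hu, laplacian_eq_sum (contDiffAt_const.mul hu), Finset.mul_sum]
  refine Finset.sum_congr rfl fun i _ => ?_
  have : fderiv ℝ (fun y => c * u y) =ᶠ[𝓝 x] fun y => c • fderiv ℝ u y := by
    filter_upwards [hu.eventually (by simp)] with y h1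
    exact fderiv_const_mul (h1.differentiableAt (by norm_num)) c
  rw [this.fderiv_eq, fderiv_fun_const_smul (differentiableAt_fderiv_of_contDiffAt hu)]
  simp

theorem laplacian_sub {u v : Euc D → ℝ} {x : Euc D}
    (hu : ContDiffAt ℝ 2 u x) (hv : ContDiffAt ℝ 2 v x) :
    laplacian (fun y => u y - v y) x = laplacian u x - laplacian v x := by
  have h := laplacian_add hu (contDiffAt_const.mul hv : ContDiffAt ℝ 2 (fun y => (-1) * v y) x)
  rw [laplacian_const_mul _ hv] at h
  simpa [sub_eq_add_neg] using h

theorem laplacian_const (c : ℝ) (x : Euc D) : laplacian (fun _ : Euc D => c) x = 0 := by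
  simp [laplacian]

/-- The Laplacian of a function of `‖y‖²`. -/
theorem laplacian_comp_norm_sq {β β' : ℝ → ℝ} {b : ℝ} {x : Euc D}
    (h₁ : ∀ᶠ s in 𝓝 (‖x‖ ^ 2), HasDerivAt β (β' s) s) (h₂ : HasDerivAt β' b (‖x‖ ^ 2)) :
    laplacian (fun y : Euc D => β (‖y‖ ^ 2)) x = 4 * b * ‖x‖ ^ 2 + 2 * D * β' (‖x‖ ^ 2) := by
  have hn : ∀ y : Euc D, HasFDerivAt (fun y : Euc D => ‖y‖ ^ 2) (2 • innerSL ℝ y) y :=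
    fun y => (hasStrictFDerivAt_norm_sq y).hasFDerivAt
  have hcont : Tendsto (fun y : Euc D => ‖y‖ ^ 2) (𝓝 x) (𝓝 (‖x‖ ^ 2)) :=
    (continuous_norm.pow 2).continuousAt
  unfold laplacian
  have key : ∀ i : Fin D, fderiv ℝ (fun y => fderiv ℝ (fun y : Euc D => β (‖y‖ ^ 2)) y
      (EuclideanSpace.single i 1)) x (EuclideanSpace.single i 1)
      = 4 * b * x i ^ 2 + 2 * β' (‖x‖ ^ 2) := by
    intro i
    have e : (fun y => fderiv ℝ (fun y : Euc D => β (‖y‖ ^ 2)) y (EuclideanSpace.single i 1))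
        =ᶠ[𝓝 x] fun y => β' (‖y‖ ^ 2) * (2 * y i) := by
      filter_upwards [hcont.eventually h₁] with y hy
      have h : HasFDerivAt (fun y : Euc D => β (‖y‖ ^ 2)) _ y := hy.comp_hasFDerivAt y (hn y)
      rw [h.fderiv]
      simp [EuclideanSpace.inner_single_right]
    rw [e.fderiv_eq]
    have hx : HasFDerivAt (fun y : Euc D => 2 * y i)
        ((2 : ℝ) • (EuclideanSpace.proj i : Euc D →L[ℝ] ℝ)) x := by
      simpa using ((EuclideanSpace.proj i : Euc D →L[ℝ] ℝ).hasFDerivAt (x := x)).const_mul 2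
    have h : HasFDerivAt (fun y : Euc D => β' (‖y‖ ^ 2) * (2 * y i)) _ x :=
      (h₂.comp_hasFDerivAt x (hn x)).mul hx
    rw [h.fderiv]
    simp [EuclideanSpace.inner_single_right]
    ring
  rw [Finset.sum_congr rfl fun i _ => key i, Finset.sum_add_distrib, ← Finset.mul_sum,
    EuclideanSpace.real_norm_sq_eq]
  simp
  ring

theorem deriv_deriv_nonpos_of_isLocalMax {g g' : ℝ → ℝ} {c t : ℝ}
    (hg : ∀ᶠ s in 𝓝 t, HasDerivAt g (g' s) s) (hg' : HasDerivAt g' c t)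
    (hmax : IsLocalMax g t) : c ≤ 0 := by
  by_contra! hc
  have e : deriv g =ᶠ[𝓝 t] g' := by
    filter_upwards [hg] with s hs using hs.deriv
  have h2 : deriv (deriv g) t = c := by rw [e.deriv_eq, hg'.deriv]
  have hmin := isLocalMin_of_deriv_deriv_pos (f := g) (x₀ := t) (by rw [h2]; exact hc)
    hmax.deriv_eq_zero hg.self_of_nhds.continuousAt
  have hconst : g =ᶠ[𝓝 t] fun _ => g t := by
    filter_upwards [hmin, hmax] with s h1 h2 using le_antisymm h2 h1
  have : deriv g =ᶠ[𝓝 t] fun _ => 0 := by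
    filter_upwards [hconst.eventuallyEq_nhds] with s hs
    rw [hs.deriv_eq]; simp
  rw [this.deriv_eq] at h2
  simp at h2
  linarith

/-- Along a `C²` curve the second derivative of `u ∘ γ` is given by the Hessian and gradient. -/
theorem hasDerivAt_comp_curve {u : Euc D → ℝ} {γ γ' : ℝ → Euc D} {γ'' : Euc D} {t : ℝ}
    (hu : ContDiffAt ℝ 2 u (γ t)) (hγ : ∀ᶠ s in 𝓝 t, HasDerivAt γ (γ' s) s)
    (hγ' : HasDerivAt γ' γ'' t) :
    (∀ᶠ s in 𝓝 t, HasDerivAt (fun s => u (γ s)) (fderiv ℝ u (γ s) (γ' s)) s) ∧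
    HasDerivAt (fun s => fderiv ℝ u (γ s) (γ' s))
      (fderiv ℝ (fderiv ℝ u) (γ t) (γ' t) (γ' t) + fderiv ℝ u (γ t) γ'') t := by
  constructor
  · have hc : ContinuousAt γ t := hγ.self_of_nhds.continuousAt
    filter_upwards [hγ, hc.eventually (hu.eventually (by simp))] with s hs hus
    exact (hus.differentiableAt (by norm_num)).hasFDerivAt.comp_hasDerivAt s hs
  · have h1 := (differentiableAt_fderiv_of_contDiffAt hu).hasFDerivAt.comp_hasDerivAt t
      hγ.self_of_nhds
    exact h1.clm_apply hγ'

theorem laplacian_nonpos_of_isLocalMax {u : Euc D → ℝ} {x : Euc D} (hu : ContDiffAt ℝ 2 u x)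
    (hmax : IsLocalMax u x) : laplacian u x ≤ 0 := by
  rw [laplacian_eq_sum hu]
  refine Finset.sum_nonpos fun i _ => ?_
  have hγ : ∀ s : ℝ, HasDerivAt (fun s : ℝ => x + s • basisVec i) (basisVec i) s := fun s => by
    simpa using ((hasDerivAt_id s).smul_const (basisVec i)).const_add x
  obtain ⟨h1, h2⟩ := hasDerivAt_comp_curve (u := u) (t := 0) (γ := fun s : ℝ => x + s • basisVec i)
    (γ' := fun _ => basisVec i) (by simpa using hu) (Eventually.of_forall hγ)
    (hasDerivAt_const _ _)
  have hm : IsLocalMax (fun s : ℝ => u (x + s • basisVec i)) 0 := by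
    have : Tendsto (fun s : ℝ => x + s • basisVec i) (𝓝 0) (𝓝 x) := by
      simpa using (hγ 0).continuousAt.tendsto
    have := this.eventually hmax
    simpa [IsLocalMax, IsMaxFilter] using this
  simpa using deriv_deriv_nonpos_of_isLocalMax h1 h2 hm

theorem laplacian_norm_sq (x : Euc D) : laplacian (fun y : Euc D => ‖y‖ ^ 2) x = 2 * D := by
  have := laplacian_comp_norm_sq (β := id) (β' := fun _ => 1) (b := 0) (x := x)
    (Eventually.of_forall fun s => hasDerivAt_id s) (hasDerivAt_const _ _)
  simpa using this

theorem contDiff_norm_sq_euc {n : WithTop ℕ∞} : ContDiff ℝ n (fun y : Euc D => ‖y‖ ^ 2) :=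
  contDiff_norm_sq ℝ

/-- Weak maximum principle on a ball, for functions subharmonic where they are positive. -/
theorem nonpos_of_laplacian_nonneg_ball (hD : 0 < D) {R : ℝ} {w : Euc D → ℝ}
    (hw : ContinuousOn w (Metric.closedBall 0 R))
    (hC : ∀ x ∈ Metric.ball (0 : Euc D) R, 0 < w x → ContDiffAt ℝ 2 w x)
    (hΔ : ∀ x ∈ Metric.ball (0 : Euc D) R, 0 < w x → 0 ≤ laplacian w x)
    (hb : ∀ x ∈ Metric.sphere (0 : Euc D) R, w x ≤ 0) :
    ∀ x ∈ Metric.closedBall (0 : Euc D) R, w x ≤ 0 := by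
  intro x₀ hx₀
  by_contra! hpos
  have hR : 0 ≤ R := le_trans dist_nonneg hx₀
  set δ : ℝ := w x₀ / (2 * (R ^ 2 + 1)) with hδ
  have hδpos : 0 < δ := by positivity
  have hδR : δ * R ^ 2 < w x₀ := by
    rw [hδ, div_mul_eq_mul_div, div_lt_iff₀ (by positivity)]; nlinarith [sq_nonneg R]
  obtain ⟨x₁, hx₁, hmax⟩ := (isCompact_closedBall (0 : Euc D) R).exists_isMaxOn ⟨x₀, hx₀⟩
    (hw.add ((continuous_const.mul (continuous_norm.pow 2)).continuousOn
      (f := fun y : Euc D => δ * ‖y‖ ^ 2)))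
  have hge : w x₀ ≤ w x₁ + δ * ‖x₁‖ ^ 2 := by
    have : w x₀ + δ * ‖x₀‖ ^ 2 ≤ w x₁ + δ * ‖x₁‖ ^ 2 := hmax hx₀
    nlinarith [mul_nonneg hδpos.le (sq_nonneg ‖x₀‖)]
  have hx₁n : ‖x₁‖ ≤ R := by simpa using hx₁
  have hw₁ : 0 < w x₁ := by
    have : ‖x₁‖ ^ 2 ≤ R ^ 2 := by gcongr
    nlinarith
  have hball : x₁ ∈ Metric.ball (0 : Euc D) R := by
    rcases lt_or_eq_of_le hx₁n with h | h
    · simpa using h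
    · exact absurd (hb x₁ (by simpa using h)) (not_le.mpr hw₁)
  have hC₁ := hC x₁ hball hw₁
  have hC₂ : ContDiffAt ℝ 2 (fun y : Euc D => δ * ‖y‖ ^ 2) x₁ :=
    contDiffAt_const.mul contDiff_norm_sq_euc.contDiffAt
  have hloc : IsLocalMax (fun y => w y + δ * ‖y‖ ^ 2) x₁ :=
    hmax.isLocalMax (Filter.mem_of_superset (Metric.isOpen_ball.mem_nhds hball)
      Metric.ball_subset_closedBall)
  have h := laplacian_nonpos_of_isLocalMax (hC₁.add hC₂) hloc
  rw [laplacian_add hC₁ hC₂, laplacian_const_mul _ contDiff_norm_sq_euc.contDiffAt,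
    laplacian_norm_sq] at h
  have := hΔ x₁ hball hw₁
  have hD' : (0 : ℝ) < D := by exact_mod_cast hD
  nlinarith [mul_pos hδpos hD']

/-- Weak maximum principle on the whole space. -/
theorem nonpos_of_laplacian_nonneg (hD : 0 < D) {w : Euc D → ℝ} (hw : ContDiff ℝ 2 w)
    (hΔ : ∀ x, 0 < w x → 0 ≤ laplacian w x)
    (hlim : ∀ δ > 0, ∀ᶠ x in cocompact (Euc D), w x ≤ δ) (x : Euc D) : w x ≤ 0 := by
  refine le_of_forall_pos_le_add fun δ hδ => ?_
  obtain ⟨R, hR⟩ : ∃ R : ℝ, ∀ y : Euc D, R ≤ ‖y‖ → w y ≤ δ := by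
    have := hlim δ hδ
    rw [← Metric.cobounded_eq_cocompact, ← comap_norm_atTop] at this
    obtain ⟨s, hs, hs'⟩ := this
    obtain ⟨R, hR⟩ := mem_atTop_sets.mp hs
    exact ⟨R, fun y hy => hs' (hR _ hy)⟩
  have h := nonpos_of_laplacian_nonneg_ball hD (R := max R ‖x‖) (w := fun y => w y - δ)
    (hw.continuous.sub continuous_const).continuousOn
    (fun y _ _ => (hw.sub contDiff_const).contDiffAt)
    (fun y _ hy => by
      rw [laplacian_sub hw.contDiffAt contDiffAt_const, laplacian_const, sub_zero]
      exact hΔ y (by linarith))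
    (fun y hy => by
      have : ‖y‖ = max R ‖x‖ := by simpa using hy
      linarith [hR y (by rw [this]; exact le_max_left _ _)])
    x (by simp)
  linarith

end Calculus

section Uniqueness

variable {D : ℕ}

/-- At a maximum over a centred sphere, the tangential Hessian is controlled by the radial
derivative. -/
theorem hess_tangent_le {u : Euc D → ℝ} {y t : Euc D} (hu : ContDiffAt ℝ 2 u y) (hy : y ≠ 0)
    (ht : inner ℝ y t = 0) (hmax : ∀ z : Euc D, ‖z‖ = ‖y‖ → u z ≤ u y) :
    fderiv ℝ (fderiv ℝ u) y t t ≤ ‖t‖ ^ 2 / ‖y‖ ^ 2 * fderiv ℝ u y y := by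
  rcases eq_or_ne t 0 with rfl | ht0
  · simp
  have hy' : 0 < ‖y‖ := norm_pos_iff.mpr hy
  have ht' : 0 < ‖t‖ := norm_pos_iff.mpr ht0
  set a : ℝ := ‖t‖ / ‖y‖ with ha
  have hapos : 0 < a := by positivity
  have hlin : ∀ s : ℝ, HasDerivAt (fun s : ℝ => a * s) a s := fun s => by
    simpa using (hasDerivAt_id s).const_mul a
  have hγ : ∀ s : ℝ, HasDerivAt (fun s => Real.cos (a * s) • y + (Real.sin (a * s) / a) • t)
      ((-(a * Real.sin (a * s))) • y + Real.cos (a * s) • t) s := fun s => by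
    have h1 := ((Real.hasDerivAt_cos (a * s)).comp s (hlin s)).smul_const y
    have h2 := (((Real.hasDerivAt_sin (a * s)).comp s (hlin s)).div_const a).smul_const t
    refine (h1.add h2).congr_deriv ?_
    congr 2
    · ring
    · field_simp
  have hγ' : HasDerivAt (fun s => (-(a * Real.sin (a * s))) • y + Real.cos (a * s) • t)
      ((-(a ^ 2)) • y) 0 := by
    have h1 := (((Real.hasDerivAt_sin (a * 0)).comp 0 (hlin 0)).const_mul a).neg.smul_const y
    have h2 := ((Real.hasDerivAt_cos (a * 0)).comp 0 (hlin 0)).smul_const t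
    refine (h1.add h2).congr_deriv ?_
    simp [sq]
  obtain ⟨h1, h2⟩ := hasDerivAt_comp_curve (u := u) (t := 0) (by simpa using hu)
    (Eventually.of_forall hγ) hγ'
  have hm : IsLocalMax (fun s : ℝ => u (Real.cos (a * s) • y + (Real.sin (a * s) / a) • t)) 0 := by
    refine Eventually.of_forall fun s => ?_
    simp only [mul_zero, Real.cos_zero, one_smul, Real.sin_zero, zero_div, zero_smul, add_zero]
    apply hmax
    rw [← sq_eq_sq₀ (norm_nonneg _) (norm_nonneg _), norm_add_sq_real, inner_smul_left,
      inner_smul_right, ht, norm_smul, norm_smul]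
    simp only [mul_pow, Real.norm_eq_abs, sq_abs, mul_zero, add_zero, div_pow]
    have : ‖t‖ ^ 2 = a ^ 2 * ‖y‖ ^ 2 := by rw [ha]; field_simp
    rw [this]
    field_simp
    nlinarith [Real.sin_sq_add_cos_sq (a * s)]
  have h := deriv_deriv_nonpos_of_isLocalMax h1 h2 hm
  have haa : a ^ 2 = ‖t‖ ^ 2 / ‖y‖ ^ 2 := by rw [ha, div_pow]
  rw [← haa]
  simp at h
  linarith

/-- At a maximum over a centred sphere, the Laplacian is at most its radial part. -/
theorem laplacian_le_radial {u : Euc D → ℝ} {y : Euc D} (hu : ContDiffAt ℝ 2 u y) (hy : y ≠ 0)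
    (hmax : ∀ z : Euc D, ‖z‖ = ‖y‖ → u z ≤ u y) :
    ‖y‖ ^ 2 * laplacian u y ≤ fderiv ℝ (fderiv ℝ u) y y y + (D - 1) * fderiv ℝ u y y := by
  have hy' : 0 < ‖y‖ := norm_pos_iff.mpr hy
  set N := ‖y‖ ^ 2 with hN
  have hNpos : 0 < N := by positivity
  set B := fderiv ℝ (fderiv ℝ u) y with hB
  set P := fderiv ℝ u y y with hP
  let t : Fin D → Euc D := fun i => basisVec i - (y i / N) • y
  have hysum : ∑ i, y i • (basisVec i : Euc D) = y := by
    ext j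
    simp [Finset.sum_apply, Pi.single_apply]
  have hNsum : ∑ i, y i ^ 2 = N := (EuclideanSpace.real_norm_sq_eq y).symm
  have hinner : ∀ i, inner ℝ y (basisVec i : Euc D) = y i := fun i => by
    simp [EuclideanSpace.inner_single_right]
  have hort : ∀ i, inner ℝ y (t i) = 0 := fun i => by
    rw [inner_sub_right, inner_smul_right, hinner, real_inner_self_eq_norm_sq, ← hN]
    field_simp; ring
  have hnt : ∀ i, ‖t i‖ ^ 2 = 1 - y i ^ 2 / N := fun i => by
    have h1 : ‖(basisVec i : Euc D)‖ = 1 := by simp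
    rw [norm_sub_sq_real, inner_smul_right, real_inner_comm, hinner, norm_smul, mul_pow, ← hN, h1,
      Real.norm_eq_abs, sq_abs]
    field_simp; ring
  have hterm : ∀ i, N * B (basisVec i) (basisVec i) ≤
      (N - y i ^ 2) / N * P + (y i • B (basisVec i) y + y i • B y (basisVec i))
        - y i ^ 2 / N * B y y := by
    intro i
    have h := hess_tangent_le hu hy (hort i) hmax
    rw [hnt, ← hN, ← hB, ← hP] at h
    have hexp : B (t i) (t i) = B (basisVec i) (basisVec i) - (y i / N) * B (basisVec i) y
        - (y i / N) * B y (basisVec i) + (y i / N) ^ 2 * B y y := by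
      simp only [t, map_sub, map_smul, sub_apply,
        smul_apply, smul_eq_mul]
      ring
    rw [hexp] at h
    have h' := mul_le_mul_of_nonneg_left h hNpos.le
    simp only [smul_eq_mul]
    have e1 : N * ((1 - y i ^ 2 / N) / N * P) = (N - y i ^ 2) / N * P := by field_simp
    have e2 : N * (B (basisVec i) (basisVec i) - (y i / N) * B (basisVec i) y
        - (y i / N) * B y (basisVec i) + (y i / N) ^ 2 * B y y)
        = N * B (basisVec i) (basisVec i) - (y i * B (basisVec i) y + y i * B y (basisVec i))
          + y i ^ 2 / N * B y y := by field_simp; ring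
    rw [e1, e2] at h'
    linarith
  rw [laplacian_eq_sum hu, Finset.mul_sum]
  refine (Finset.sum_le_sum fun i _ => hterm i).trans_eq ?_
  rw [Finset.sum_sub_distrib, Finset.sum_add_distrib, Finset.sum_add_distrib, ← Finset.sum_mul,
    ← Finset.sum_mul, ← Finset.sum_div, ← Finset.sum_div, Finset.sum_sub_distrib, hNsum]
  have e1 : ∑ i, y i • B (basisVec i) y = B y y := by
    conv_rhs => rw [show B y = B (∑ i, y i • (basisVec i : Euc D)) by rw [hysum]]
    rw [map_sum]; simp
  have e2 : ∑ i, y i • B y (basisVec i) = B y y := by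
    conv_rhs => rw [← hysum]
    rw [map_sum, hysum]; simp
  rw [e1, e2]
  simp
  field_simp
  ring

theorem eventually_add_pos {a : ℝ} (ha : 0 < a) : ∀ᶠ s in 𝓝 (0 : ℝ), 0 < a + s := by
  filter_upwards [lt_mem_nhds (neg_lt_zero.mpr ha)] with s hs
  linarith

/-- A subharmonic function maximal over a centred sphere at `y` increases radially at `y`. -/
theorem radial_fderiv_nonneg (hD : 0 < D) {u₂ : Euc D → ℝ} (hC₂ : ContDiff ℝ 2 u₂)
    (hΔ : ∀ z, 0 ≤ laplacian u₂ z) {y : Euc D} (hmaxy : ∀ z : Euc D, ‖z‖ = ‖y‖ → u₂ z ≤ u₂ y) :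
    0 ≤ fderiv ℝ u₂ y y := by
  have hball := nonpos_of_laplacian_nonneg_ball (D := D) hD (R := ‖y‖)
    (w := fun z => u₂ z - u₂ y) (hC₂.continuous.sub continuous_const).continuousOn
    (fun z _ _ => (hC₂.sub contDiff_const).contDiffAt)
    (fun z _ _ => by
      rw [laplacian_sub hC₂.contDiffAt contDiffAt_const, laplacian_const, sub_zero]
      exact hΔ z)
    (fun z hz => by linarith [hmaxy z (by simpa using hz)])
  have hline : HasDerivAt (fun s : ℝ => u₂ (s • y)) (fderiv ℝ u₂ y y) 1 := by
    have hl : HasDerivAt (fun s : ℝ => s • y) y 1 := by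
      simpa using (hasDerivAt_id (1 : ℝ)).smul_const y
    have hf : HasFDerivAt u₂ (fderiv ℝ u₂ y) ((1 : ℝ) • y) := by
      rw [one_smul]
      exact (hC₂.differentiable (by norm_num) y).hasFDerivAt
    exact hf.comp_hasDerivAt 1 hl
  have hsl := (hasDerivAt_iff_tendsto_slope_left_right.mp hline).1
  refine ge_of_tendsto hsl ?_
  filter_upwards [self_mem_nhdsWithin,
    nhdsWithin_le_nhds (Ioo_mem_nhds (zero_lt_one' ℝ) one_lt_two)] with s hs hs2
  have hs' : s < 1 := hs
  have h1 : u₂ (s • y) ≤ u₂ y := by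
    have := hball (s • y) (by
      rw [mem_closedBall_zero_iff, norm_smul, Real.norm_of_nonneg hs2.1.le]
      nlinarith [norm_nonneg y])
    linarith
  rw [slope_def_field, one_smul]
  exact div_nonneg_of_nonpos (by linarith) (by linarith)

/-- The radial curve through `y` along which `‖·‖ ^ (-k)` moves at unit speed. -/
noncomputable def radialCurve (k σ : ℝ) (y : Euc D) (s : ℝ) : Euc D :=
  (((σ + s) / σ) ^ (-(1 / k))) • y

theorem radialCurve_zero {k σ : ℝ} (hσ : 0 < σ) (y : Euc D) : radialCurve k σ y 0 = y := by
  simp [radialCurve, div_self hσ.ne']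

theorem norm_radialCurve_rpow {k σ s : ℝ} (hk : 0 < k) (hσ : 0 < σ) (hs : 0 < σ + s) {y : Euc D}
    (hy : ‖y‖ ^ (-k) = σ) : ‖radialCurve k σ y s‖ ^ (-k) = σ + s := by
  have h : 0 < (σ + s) / σ := by positivity
  rw [radialCurve, norm_smul, Real.norm_of_nonneg (by positivity),
    Real.mul_rpow (by positivity) (norm_nonneg _), hy, ← Real.rpow_mul h.le]
  rw [show -(1 / k) * -k = 1 by field_simp, Real.rpow_one]
  field_simp

theorem hasDerivAt_radialCurve {k σ : ℝ} (hk : 0 < k) (hσ : 0 < σ) (y : Euc D) :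
    (∀ᶠ s in 𝓝 0, HasDerivAt (radialCurve k σ y)
      ((-(1 / k) * ((σ + s) / σ) ^ (-(1 / k) - 1) / σ) • y) s) ∧
    HasDerivAt (fun s => (-(1 / k) * ((σ + s) / σ) ^ (-(1 / k) - 1) / σ) • y)
      (((k + 1) / (k ^ 2 * σ ^ 2)) • y) 0 := by
  have hlin : ∀ s : ℝ, HasDerivAt (fun s : ℝ => (σ + s) / σ) (1 / σ) s := fun s =>
    ((hasDerivAt_id s).const_add σ).div_const σ
  have hev := eventually_add_pos hσ
  constructor
  · filter_upwards [hev] with s hs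
    have h := (Real.hasDerivAt_rpow_const (x := (σ + s) / σ) (p := -(1 / k))
      (Or.inl (by positivity))).comp s (hlin s)
    have h2 := h.smul_const y
    refine h2.congr_deriv ?_
    congr 1; ring
  · have h := (Real.hasDerivAt_rpow_const (x := (σ + 0) / σ) (p := -(1 / k) - 1)
      (Or.inl (by rw [add_zero, div_self hσ.ne']; norm_num))).comp 0 (hlin 0)
    have h2 := ((h.const_mul (-(1 / k))).div_const σ).smul_const y
    refine h2.congr_deriv ?_
    congr 1
    rw [add_zero, div_self hσ.ne', Real.one_rpow]
    field_simp
    ring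

theorem hasDerivAt_comp_radialCurve {u : Euc D → ℝ} {k σ : ℝ} (hk : 0 < k) (hσ : 0 < σ) {y : Euc D}
    (hu : ContDiffAt ℝ 2 u y) : ∃ g' : ℝ → ℝ,
    (∀ᶠ s in 𝓝 0, HasDerivAt (fun s => u (radialCurve k σ y s)) (g' s) s) ∧
    g' 0 = -(1 / (k * σ)) * fderiv ℝ u y y ∧
    HasDerivAt g' (1 / (k ^ 2 * σ ^ 2) *
      (fderiv ℝ (fderiv ℝ u) y y y + (k + 1) * fderiv ℝ u y y)) 0 := by
  obtain ⟨h1, h2⟩ := hasDerivAt_radialCurve hk hσ y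
  have h0 := radialCurve_zero (k := k) hσ y
  obtain ⟨h3, h4⟩ := hasDerivAt_comp_curve (u := u) (t := 0) (by rwa [h0]) h1 h2
  refine ⟨_, h3, ?_, h4.congr_deriv ?_⟩
  · rw [h0, add_zero, div_self hσ.ne', Real.one_rpow, map_smul, smul_eq_mul]
    field_simp
  · rw [h0, add_zero, div_self hσ.ne', Real.one_rpow]
    simp only [map_smul, smul_apply, smul_eq_mul]
    field_simp

/-- A radially shifted subsolution cannot touch a supersolution from below, up to a concave
barrier. -/
theorem not_isLocalMax_radialCurve {f : ℝ → ℝ} {ρ u₁ u₂ : Euc D → ℝ}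
    (hfpos : ∀ t : ℝ, 0 < t → 0 < f t) (hfmono : MonotoneOn f (Ici 0)) (hρpos : ∀ x, 0 < ρ x)
    {α k M t σ : ℝ} (hρpow : ∀ x : Euc D, 1 ≤ ‖x‖ → ρ x = ‖x‖ ^ (-α))
    (hpos₁ : ∀ x, 0 < u₁ x) (hpos₂ : ∀ x, 0 < u₂ x) (hC₁ : ContDiff ℝ 2 u₁)
    (hC₂ : ContDiff ℝ 2 u₂) (hkpos : 0 < k) (hkα : 2 * k ≤ α - 2) (hkD : k ≤ D - 2)
    (hMpos : 0 < M) {x y : Euc D} (hx : 1 ≤ ‖x‖) (hy : 1 ≤ ‖y‖) (hyx : ‖y‖ < ‖x‖)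
    (htx : ‖x‖ ^ (-k) = t) (hσy : ‖y‖ ^ (-k) = σ) (htpos : 0 < t) (htσ : t < σ)
    (hu12 : u₁ x ≤ u₂ y) (hPnn : 0 ≤ fderiv ℝ u₂ y y)
    (hΔy : ‖y‖ ^ 2 * (ρ y * f (u₂ y)) ≤
      fderiv ℝ (fderiv ℝ u₂) y y y + (D - 1) * fderiv ℝ u₂ y y)
    (hΔx : fderiv ℝ (fderiv ℝ u₁) x x x + (D - 1) * fderiv ℝ u₁ x x ≤
      ‖x‖ ^ 2 * (ρ x * f (u₁ x))) :
    ¬ IsLocalMax (fun s => u₂ (radialCurve k σ y s) - u₁ (radialCurve k t x s)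
        - 2 * M * (t + s) ^ (1 / 2 : ℝ)) 0 := by
  intro hloc
  have hσpos : 0 < σ := htpos.trans htσ
  set P := fderiv ℝ u₂ y y with hP
  set Q := fderiv ℝ u₁ x x with hQ
  set B₂ := fderiv ℝ (fderiv ℝ u₂) y y y with hB₂
  set B₁ := fderiv ℝ (fderiv ℝ u₁) x x x with hB₁
  obtain ⟨g₂, hg₂, hg₂0, hg₂'⟩ := hasDerivAt_comp_radialCurve (u := u₂) hkpos hσpos
    (y := y) hC₂.contDiffAt
  obtain ⟨g₁, hg₁, hg₁0, hg₁'⟩ := hasDerivAt_comp_radialCurve (u := u₁) hkpos htpos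
    (y := x) hC₁.contDiffAt
  have hev := eventually_add_pos htpos
  have hlin : ∀ s : ℝ, HasDerivAt (fun s : ℝ => t + s) 1 s := fun s =>
    (hasDerivAt_id s).const_add t
  have hH : ∀ᶠ s in 𝓝 (0 : ℝ), HasDerivAt (fun s => 2 * M * (t + s) ^ (1 / 2 : ℝ))
      (2 * M * (1 / 2 * (t + s) ^ (1 / 2 - 1 : ℝ))) s := by
    filter_upwards [hev] with s hs
    have := (Real.hasDerivAt_rpow_const (x := t + s) (p := 1 / 2) (Or.inl hs.ne')).comp s (hlin s)
    simpa using this.const_mul (2 * M)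
  have hH' : HasDerivAt (fun s => 2 * M * (1 / 2 * (t + s) ^ (1 / 2 - 1 : ℝ)))
      (2 * M * (1 / 2 * ((1 / 2 - 1) * t ^ (1 / 2 - 1 - 1 : ℝ)))) 0 := by
    have := (Real.hasDerivAt_rpow_const (x := t + 0) (p := 1 / 2 - 1)
      (Or.inl (by linarith))).comp 0 (hlin 0)
    simp only [add_zero, mul_one] at this
    exact (this.const_mul (1 / 2)).const_mul (2 * M)
  set H₁ : ℝ := 2 * M * (1 / 2 * t ^ (1 / 2 - 1 : ℝ)) with hH₁
  set H₂ : ℝ := 2 * M * (1 / 2 * ((1 / 2 - 1) * t ^ (1 / 2 - 1 - 1 : ℝ))) with hH₂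
  have hH₁pos : 0 < H₁ := by positivity
  have hH₂neg : H₂ < 0 := by
    have : 0 < t ^ (1 / 2 - 1 - 1 : ℝ) := by positivity
    rw [hH₂]; nlinarith [mul_pos hMpos this]
  have hG : ∀ᶠ s in 𝓝 (0 : ℝ), HasDerivAt (fun s => u₂ (radialCurve k σ y s)
      - u₁ (radialCurve k t x s) - 2 * M * (t + s) ^ (1 / 2 : ℝ))
      (g₂ s - g₁ s - 2 * M * (1 / 2 * (t + s) ^ (1 / 2 - 1 : ℝ))) s := by
    filter_upwards [hg₂, hg₁, hH] with s h2 h1 h3 using (h2.sub h1).sub h3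
  have hsecond := deriv_deriv_nonpos_of_isLocalMax hG ((hg₂'.sub hg₁').sub hH') hloc
  have hfirst := hloc.hasDerivAt_eq_zero hG.self_of_nhds
  rw [hg₂0, hg₁0, add_zero, ← hH₁, ← hP, ← hQ] at hfirst
  rw [← hP, ← hQ, ← hB₁, ← hB₂] at hsecond
  have hf12 : f (u₁ x) ≤ f (u₂ y) := hfmono (hpos₁ x).le (hpos₂ y).le hu12
  have hf1 : 0 < f (u₁ x) := hfpos _ (hpos₁ x)
  have hyn : 0 < ‖y‖ := by linarith
  have hxn : 0 < ‖x‖ := by linarith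
  have hweight : ∀ z : Euc D, 1 ≤ ‖z‖ →
      ‖z‖ ^ 2 * ρ z / (‖z‖ ^ (-k)) ^ 2 = ‖z‖ ^ (2 - α + 2 * k) := by
    intro z hz
    have hz0 : 0 < ‖z‖ := by linarith
    rw [hρpow z hz, ← Real.rpow_natCast, ← Real.rpow_natCast, ← Real.rpow_mul hz0.le,
      ← Real.rpow_add hz0, ← Real.rpow_sub hz0]
    congr 1; push_cast; ring
  have hw : ‖x‖ ^ 2 * ρ x / t ^ 2 ≤ ‖y‖ ^ 2 * ρ y / σ ^ 2 := by
    rw [← htx, ← hσy, hweight x hx, hweight y hy]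
    exact Real.rpow_le_rpow_of_nonpos hyn hyx.le (by linarith)
  have hw0 : 0 < ‖y‖ ^ 2 * ρ y / σ ^ 2 := by have := hρpos y; positivity
  have hmain : ‖x‖ ^ 2 * ρ x / t ^ 2 * f (u₁ x) ≤ ‖y‖ ^ 2 * ρ y / σ ^ 2 * f (u₂ y) :=
    mul_le_mul hw hf12 hf1.le hw0.le
  set e : ℝ := D - 2 - k with he
  have he0 : 0 ≤ e := by linarith
  have h2 : ‖y‖ ^ 2 * ρ y / σ ^ 2 * f (u₂ y) ≤ (B₂ + (D - 1) * P) / σ ^ 2 := by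
    rw [div_mul_eq_mul_div, mul_assoc]; gcongr
  have h1 : (B₁ + (D - 1) * Q) / t ^ 2 ≤ ‖x‖ ^ 2 * ρ x / t ^ 2 * f (u₁ x) := by
    rw [div_mul_eq_mul_div, mul_assoc]; gcongr
  have hQ' : Q / t = P / σ + k * H₁ := by
    field_simp at hfirst ⊢
    linarith
  have hs' : (B₂ + (k + 1) * P) / σ ^ 2 - (B₁ + (k + 1) * Q) / t ^ 2 - k ^ 2 * H₂ ≤ 0 := by
    have := mul_le_mul_of_nonneg_left hsecond (sq_nonneg k)
    rw [mul_zero] at this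
    refine le_trans (le_of_eq ?_) this
    field_simp
  have hexp₂ : (B₂ + (D - 1) * P) / σ ^ 2 = (B₂ + (k + 1) * P) / σ ^ 2 + e * (P / σ) / σ := by
    rw [he]; field_simp; ring
  have hexp₁ : (B₁ + (D - 1) * Q) / t ^ 2 = (B₁ + (k + 1) * Q) / t ^ 2 + e * (Q / t) / t := by
    rw [he]; field_simp; ring
  have hcmp : e * (P / σ) / σ ≤ e * (Q / t) / t := by
    rw [hQ']
    have : 0 ≤ P / σ := by positivity
    calc e * (P / σ) / σ ≤ e * (P / σ) / t := by gcongr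
      _ ≤ e * (P / σ + k * H₁) / t := by
        gcongr
        have := mul_pos hkpos hH₁pos
        linarith
  have : 0 < -(k ^ 2 * H₂) := by have := mul_neg_of_pos_of_neg (pow_pos hkpos 2) hH₂neg; linarith
  linarith

/-- Two entire solutions, the first of which is large, differ outside the unit ball at most by a
multiple of a negative power of the norm. -/
theorem le_add_rpow_of_isELS (hD : 3 ≤ D) {f : ℝ → ℝ} {ρ : Euc D → ℝ}
    (hfpos : ∀ t : ℝ, 0 < t → 0 < f t) (hfmono : MonotoneOn f (Ici 0))
    (hρpos : ∀ x, 0 < ρ x) {α : ℝ} (hα : 2 < α)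
    (hρpow : ∀ x : Euc D, 1 ≤ ‖x‖ → ρ x = ‖x‖ ^ (-α))
    {u₁ u₂ : Euc D → ℝ} (h₁ : IsELS ρ f u₁) (h₂ : IsELS ρ f u₂) :
    ∃ C k : ℝ, 0 < C ∧ 0 < k ∧ ∀ x : Euc D, 1 < ‖x‖ →
      u₂ x ≤ u₁ x + C * (‖x‖ ^ (-k)) ^ (1 / 2 : ℝ) := by
  obtain ⟨hC₁, hpos₁, hΔ₁, hlim₁⟩ := h₁
  obtain ⟨hC₂, hpos₂, hΔ₂, -⟩ := h₂
  have hDr : (3 : ℝ) ≤ D := by exact_mod_cast hD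
  set k : ℝ := min ((α - 2) / 2) (D - 2) with hk
  have hkpos : 0 < k := lt_min (by linarith) (by linarith)
  have hkα : 2 * k ≤ α - 2 := by have := min_le_left ((α - 2) / 2) ((D : ℝ) - 2); linarith
  have hkD : k ≤ D - 2 := min_le_right _ _
  obtain ⟨M, hM⟩ := ((isCompact_closedBall (0 : Euc D) 1).image hC₂.continuous).bddAbove
  have hM' : ∀ z : Euc D, ‖z‖ ≤ 1 → u₂ z ≤ M := fun z hz =>
    hM ⟨z, by simpa using hz, rfl⟩
  have hMpos : 0 < M := (hpos₂ 0).trans_le (hM' 0 (by simp))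
  refine ⟨2 * M, k, by linarith, hkpos, fun x₀ hx₀ => ?_⟩
  set τ₀ : ℝ := ‖x₀‖ ^ (-k) with hτ₀
  have hτ₀pos : 0 < τ₀ := by positivity
  have hτ₀1 : τ₀ < 1 := Real.rpow_lt_one_of_one_lt_of_neg hx₀ (by linarith)
  -- the shifted comparison
  have key : ∀ ε : ℝ, 0 < ε → ε ≤ 1 / 2 → τ₀ + ε ≤ 1 →
      u₂ (radialCurve k τ₀ x₀ ε) ≤ u₁ x₀ + 2 * M * τ₀ ^ (1 / 2 : ℝ) := by
    intro ε hε hε2 hε1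
    by_contra! hcon
    obtain ⟨K, hK⟩ := ((isCompact_closedBall (0 : Euc D) (ε ^ (-(1 / k)))).image
      hC₂.continuous).bddAbove
    obtain ⟨R₀, hR₀⟩ : ∃ R₀ : ℝ, ∀ x : Euc D, R₀ ≤ ‖x‖ → K ≤ u₁ x := by
      have := hlim₁.eventually_ge_atTop K
      rw [← Metric.cobounded_eq_cocompact, ← comap_norm_atTop] at this
      obtain ⟨s, hs, hs'⟩ := this
      obtain ⟨R, hR⟩ := mem_atTop_sets.mp hs
      exact ⟨R, fun y hy => hs' (hR _ hy)⟩
    set R : ℝ := max R₀ ‖x₀‖ with hR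
    let τ : Euc D → ℝ := fun x => (max ‖x‖ 1) ^ (-k)
    have hτc : Continuous τ := by
      refine (continuous_norm.max continuous_const).rpow_const fun x => Or.inl ?_
      have := le_max_right ‖x‖ (1 : ℝ); positivity
    have hτe : ∀ x : Euc D, 1 ≤ ‖x‖ → τ x = ‖x‖ ^ (-k) := fun x hx => by
      simp only [τ, max_eq_left hx]
    let S : Set (Euc D × Euc D) := {p | 1 ≤ ‖p.1‖ ∧ ‖p.1‖ ≤ R ∧ 1 ≤ ‖p.2‖ ∧ τ p.2 = τ p.1 + ε}
    have hnle : ∀ x y : Euc D, 1 ≤ ‖x‖ → 1 ≤ ‖y‖ → τ y = τ x + ε → ‖y‖ < ‖x‖ := by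
      intro x y hx hy h
      rw [hτe x hx, hτe y hy] at h
      by_contra! hc
      have := Real.rpow_le_rpow_of_nonpos (by linarith) hc (by linarith : -k ≤ 0)
      linarith
    have hyK : ∀ x y : Euc D, 1 ≤ ‖x‖ → 1 ≤ ‖y‖ → τ y = τ x + ε → u₂ y ≤ K := by
      intro x y hx hy h
      refine hK ⟨y, ?_, rfl⟩
      rw [mem_closedBall_zero_iff]
      rw [hτe x hx, hτe y hy] at h
      have h1 : ε ≤ ‖y‖ ^ (-k) := by rw [h]; have := Real.rpow_nonneg (norm_nonneg x) (-k); linarith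
      have h2 := Real.rpow_le_rpow_of_nonpos hε h1 (by have := one_div_pos.mpr hkpos; linarith :
        -(1 / k) ≤ 0)
      rwa [← Real.rpow_mul (norm_nonneg y), show -k * -(1 / k) = 1 by field_simp,
        Real.rpow_one] at h2
    have hScomp : IsCompact S := by
      refine Metric.isCompact_of_isClosed_isBounded ?_ ?_
      · refine (isClosed_le continuous_const (continuous_norm.comp continuous_fst)).inter
          ((isClosed_le (continuous_norm.comp continuous_fst) continuous_const).inter
          ((isClosed_le continuous_const (continuous_norm.comp continuous_snd)).inter
          (isClosed_eq (hτc.comp continuous_snd)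
            ((hτc.comp continuous_fst).add continuous_const))))
      · refine (Metric.isBounded_closedBall (x := (0 : Euc D × Euc D)) (r := R)).subset ?_
        rintro ⟨x, y⟩ ⟨hx, hxR, hy, h⟩
        rw [mem_closedBall_zero_iff, Prod.norm_mk]
        exact max_le hxR ((hnle x y hx hy h).le.trans hxR)
    let Ψ : Euc D × Euc D → ℝ := fun p => u₂ p.2 - u₁ p.1 - 2 * M * τ p.1 ^ (1 / 2 : ℝ)
    have hΨc : Continuous Ψ := by
      refine ((hC₂.continuous.comp continuous_snd).sub (hC₁.continuous.comp continuous_fst)).sub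
        (continuous_const.mul ?_)
      exact (hτc.comp continuous_fst).rpow_const fun _ => Or.inr (by norm_num)
    have hnc : ‖radialCurve k τ₀ x₀ ε‖ ^ (-k) = τ₀ + ε :=
      norm_radialCurve_rpow hkpos hτ₀pos (by positivity) rfl
    have hnc1 : 1 ≤ ‖radialCurve k τ₀ x₀ ε‖ := by
      by_contra! hc
      have hc0 : 0 < ‖radialCurve k τ₀ x₀ ε‖ := by
        rw [radialCurve, norm_smul, Real.norm_of_nonneg (by positivity)]; positivity
      have := Real.one_lt_rpow_of_pos_of_lt_one_of_neg hc0 hc (by linarith : -k < 0)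
      linarith
    have hmem₀ : (x₀, radialCurve k τ₀ x₀ ε) ∈ S :=
      ⟨hx₀.le, le_max_right _ _, hnc1, by rw [hτe _ hnc1, hτe _ hx₀.le, hnc]⟩
    obtain ⟨⟨x, y⟩, ⟨hx, hxR, hy, hxy⟩, hmax⟩ := hScomp.exists_isMaxOn ⟨_, hmem₀⟩ hΨc.continuousOn
    simp only at hx hxR hy hxy
    have hΨpos : 0 < u₂ y - u₁ x - 2 * M * τ x ^ (1 / 2 : ℝ) := by
      have h := hmax hmem₀
      have h' : u₂ (radialCurve k τ₀ x₀ ε) - u₁ x₀ - 2 * M * τ x₀ ^ (1 / 2 : ℝ) ≤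
        u₂ y - u₁ x - 2 * M * τ x ^ (1 / 2 : ℝ) := h
      rw [hτe x₀ hx₀.le] at h'
      linarith
    set t : ℝ := τ x with ht
    have htx : ‖x‖ ^ (-k) = t := (hτe x hx).symm
    have htpos : 0 < t := by rw [← htx]; positivity
    set σ : ℝ := t + ε with hσ
    have hσpos : 0 < σ := by positivity
    have htσ : t < σ := by linarith
    have hσy : ‖y‖ ^ (-k) = σ := by rw [← hτe y hy, hxy]
    have hx0 : x ≠ 0 := by rintro rfl; simp at hx; linarith
    have hy0 : y ≠ 0 := by rintro rfl; simp at hy; linarith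
    have hyx : ‖y‖ < ‖x‖ := hnle x y hx hy hxy
    have hHpos : 0 < 2 * M * t ^ (1 / 2 : ℝ) := by positivity
    have hxR' : ‖x‖ < R := by
      refine lt_of_le_of_ne hxR fun h => ?_
      have h1 := hR₀ x (by rw [h]; exact le_max_left _ _)
      have h2 := hyK x y hx hy hxy
      linarith
    have hy1 : 1 < ‖y‖ := by
      refine lt_of_le_of_ne hy fun h => ?_
      have h1 := hM' y h.symm.le
      rw [← h, Real.one_rpow] at hσy
      have ht2 : (1 / 2 : ℝ) ≤ t := by linarith
      have ht3 : t ≤ t ^ (1 / 2 : ℝ) := by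
        have := Real.rpow_le_rpow_of_exponent_ge htpos (by linarith : t ≤ 1)
          (by norm_num : (1 / 2 : ℝ) ≤ 1)
        rwa [Real.rpow_one] at this
      nlinarith [hpos₁ x]
    have hmaxy : ∀ z : Euc D, ‖z‖ = ‖y‖ → u₂ z ≤ u₂ y := by
      intro z hz
      have hz1 : 1 ≤ ‖z‖ := by rw [hz]; exact hy
      have h : Ψ (x, z) ≤ Ψ (x, y) := hmax ⟨hx, hxR, hz1, by rw [hτe z hz1, hz, hσy]⟩
      simp only [Ψ] at h
      linarith
    have hminx : ∀ z : Euc D, ‖z‖ = ‖x‖ → -u₁ z ≤ -u₁ x := by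
      intro z hz
      have hz1 : 1 ≤ ‖z‖ := by rw [hz]; exact hx
      have hτz : τ z = t := by rw [hτe z hz1, hz, htx]
      have h : Ψ (z, y) ≤ Ψ (x, y) :=
        hmax ⟨hz1, by simpa [hz] using hxR, hy, by simp only [hτz]; exact hxy⟩
      simp only [Ψ, hτz] at h
      linarith
    set P := fderiv ℝ u₂ y y with hP
    set Q := fderiv ℝ u₁ x x with hQ
    set B₂ := fderiv ℝ (fderiv ℝ u₂) y y y with hB₂
    set B₁ := fderiv ℝ (fderiv ℝ u₁) x x x with hB₁
    have hPnn : 0 ≤ P := radial_fderiv_nonneg (by omega) hC₂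
      (fun z => by rw [hΔ₂]; exact (mul_pos (hρpos z) (hfpos _ (hpos₂ z))).le) hmaxy
    have hΔy : ‖y‖ ^ 2 * (ρ y * f (u₂ y)) ≤ B₂ + (D - 1) * P := by
      rw [← hΔ₂]; exact laplacian_le_radial hC₂.contDiffAt hy0 hmaxy
    have hΔx : B₁ + (D - 1) * Q ≤ ‖x‖ ^ 2 * (ρ x * f (u₁ x)) := by
      rw [← hΔ₁]
      have h := laplacian_le_radial (u := fun z => -u₁ z) hC₁.neg.contDiffAt hx0 hminx
      have e1 : laplacian (fun z => -u₁ z) x = -laplacian u₁ x := by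
        have := laplacian_const_mul (-1) (u := u₁) (x := x) hC₁.contDiffAt
        simpa using this
      have e2 : fderiv ℝ (fun z => -u₁ z) = fun z => -fderiv ℝ u₁ z := by
        funext z; exact fderiv_fun_neg
      rw [e1, e2, fderiv_fun_neg] at h
      simp only [neg_apply] at h
      linarith
    have hev := eventually_add_pos htpos
    have hloc : IsLocalMax (fun s => u₂ (radialCurve k σ y s) - u₁ (radialCurve k t x s)
        - 2 * M * (t + s) ^ (1 / 2 : ℝ)) 0 := by
      have hc₂ : ContinuousAt (radialCurve k σ y) 0 :=
        (hasDerivAt_radialCurve hkpos hσpos y).1.self_of_nhds.continuousAt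
      have hc₁ : ContinuousAt (radialCurve k t x) 0 :=
        (hasDerivAt_radialCurve hkpos htpos x).1.self_of_nhds.continuousAt
      have hc₂' : Tendsto (fun s => ‖radialCurve k σ y s‖) (𝓝 0) (𝓝 ‖y‖) := by
        have := hc₂.norm.tendsto; rwa [radialCurve_zero hσpos] at this
      have hc₁' : Tendsto (fun s => ‖radialCurve k t x s‖) (𝓝 0) (𝓝 ‖x‖) := by
        have := hc₁.norm.tendsto; rwa [radialCurve_zero htpos] at this
      filter_upwards [hev, hc₂'.eventually (lt_mem_nhds hy1),
        hc₁'.eventually (lt_mem_nhds (hy1.trans hyx)), hc₁'.eventually (gt_mem_nhds hxR')]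
        with s hs hs1 hs2 hs3
      have e1 : τ (radialCurve k t x s) = t + s := by
        rw [hτe _ hs2.le, norm_radialCurve_rpow hkpos htpos hs htx]
      have e2 : τ (radialCurve k σ y s) = σ + s := by
        rw [hτe _ hs1.le, norm_radialCurve_rpow hkpos hσpos (by linarith) hσy]
      have h : Ψ (radialCurve k t x s, radialCurve k σ y s) ≤ Ψ (x, y) :=
        hmax ⟨hs2.le, hs3.le, hs1.le, by
          show τ (radialCurve k σ y s) = τ (radialCurve k t x s) + ε
          rw [e1, e2]; linarith⟩
      simp only [Ψ, e1] at h
      simpa [radialCurve_zero hσpos, radialCurve_zero htpos] using h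
    exact not_isLocalMax_radialCurve hfpos hfmono hρpos hρpow hpos₁ hpos₂ hC₁ hC₂ hkpos hkα hkD
      hMpos hx hy hyx htx hσy htpos htσ (by linarith) hPnn hΔy hΔx hloc
  have hcont : Tendsto (fun ε => u₂ (radialCurve k τ₀ x₀ ε)) (𝓝[>] 0) (𝓝 (u₂ x₀)) := by
    have hc : ContinuousAt (radialCurve k τ₀ x₀) 0 :=
      (hasDerivAt_radialCurve hkpos hτ₀pos x₀).1.self_of_nhds.continuousAt
    have := (hC₂.continuous.continuousAt.comp hc).tendsto
    simp only [Function.comp_def, radialCurve_zero hτ₀pos] at this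
    exact this.mono_left nhdsWithin_le_nhds
  refine le_of_tendsto hcont ?_
  have hm : 0 < min (1 / 2 : ℝ) (1 - τ₀) := lt_min (by norm_num) (by linarith)
  filter_upwards [self_mem_nhdsWithin, nhdsWithin_le_nhds (Iio_mem_nhds hm)] with ε hε hε'
  have hε'' : ε < min (1 / 2 : ℝ) (1 - τ₀) := hε'
  exact key ε hε (hε''.le.trans (min_le_left _ _))
    (by have := hε''.le.trans (min_le_right _ _); linarith)

/-- Two entire large solutions coincide. -/
theorem isELS_le (hD : 3 ≤ D) {f : ℝ → ℝ} {ρ : Euc D → ℝ}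
    (hfpos : ∀ t : ℝ, 0 < t → 0 < f t) (hfmono : MonotoneOn f (Ici 0))
    (hρpos : ∀ x, 0 < ρ x) {α : ℝ} (hα : 2 < α)
    (hρpow : ∀ x : Euc D, 1 ≤ ‖x‖ → ρ x = ‖x‖ ^ (-α))
    {u₁ u₂ : Euc D → ℝ} (h₁ : IsELS ρ f u₁) (h₂ : IsELS ρ f u₂) (x : Euc D) : u₂ x ≤ u₁ x := by
  obtain ⟨C, k, hC, hk, hle⟩ := le_add_rpow_of_isELS hD hfpos hfmono hρpos hα hρpow h₁ h₂
  have h := nonpos_of_laplacian_nonneg (D := D) (by omega) (w := fun x => u₂ x - u₁ x)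
    (h₂.1.sub h₁.1)
    (fun z hz => by
      rw [laplacian_sub h₂.1.contDiffAt h₁.1.contDiffAt, h₁.2.2.1, h₂.2.2.1, ← mul_sub]
      exact mul_nonneg (hρpos z).le (sub_nonneg.mpr
        (hfmono (h₁.2.1 z).le (h₂.2.1 z).le (by linarith))))
    (fun δ hδ => by
      have hlim : Tendsto (fun z : Euc D => C * (‖z‖ ^ (-k)) ^ (1 / 2 : ℝ))
          (cocompact (Euc D)) (𝓝 0) := by
        have h1 : Tendsto (fun z : Euc D => ‖z‖ ^ (-k)) (cocompact (Euc D)) (𝓝 0) :=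
          (tendsto_rpow_neg_atTop hk).comp (tendsto_norm_cocompact_atTop (E := Euc D))
        have h2 := (h1.rpow_const (p := 1 / 2) (Or.inr (by norm_num))).const_mul C
        simpa using h2
      filter_upwards [hlim.eventually (gt_mem_nhds hδ),
        (tendsto_norm_cocompact_atTop (E := Euc D)).eventually_gt_atTop 1] with z hz hz1
      linarith [hle z hz1]) x
  linarith

end Uniqueness

section Potential

variable {D : ℕ}

/-- A bounded measurable density supported in a closed ball. -/
structure IsDensity (M R : ℝ) (g : Euc D → ℝ) : Prop where
  meas : AEStronglyMeasurable g volume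
  bound : ∀ x, |g x| ≤ M
  supp : ∀ x, R < ‖x‖ → g x = 0

theorem IsDensity.nonneg {M R : ℝ} {g : Euc D → ℝ} (hg : IsDensity M R g) : 0 ≤ M :=
  (abs_nonneg _).trans (hg.bound 0)

theorem IsDensity.integrable_smul {F : Type*} [NormedAddCommGroup F] [NormedSpace ℝ F]
    {M R : ℝ} {g : Euc D → ℝ} (hg : IsDensity M R g) {k : Euc D → F}
    (hk : LocallyIntegrable k volume) (x : Euc D) :
    Integrable (fun y => g y • k (x - y)) volume := by
  have h1 : IntegrableOn k (Metric.closedBall 0 (R + ‖x‖)) volume :=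
    hk.integrableOn_isCompact (isCompact_closedBall _ _)
  have h2 : Integrable (fun y => (Metric.closedBall 0 (R + ‖x‖)).indicator k (x - y)) volume :=
    ((integrable_indicator_iff Metric.isClosed_closedBall.measurableSet).2 h1).comp_sub_left x
  refine (h2.norm.const_mul M).mono' (hg.meas.smul (hk.aestronglyMeasurable.comp_measurePreserving
    (Measure.measurePreserving_sub_left volume x))) (Eventually.of_forall fun y => ?_)
  rw [norm_smul]
  by_cases hy : R < ‖y‖
  · rw [hg.supp y hy]
    simpa using mul_nonneg hg.nonneg (norm_nonneg _)
  · rw [indicator_of_mem]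
    · exact mul_le_mul_of_nonneg_right (hg.bound y) (norm_nonneg _)
    · rw [mem_closedBall_zero_iff]
      linarith [norm_sub_le x y]

theorem IsDensity.norm_integral_smul_le {F : Type*} [NormedAddCommGroup F] [NormedSpace ℝ F]
    {M R : ℝ} {g : Euc D → ℝ} (hg : IsDensity M R g) {k : Euc D → F}
    (hk : LocallyIntegrable k volume) {S : ℝ} {x : Euc D} (hx : R + ‖x‖ ≤ S) :
    ‖∫ y, g y • k (x - y)‖ ≤ M * ∫ z in Metric.closedBall 0 S, ‖k z‖ := by
  have h1 : IntegrableOn k (Metric.closedBall 0 S) volume :=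
    hk.integrableOn_isCompact (isCompact_closedBall _ _)
  have h2 : Integrable (fun y => (Metric.closedBall 0 S).indicator k (x - y)) volume :=
    ((integrable_indicator_iff Metric.isClosed_closedBall.measurableSet).2 h1).comp_sub_left x
  calc ‖∫ y, g y • k (x - y)‖ ≤ ∫ y, M * ‖(Metric.closedBall 0 S).indicator k (x - y)‖ := by
        refine norm_integral_le_of_norm_le (h2.norm.const_mul M) (Eventually.of_forall fun y => ?_)
        rw [norm_smul]
        by_cases hy : R < ‖y‖
        · rw [hg.supp y hy]
          simpa using mul_nonneg hg.nonneg (norm_nonneg _)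
        · rw [indicator_of_mem]
          · exact mul_le_mul_of_nonneg_right (hg.bound y) (norm_nonneg _)
          · rw [mem_closedBall_zero_iff]
            linarith [norm_sub_le x y]
    _ = M * ∫ z in Metric.closedBall 0 S, ‖k z‖ := by
        rw [integral_const_mul,
          integral_sub_left_eq_self (fun y => ‖(Metric.closedBall 0 S).indicator k y‖) volume x,
          ← integral_indicator Metric.isClosed_closedBall.measurableSet]
        simp only [norm_indicator_eq_indicator_norm]

/-- The (regularised) Newtonian kernel. -/
noncomputable def newtonKer (D : ℕ) (ε : ℝ) (x : Euc D) : ℝ := (‖x‖ ^ 2 + ε) ^ (1 - D / 2 : ℝ)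

/-- The differential of the (regularised) Newtonian kernel. -/
noncomputable def newtonGrad (D : ℕ) (ε : ℝ) (x : Euc D) : Euc D →L[ℝ] ℝ :=
  ((2 - D) * (‖x‖ ^ 2 + ε) ^ (-(D : ℝ) / 2)) • innerSL ℝ x

theorem hasFDerivAt_newtonKer {ε : ℝ} (hε : 0 < ε) (x : Euc D) :
    HasFDerivAt (newtonKer D ε) (newtonGrad D ε x) x := by
  have h1 : HasFDerivAt (fun y : Euc D => ‖y‖ ^ 2 + ε) (2 • innerSL ℝ x) x :=
    (hasStrictFDerivAt_norm_sq x).hasFDerivAt.add_const ε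
  have h2 := h1.rpow_const (p := (1 - D / 2 : ℝ)) (Or.inl (by positivity))
  refine h2.congr_fderiv ?_
  unfold newtonGrad
  ext z
  simp only [smul_apply, smul_eq_mul, nsmul_eq_mul, innerSL_apply_apply]
  rw [show (1 - (D : ℝ) / 2 - 1) = -(D : ℝ) / 2 by ring]
  push_cast
  ring

theorem continuous_newtonKer {ε : ℝ} (hε : 0 < ε) : Continuous (newtonKer D ε) :=
  continuous_iff_continuousAt.2 fun x => (hasFDerivAt_newtonKer hε x).continuousAt

theorem continuous_newtonGrad {ε : ℝ} (hε : 0 < ε) : Continuous (newtonGrad D ε) := by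
  unfold newtonGrad
  refine (continuous_const.mul (Continuous.rpow_const (by fun_prop) fun x => Or.inl ?_)).smul
    (innerSL ℝ).continuous
  positivity

theorem newtonKer_le {ε : ℝ} (hD : 3 ≤ D) (hε : 0 ≤ ε) {x : Euc D} (hx : x ≠ 0) :
    newtonKer D ε x ≤ newtonKer D 0 x := by
  have hx' : 0 < ‖x‖ := norm_pos_iff.2 hx
  have hD' : (3 : ℝ) ≤ D := by exact_mod_cast hD
  exact Real.rpow_le_rpow_of_nonpos (by positivity) (by linarith) (by linarith)

theorem newtonKer_nonneg {ε : ℝ} (hε : 0 ≤ ε) (x : Euc D) : 0 ≤ newtonKer D ε x :=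
  Real.rpow_nonneg (by positivity) _

theorem norm_newtonGrad {ε : ℝ} (hε : 0 ≤ ε) (x : Euc D) :
    ‖newtonGrad D ε x‖ = |(2 - D : ℝ)| * ((‖x‖ ^ 2 + ε) ^ (-(D : ℝ) / 2) * ‖x‖) := by
  unfold newtonGrad
  rw [norm_smul, norm_mul, Real.norm_eq_abs, Real.norm_eq_abs, innerSL_apply_norm,
    abs_of_nonneg (Real.rpow_nonneg (by positivity : 0 ≤ ‖x‖ ^ 2 + ε) _), mul_assoc]

theorem norm_newtonGrad_le {ε : ℝ} (hε : 0 ≤ ε) (x : Euc D) :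
    ‖newtonGrad D ε x‖ ≤ ‖newtonGrad D 0 x‖ := by
  rw [norm_newtonGrad hε, norm_newtonGrad le_rfl]
  rcases eq_or_ne x 0 with rfl | hx
  · simp
  have hx' : 0 < ‖x‖ := norm_pos_iff.2 hx
  refine mul_le_mul_of_nonneg_left (mul_le_mul_of_nonneg_right ?_ hx'.le) (abs_nonneg _)
  refine Real.rpow_le_rpow_of_nonpos (by positivity) (by linarith) ?_
  have : (0 : ℝ) ≤ D := D.cast_nonneg
  linarith

theorem norm_newtonGrad_le_rpow {ε : ℝ} (hD : 3 ≤ D) (hε : 0 < ε) (x : Euc D) :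
    ‖newtonGrad D ε x‖ ≤ |(2 - D : ℝ)| * ε ^ (1 / 2 - D / 2 : ℝ) := by
  rw [norm_newtonGrad hε.le]
  have hD' : (3 : ℝ) ≤ D := by exact_mod_cast hD
  refine mul_le_mul_of_nonneg_left ?_ (abs_nonneg _)
  have hs : 0 < ‖x‖ ^ 2 + ε := by positivity
  calc (‖x‖ ^ 2 + ε) ^ (-(D : ℝ) / 2) * ‖x‖
      ≤ (‖x‖ ^ 2 + ε) ^ (-(D : ℝ) / 2) * (‖x‖ ^ 2 + ε) ^ (1 / 2 : ℝ) := by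
        refine mul_le_mul_of_nonneg_left ?_ (Real.rpow_nonneg hs.le _)
        rw [← Real.sqrt_eq_rpow]
        exact Real.le_sqrt_of_sq_le (by linarith)
    _ = (‖x‖ ^ 2 + ε) ^ (1 / 2 - D / 2 : ℝ) := by
        rw [← Real.rpow_add hs]; congr 1; ring
    _ ≤ _ := Real.rpow_le_rpow_of_nonpos hε (by nlinarith [sq_nonneg ‖x‖]) (by linarith)

theorem tendsto_newtonKer {x : Euc D} (hx : x ≠ 0) {e : ℕ → ℝ} (he : Tendsto e atTop (𝓝 0)) :
    Tendsto (fun n => newtonKer D (e n) x) atTop (𝓝 (newtonKer D 0 x)) := by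
  have hx' : 0 < ‖x‖ := norm_pos_iff.2 hx
  exact (tendsto_const_nhds.add he).rpow_const (Or.inl (by positivity))

theorem tendsto_newtonGrad (x : Euc D) {e : ℕ → ℝ} (he : Tendsto e atTop (𝓝 0)) :
    Tendsto (fun n => newtonGrad D (e n) x) atTop (𝓝 (newtonGrad D 0 x)) := by
  rcases eq_or_ne x 0 with rfl | hx
  · simp [newtonGrad]
  have hx' : 0 < ‖x‖ := norm_pos_iff.2 hx
  exact (((tendsto_const_nhds.add he).rpow_const (Or.inl (by positivity))).const_mul _).smul_const _

theorem locallyIntegrable_of_norm_rpow {F : Type*} [NormedAddCommGroup F]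
    (hD : 3 ≤ D) {k : Euc D → F} (hk : AEStronglyMeasurable k volume) {C q : ℝ} (hq : -(D : ℝ) < q)
    (hkb : ∀ x, ‖k x‖ ≤ C * ‖x‖ ^ q) : LocallyIntegrable k volume := by
  have : Nontrivial (Euc D) := by
    have : Nonempty (Fin D) := ⟨⟨0, by omega⟩⟩
    infer_instance
  rw [locallyIntegrable_iff]
  intro K hK
  obtain ⟨r, hr⟩ := hK.isBounded.subset_ball (0 : Euc D)
  refine IntegrableOn.mono_set ?_ hr
  have h1 : IntegrableOn (fun x : Euc D => ‖x‖ ^ q) (Metric.ball 0 r) volume := by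
    rw [integrableOn_fun_norm_addHaar (f := fun s : ℝ => s ^ q) volume]
    have h2 : IntegrableOn (fun s : ℝ => s ^ (q + D - 1)) (Ioo 0 r) volume := by
      rcases le_or_gt r 0 with h | h
      · simp [Ioo_eq_empty_of_le h]
      · exact (intervalIntegral.integrableOn_Ioo_rpow_iff h).2 (by linarith)
    refine h2.congr_fun (fun s hs => ?_) measurableSet_Ioo
    simp only [finrank_euclideanSpace, Fintype.card_fin, smul_eq_mul]
    rw [← Real.rpow_natCast, ← Real.rpow_add hs.1, Nat.cast_sub (by omega)]
    congr 1
    push_cast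
    ring
  exact (h1.const_mul C).mono' hk.restrict (Eventually.of_forall hkb)

theorem locallyIntegrable_newtonKer_zero (hD : 3 ≤ D) :
    LocallyIntegrable (newtonKer D 0) volume := by
  refine locallyIntegrable_of_norm_rpow hD (C := 1) (q := 2 - D) ?_ (by linarith) fun x => ?_
  · unfold newtonKer
    exact Measurable.aestronglyMeasurable (by fun_prop)
  · rw [Real.norm_of_nonneg (newtonKer_nonneg le_rfl x), newtonKer, add_zero, one_mul,
      ← Real.rpow_natCast, ← Real.rpow_mul (norm_nonneg x)]
    refine le_of_eq ?_
    congr 1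
    push_cast
    ring

theorem locallyIntegrable_newtonGrad_zero (hD : 3 ≤ D) :
    LocallyIntegrable (newtonGrad D 0) volume := by
  have hD' : (3 : ℝ) ≤ D := by exact_mod_cast hD
  refine locallyIntegrable_of_norm_rpow hD (C := |(2 - D : ℝ)|) (q := 1 - D) ?_ (by linarith)
    fun x => ?_
  · unfold newtonGrad
    have h : Measurable fun x : Euc D => (2 - D : ℝ) * (‖x‖ ^ 2 + 0) ^ (-(D : ℝ) / 2) := by
      fun_prop
    exact h.aestronglyMeasurable.smul (innerSL ℝ).continuous.aestronglyMeasurable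
  · rw [norm_newtonGrad le_rfl]
    refine mul_le_mul_of_nonneg_left (le_of_eq ?_) (abs_nonneg _)
    rcases eq_or_ne x 0 with rfl | hx
    · rw [norm_zero, Real.zero_rpow (by linarith), mul_zero]
    have hx' : 0 < ‖x‖ := norm_pos_iff.2 hx
    rw [add_zero, ← Real.rpow_natCast, ← Real.rpow_mul hx'.le, ← Real.rpow_add_one hx'.ne']
    congr 1
    push_cast
    ring

end Potential

section PotentialRegularity

variable {D : ℕ}

theorem IsDensity.tendstoUniformlyOn_integral (hD : 3 ≤ D) {F : Type*} [NormedAddCommGroup F]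
    [NormedSpace ℝ F]
    {M R : ℝ} {g : Euc D → ℝ} (hg : IsDensity M R g) {k : Euc D → F} {kn : ℕ → Euc D → F}
    (hk : LocallyIntegrable k volume) (hkn : ∀ n, LocallyIntegrable (kn n) volume)
    (hle : ∀ n z, z ≠ 0 → ‖kn n z‖ ≤ ‖k z‖)
    (hlim : ∀ z, z ≠ 0 → Tendsto (fun n => kn n z) atTop (𝓝 (k z))) (r : ℝ) :
    TendstoUniformlyOn (fun n x => ∫ y, g y • kn n (x - y)) (fun x => ∫ y, g y • k (x - y)) atTop
      (Metric.ball 0 r) := by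
  have : Nontrivial (Euc D) := by
    have : Nonempty (Fin D) := ⟨⟨0, by omega⟩⟩
    infer_instance
  have hae : ∀ᵐ z ∂(volume.restrict (Metric.closedBall (0 : Euc D) (R + r))), z ≠ 0 :=
    ae_restrict_of_ae (Measure.ae_ne volume 0)
  have hint : Tendsto (fun n => ∫ z in Metric.closedBall (0 : Euc D) (R + r), ‖kn n z - k z‖) atTop
      (𝓝 0) := by
    have h1 : IntegrableOn k (Metric.closedBall 0 (R + r)) volume :=
      hk.integrableOn_isCompact (isCompact_closedBall _ _)
    rw [show (0 : ℝ) = ∫ z in Metric.closedBall (0 : Euc D) (R + r), (0 : ℝ) by simp]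
    refine tendsto_integral_of_dominated_convergence (fun z => 2 * ‖k z‖)
      (fun n => ((hkn n).aestronglyMeasurable.sub hk.aestronglyMeasurable).norm.restrict)
      (h1.norm.const_mul 2) (fun n => ?_) ?_
    · filter_upwards [hae] with z hz
      rw [norm_norm]
      linarith [norm_sub_le (kn n z) (k z), hle n z hz]
    · filter_upwards [hae] with z hz
      simpa using ((hlim z hz).sub_const (k z)).norm
  rw [Metric.tendstoUniformlyOn_iff]
  intro δ hδ
  have hM := hint.const_mul M
  rw [mul_zero] at hM
  filter_upwards [hM.eventually (gt_mem_nhds hδ)] with n hn x hx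
  rw [mem_ball_zero_iff] at hx
  rw [dist_comm, dist_eq_norm, ← integral_sub (hg.integrable_smul (hkn n) x)
    (hg.integrable_smul hk x)]
  simp only [← smul_sub]
  exact (hg.norm_integral_smul_le ((hkn n).sub hk) (by linarith : R + ‖x‖ ≤ R + r)).trans_lt hn

/-- The Newtonian potential of `g`. -/
noncomputable def pot (g : Euc D → ℝ) (x : Euc D) : ℝ := ∫ y, g y • newtonKer D 0 (x - y)

theorem IsDensity.integrable {M R : ℝ} {g : Euc D → ℝ} (hg : IsDensity M R g) :
    Integrable g volume := by
  simpa using hg.integrable_smul (k := fun _ => (1 : ℝ)) (locallyIntegrable_const 1) 0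

theorem IsDensity.hasFDerivAt_integral_newtonKer (hD : 3 ≤ D) {M R : ℝ} {g : Euc D → ℝ}
    (hg : IsDensity M R g) {ε : ℝ} (hε : 0 < ε) (x : Euc D) :
    HasFDerivAt (fun x => ∫ y, g y • newtonKer D ε (x - y))
      (∫ y, g y • newtonGrad D ε (x - y)) x := by
  refine hasFDerivAt_integral_of_dominated_of_fderiv_le (s := univ)
    (F := fun x y => g y • newtonKer D ε (x - y)) (F' := fun x y => g y • newtonGrad D ε (x - y))
    (bound := fun y => |g y| * (|(2 - D : ℝ)| * ε ^ (1 / 2 - D / 2 : ℝ))) univ_mem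
    (Eventually.of_forall fun z => ?_)
    (hg.integrable_smul (continuous_newtonKer hε).locallyIntegrable x)
    (hg.integrable_smul (continuous_newtonGrad hε).locallyIntegrable x).aestronglyMeasurable
    (Eventually.of_forall fun y z _ => ?_) (hg.integrable.abs.mul_const _)
    (Eventually.of_forall fun y z _ => ?_)
  · exact (hg.integrable_smul (continuous_newtonKer hε).locallyIntegrable z).aestronglyMeasurable
  · rw [norm_smul, Real.norm_eq_abs]
    exact mul_le_mul_of_nonneg_left (norm_newtonGrad_le_rpow hD hε _) (abs_nonneg _)
  · have h := (hasFDerivAt_newtonKer hε (z - y)).comp z ((hasFDerivAt_id z).sub_const y)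
    exact h.const_smul (g y)

theorem IsDensity.continuous_integral_newtonGrad (hD : 3 ≤ D) {M R : ℝ} {g : Euc D → ℝ}
    (hg : IsDensity M R g) {ε : ℝ} (hε : 0 < ε) :
    Continuous fun x => ∫ y, g y • newtonGrad D ε (x - y) := by
  refine continuous_of_dominated
    (bound := fun y => |g y| * (|(2 - D : ℝ)| * ε ^ (1 / 2 - D / 2 : ℝ)))
    (fun x => (hg.integrable_smul (continuous_newtonGrad hε).locallyIntegrable x).aestronglyMeasurable)
    (fun x => Eventually.of_forall fun y => ?_) (hg.integrable.abs.mul_const _)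
    (Eventually.of_forall fun y => ?_)
  · rw [norm_smul, Real.norm_eq_abs]
    exact mul_le_mul_of_nonneg_left (norm_newtonGrad_le_rpow hD hε _) (abs_nonneg _)
  · exact ((continuous_newtonGrad hε).comp
      (by fun_prop : Continuous fun x : Euc D => x - y)).const_smul (g y)

theorem tendsto_sq_one_div : Tendsto (fun n : ℕ => (1 / ((n : ℝ) + 1)) ^ 2) atTop (𝓝 0) := by
  simpa using (tendsto_one_div_add_atTop_nhds_zero_nat (𝕜 := ℝ)).pow 2

theorem sq_one_div_pos (n : ℕ) : 0 < (1 / ((n : ℝ) + 1)) ^ 2 := by positivity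

theorem IsDensity.tendstoUniformlyOn_newtonKer (hD : 3 ≤ D) {M R : ℝ} {g : Euc D → ℝ}
    (hg : IsDensity M R g) (r : ℝ) :
    TendstoUniformlyOn
      (fun (n : ℕ) x => ∫ y, g y • newtonKer D ((1 / ((n : ℝ) + 1)) ^ 2) (x - y))
      (pot g) atTop (Metric.ball 0 r) :=
  hg.tendstoUniformlyOn_integral hD (locallyIntegrable_newtonKer_zero hD)
    (fun n => (continuous_newtonKer (sq_one_div_pos n)).locallyIntegrable)
    (fun n z hz => by
      rw [Real.norm_of_nonneg (newtonKer_nonneg (sq_one_div_pos n).le _),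
        Real.norm_of_nonneg (newtonKer_nonneg le_rfl _)]
      exact newtonKer_le hD (sq_one_div_pos n).le hz)
    (fun z hz => tendsto_newtonKer hz tendsto_sq_one_div) r

theorem IsDensity.tendstoUniformlyOn_newtonGrad (hD : 3 ≤ D) {M R : ℝ} {g : Euc D → ℝ}
    (hg : IsDensity M R g) (r : ℝ) :
    TendstoUniformlyOn
      (fun (n : ℕ) x => ∫ y, g y • newtonGrad D ((1 / ((n : ℝ) + 1)) ^ 2) (x - y))
      (fun x => ∫ y, g y • newtonGrad D 0 (x - y)) atTop (Metric.ball 0 r) :=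
  hg.tendstoUniformlyOn_integral hD (locallyIntegrable_newtonGrad_zero hD)
    (fun n => (continuous_newtonGrad (sq_one_div_pos n)).locallyIntegrable)
    (fun n z _ => norm_newtonGrad_le (sq_one_div_pos n).le z)
    (fun z _ => tendsto_newtonGrad z tendsto_sq_one_div) r

theorem tendsto_at_of_ball {F : Type*} [NormedAddCommGroup F] {h : ℕ → Euc D → F} {h0 : Euc D → F}
    (hu : ∀ r : ℝ, TendstoUniformlyOn h h0 atTop (Metric.ball 0 r)) (x : Euc D) :
    Tendsto (fun n => h n x) atTop (𝓝 (h0 x)) :=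
  (hu (‖x‖ + 1)).tendsto_at (by simp)

theorem IsDensity.hasFDerivAt_pot (hD : 3 ≤ D) {M R : ℝ} {g : Euc D → ℝ}
    (hg : IsDensity M R g) (x : Euc D) :
    HasFDerivAt (pot g) (∫ y, g y • newtonGrad D 0 (x - y)) x :=
  hasFDerivAt_of_tendstoUniformlyOn (s := Metric.ball 0 (‖x‖ + 1)) Metric.isOpen_ball
    (hg.tendstoUniformlyOn_newtonGrad hD _)
    (fun n z _ => hg.hasFDerivAt_integral_newtonKer hD (sq_one_div_pos n) z)
    (fun z _ => tendsto_at_of_ball (hg.tendstoUniformlyOn_newtonKer hD) z) (by simp)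

theorem IsDensity.contDiff_one_pot (hD : 3 ≤ D) {M R : ℝ} {g : Euc D → ℝ}
    (hg : IsDensity M R g) : ContDiff ℝ 1 (pot g) := by
  rw [contDiff_one_iff_fderiv]
  refine ⟨fun x => (hg.hasFDerivAt_pot hD x).differentiableAt, ?_⟩
  have e : fderiv ℝ (pot g) = fun x => ∫ y, g y • newtonGrad D 0 (x - y) :=
    funext fun x => (hg.hasFDerivAt_pot hD x).fderiv
  rw [e, continuous_iff_continuousAt]
  intro x
  exact ((hg.tendstoUniformlyOn_newtonGrad hD (‖x‖ + 1)).continuousOn (Frequently.of_forall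
    fun n => (hg.continuous_integral_newtonGrad hD (sq_one_div_pos n)).continuousOn)).continuousAt
      (Metric.isOpen_ball.mem_nhds (by simp))

theorem integral_fderiv_mul_comp_sub {g k : Euc D → ℝ} {k' : Euc D → Euc D →L[ℝ] ℝ}
    (hg : ContDiff ℝ 1 g) (hgc : HasCompactSupport g) (hk : ∀ z, HasFDerivAt k (k' z) z)
    (hk' : Continuous k') (x v : Euc D) :
    ∫ y, fderiv ℝ g y v * k (x - y) = ∫ y, g y * k' (x - y) v := by
  have hkc : Continuous k := continuous_iff_continuousAt.2 fun z => (hk z).continuousAt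
  have hd : ∀ y, HasFDerivAt (fun y => k (x - y)) (-(k' (x - y))) y := fun y => by
    have h := (hk (x - y)).comp y ((hasFDerivAt_id y).const_sub x)
    refine h.congr_fderiv ?_
    ext z
    simp
  have hkx : Continuous fun y => k (x - y) := hkc.comp (by fun_prop)
  have hkx' : Continuous fun y => k' (x - y) v := (hk'.comp (by fun_prop)).clm_apply continuous_const
  have hg' : Continuous fun y => fderiv ℝ g y v :=
    (hg.continuous_fderiv (by norm_num)).clm_apply continuous_const
  have hgc' : HasCompactSupport fun y => fderiv ℝ g y v := hgc.fderiv_apply (𝕜 := ℝ) v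
  have h := integral_mul_fderiv_eq_neg_fderiv_mul_of_integrable (μ := volume) (𝕜 := ℝ)
    (f := fun y => k (x - y)) (g := g) (v := v)
    (by
      have : (fun y => fderiv ℝ (fun y => k (x - y)) y v * g y) = fun y => -(k' (x - y) v) * g y := by
        funext y; rw [(hd y).fderiv]; simp
      rw [this]
      exact (hkx'.neg.mul hg.continuous).integrable_of_hasCompactSupport hgc.mul_left)
    ((hkx.mul hg').integrable_of_hasCompactSupport hgc'.mul_left)
    ((hkx.mul hg.continuous).integrable_of_hasCompactSupport hgc.mul_left)
    (fun y _ => (hd y).differentiableAt) (fun y _ => hg.differentiable (by norm_num) y)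
  simp only [mul_comm (fderiv ℝ g _ v)]
  rw [h, ← integral_neg]
  congr 1
  funext y
  rw [(hd y).fderiv]
  simp [mul_comm]

theorem isDensity_of_continuous {g : Euc D → ℝ} (hg : Continuous g) (hgc : HasCompactSupport g) :
    ∃ M R, IsDensity M R g := by
  obtain ⟨M, hM⟩ := hg.bounded_above_of_compact_support hgc
  obtain ⟨R, hR⟩ := hgc.isBounded.subset_closedBall (0 : Euc D)
  refine ⟨M, R, hg.aestronglyMeasurable, hM, fun x hx => ?_⟩
  by_contra h
  have := hR (subset_tsupport g h)
  rw [mem_closedBall_zero_iff] at this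
  linarith

theorem continuous_fderiv_apply {g : Euc D → ℝ} (hg : ContDiff ℝ 1 g) (v : Euc D) :
    Continuous fun y => fderiv ℝ g y v :=
  (hg.continuous_fderiv (by norm_num)).clm_apply continuous_const

theorem fderiv_pot_apply (hD : 3 ≤ D) {g : Euc D → ℝ} (hg : ContDiff ℝ 1 g)
    (hgc : HasCompactSupport g) (x v : Euc D) :
    fderiv ℝ (pot g) x v = pot (fun y => fderiv ℝ g y v) x := by
  obtain ⟨M, R, hd⟩ := isDensity_of_continuous hg.continuous hgc
  obtain ⟨M', R', hd'⟩ := isDensity_of_continuous (continuous_fderiv_apply hg v)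
    (hgc.fderiv_apply (𝕜 := ℝ) v)
  rw [(hd.hasFDerivAt_pot hD x).fderiv]
  have h1 := (ContinuousLinearMap.apply ℝ ℝ v).continuous.continuousAt.tendsto.comp
    (tendsto_at_of_ball (hd.tendstoUniformlyOn_newtonGrad hD) x)
  have h2 := tendsto_at_of_ball (hd'.tendstoUniformlyOn_newtonKer hD) x
  refine tendsto_nhds_unique h1 (h2.congr fun n => ?_)
  simp only [Function.comp_apply, ContinuousLinearMap.apply_apply, smul_eq_mul]
  rw [ContinuousLinearMap.integral_apply (hd.integrable_smul
    (continuous_newtonGrad (sq_one_div_pos n)).locallyIntegrable x)]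
  simp only [smul_apply, smul_eq_mul]
  exact integral_fderiv_mul_comp_sub hg hgc (hasFDerivAt_newtonKer (sq_one_div_pos n))
    (continuous_newtonGrad (sq_one_div_pos n)) x v

theorem contDiff_two_pot (hD : 3 ≤ D) {g : Euc D → ℝ} (hg : ContDiff ℝ 1 g)
    (hgc : HasCompactSupport g) : ContDiff ℝ 2 (pot g) := by
  obtain ⟨M, R, hd⟩ := isDensity_of_continuous hg.continuous hgc
  rw [show (2 : WithTop ℕ∞) = 1 + 1 by norm_num, contDiff_succ_iff_fderiv]
  refine ⟨fun x => (hd.hasFDerivAt_pot hD x).differentiableAt, by simp, ?_⟩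
  rw [contDiff_clm_apply_iff]
  intro v
  obtain ⟨M', R', hd'⟩ := isDensity_of_continuous (continuous_fderiv_apply hg v)
    (hgc.fderiv_apply (𝕜 := ℝ) v)
  simpa only [funext fun x => fderiv_pot_apply hD hg hgc x v] using hd'.contDiff_one_pot hD

end PotentialRegularity

section PoissonEquation

variable {D : ℕ}

theorem contDiff_newtonKer {ε : ℝ} (hε : 0 < ε) {n : WithTop ℕ∞} :
    ContDiff ℝ n (newtonKer D ε) := by
  unfold newtonKer
  exact (contDiff_norm_sq_euc.add contDiff_const).rpow_const_of_ne fun x => by positivity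

theorem fderiv_newtonKer {ε : ℝ} (hε : 0 < ε) : fderiv ℝ (newtonKer D ε) = newtonGrad D ε :=
  funext fun x => (hasFDerivAt_newtonKer hε x).fderiv

theorem contDiff_newtonGrad {ε : ℝ} (hε : 0 < ε) : ContDiff ℝ 1 (newtonGrad D ε) := by
  rw [← fderiv_newtonKer hε]
  exact (contDiff_newtonKer hε (n := 2)).fderiv_right (by norm_num)

theorem laplacian_newtonKer {ε : ℝ} (hε : 0 < ε) (x : Euc D) :
    laplacian (newtonKer D ε) x
      = (2 - D) * D * (ε * (‖x‖ ^ 2 + ε) ^ (-(D : ℝ) / 2 - 1)) := by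
  have hd : ∀ s q : ℝ, 0 < s + ε → HasDerivAt (fun s : ℝ => (s + ε) ^ q) (q * (s + ε) ^ (q - 1)) s :=
    fun s q hs => by
      simpa using ((hasDerivAt_id s).add_const ε).rpow_const (p := q) (Or.inl hs.ne')
  have hx : 0 < ‖x‖ ^ 2 + ε := by positivity
  have h := laplacian_comp_norm_sq (D := D) (x := x) (β := fun s : ℝ => (s + ε) ^ (1 - D / 2 : ℝ))
    (β' := fun s => (1 - D / 2 : ℝ) * (s + ε) ^ (-(D : ℝ) / 2))
    (b := (1 - D / 2 : ℝ) * (-(D : ℝ) / 2 * (‖x‖ ^ 2 + ε) ^ (-(D : ℝ) / 2 - 1)))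
    (by
      filter_upwards [lt_mem_nhds (by linarith : -ε < ‖x‖ ^ 2)] with s hs
      refine (hd s _ (by linarith)).congr_deriv ?_
      congr 2
      ring)
    ((hd _ _ hx).const_mul _)
  refine h.trans ?_
  have e : (‖x‖ ^ 2 + ε) ^ (-(D : ℝ) / 2)
      = (‖x‖ ^ 2 + ε) ^ (-(D : ℝ) / 2 - 1) * (‖x‖ ^ 2 + ε) := by
    rw [← Real.rpow_add_one hx.ne']
    congr 1
    ring
  rw [e]
  ring

/-- The mass of the approximate identity associated with the Newtonian kernel. -/
noncomputable def newtonMass (D : ℕ) : ℝ :=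
  ∫ z : Euc D, (1 + ‖z‖ ^ 2) ^ (-(D : ℝ) / 2 - 1)

theorem integrable_newtonMass : Integrable (fun z : Euc D => (1 + ‖z‖ ^ 2) ^ (-(D : ℝ) / 2 - 1))
    volume := by
  have h := integrable_rpow_neg_one_add_norm_sq (E := Euc D) (μ := volume) (r := (D : ℝ) + 2)
    (by simp)
  refine h.congr (Eventually.of_forall fun z => ?_)
  simp only
  congr 1
  ring

theorem newtonMass_pos : 0 < newtonMass D := by
  unfold newtonMass
  rw [integral_pos_iff_support_of_nonneg (fun z => Real.rpow_nonneg (by positivity) _)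
    integrable_newtonMass]
  have : Function.support (fun z : Euc D => (1 + ‖z‖ ^ 2) ^ (-(D : ℝ) / 2 - 1)) = univ := by
    ext z
    simpa using (Real.rpow_pos_of_pos (by positivity) _).ne'
  rw [this]
  exact isOpen_univ.measure_pos volume univ_nonempty

theorem tendsto_approx_identity {g : Euc D → ℝ} (hg : Continuous g)
    (hgc : HasCompactSupport g) (x : Euc D) :
    Tendsto (fun n : ℕ => ∫ y, g y * ((1 / ((n : ℝ) + 1)) ^ 2
      * (‖x - y‖ ^ 2 + (1 / ((n : ℝ) + 1)) ^ 2) ^ (-(D : ℝ) / 2 - 1))) atTop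
      (𝓝 (newtonMass D * g x)) := by
  obtain ⟨M, hM⟩ := hg.bounded_above_of_compact_support hgc
  have e : ∀ r : ℝ, 0 < r → ∫ y, g y * (r ^ 2 * (‖x - y‖ ^ 2 + r ^ 2) ^ (-(D : ℝ) / 2 - 1))
      = ∫ z : Euc D, (1 + ‖z‖ ^ 2) ^ (-(D : ℝ) / 2 - 1) * g (x - r • z) := fun r hr => by
    have h1 := integral_sub_left_eq_self
      (fun z => g (x - z) * (r ^ 2 * (‖z‖ ^ 2 + r ^ 2) ^ (-(D : ℝ) / 2 - 1))) volume x
    simp only [sub_sub_cancel] at h1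
    rw [h1]
    have h2 := Measure.integral_comp_smul_of_nonneg (volume : Measure (Euc D))
      (fun z => g (x - z) * (r ^ 2 * (‖z‖ ^ 2 + r ^ 2) ^ (-(D : ℝ) / 2 - 1))) r (hR := hr.le)
    rw [smul_eq_mul, eq_inv_mul_iff_mul_eq₀ (by positivity)] at h2
    rw [← h2, ← integral_const_mul]
    congr 1
    funext z
    have hz : (0 : ℝ) < 1 + ‖z‖ ^ 2 := by positivity
    have e1 : (‖r • z‖ ^ 2 + r ^ 2) ^ (-(D : ℝ) / 2 - 1)
        = r ^ (-(D : ℝ) - 2) * (1 + ‖z‖ ^ 2) ^ (-(D : ℝ) / 2 - 1) := by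
      rw [norm_smul, Real.norm_of_nonneg hr.le,
        show (r * ‖z‖) ^ 2 + r ^ 2 = r ^ 2 * (1 + ‖z‖ ^ 2) by ring,
        Real.mul_rpow (by positivity) hz.le, ← Real.rpow_natCast, ← Real.rpow_mul hr.le]
      congr 2
      push_cast
      ring
    have e2 : r ^ D * (r ^ 2 * r ^ (-(D : ℝ) - 2)) = 1 := by
      rw [← Real.rpow_natCast, ← Real.rpow_natCast, ← Real.rpow_add hr, ← Real.rpow_add hr]
      push_cast
      rw [show (D : ℝ) + (2 + (-(D : ℝ) - 2)) = 0 by ring, Real.rpow_zero]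
    rw [finrank_euclideanSpace, Fintype.card_fin, e1]
    linear_combination (g (x - r • z) * (1 + ‖z‖ ^ 2) ^ (-(D : ℝ) / 2 - 1)) * e2
  have hmeas : Continuous fun z : Euc D => (1 + ‖z‖ ^ 2) ^ (-(D : ℝ) / 2 - 1) :=
    Continuous.rpow_const (by fun_prop) fun z => Or.inl (by positivity)
  simp_rw [e _ (Nat.one_div_pos_of_nat (α := ℝ))]
  rw [newtonMass, ← integral_mul_const]
  refine tendsto_integral_of_dominated_convergence
    (fun z => (1 + ‖z‖ ^ 2) ^ (-(D : ℝ) / 2 - 1) * M) (fun n => ?_)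
    (integrable_newtonMass.mul_const M) (fun n => Eventually.of_forall fun z => ?_)
    (Eventually.of_forall fun z => ?_)
  · exact (hmeas.mul (hg.comp (by fun_prop))).aestronglyMeasurable
  · rw [norm_mul, Real.norm_of_nonneg (Real.rpow_nonneg (by positivity) _)]
    exact mul_le_mul_of_nonneg_left (hM _) (Real.rpow_nonneg (by positivity) _)
  · refine Tendsto.const_mul _ ?_
    have h : Tendsto (fun n : ℕ => x - (1 / ((n : ℝ) + 1)) • z) atTop (𝓝 (x - (0 : ℝ) • z)) :=
      tendsto_const_nhds.sub (tendsto_one_div_add_atTop_nhds_zero_nat.smul_const z)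
    rw [zero_smul, sub_zero] at h
    exact (hg.tendsto x).comp h

theorem laplacian_pot (hD : 3 ≤ D) {g : Euc D → ℝ} (hg : ContDiff ℝ 1 g)
    (hgc : HasCompactSupport g) (x : Euc D) :
    laplacian (pot g) x = (2 - D) * D * newtonMass D * g x := by
  have h1 : laplacian (pot g) x
      = ∑ i, ∫ y, fderiv ℝ g y (basisVec i) * newtonGrad D 0 (x - y) (basisVec i) := by
    refine Finset.sum_congr rfl fun i _ => ?_
    obtain ⟨M', R', hd'⟩ := isDensity_of_continuous (continuous_fderiv_apply hg (basisVec i))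
      (hgc.fderiv_apply (𝕜 := ℝ) (basisVec i))
    change fderiv ℝ (fun y => fderiv ℝ (pot g) y (basisVec i)) x (basisVec i) = _
    rw [funext fun z => fderiv_pot_apply hD hg hgc z (basisVec i),
      (hd'.hasFDerivAt_pot hD x).fderiv, ContinuousLinearMap.integral_apply (hd'.integrable_smul
        (locallyIntegrable_newtonGrad_zero hD) x)]
    simp only [smul_apply, smul_eq_mul]
  have h2 : Tendsto (fun n : ℕ => ∑ i, ∫ y, fderiv ℝ g y (basisVec i)
      * newtonGrad D ((1 / ((n : ℝ) + 1)) ^ 2) (x - y) (basisVec i)) atTop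
      (𝓝 (laplacian (pot g) x)) := by
    rw [h1]
    refine tendsto_finsetSum _ fun i _ => ?_
    obtain ⟨M', R', hd'⟩ := isDensity_of_continuous (continuous_fderiv_apply hg (basisVec i))
      (hgc.fderiv_apply (𝕜 := ℝ) (basisVec i))
    have h := (ContinuousLinearMap.apply ℝ ℝ (basisVec i : Euc D)).continuous.continuousAt.tendsto.comp
      (tendsto_at_of_ball (hd'.tendstoUniformlyOn_newtonGrad hD) x)
    simp only [Function.comp_def, ContinuousLinearMap.apply_apply] at h
    rw [ContinuousLinearMap.integral_apply (hd'.integrable_smul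
        (locallyIntegrable_newtonGrad_zero hD) x)] at h
    refine h.congr fun n => ?_
    rw [ContinuousLinearMap.integral_apply (hd'.integrable_smul
      (continuous_newtonGrad (sq_one_div_pos n)).locallyIntegrable x)]
    simp only [smul_apply, smul_eq_mul]
  refine tendsto_nhds_unique h2 ?_
  have h3 := (tendsto_approx_identity hg.continuous hgc x).const_mul ((2 - D : ℝ) * D)
  rw [← mul_assoc] at h3
  refine h3.congr fun n => ?_
  have hε := sq_one_div_pos n
  set ε : ℝ := (1 / ((n : ℝ) + 1)) ^ 2
  have hi : ∀ i, ∫ y, fderiv ℝ g y (basisVec i) * newtonGrad D ε (x - y) (basisVec i)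
      = ∫ y, g y * fderiv ℝ (fun z => newtonGrad D ε z (basisVec i)) (x - y) (basisVec i) :=
    fun i => by
      have hc : ContDiff ℝ 1 fun z => newtonGrad D ε z (basisVec i) :=
        (contDiff_newtonGrad hε).clm_apply contDiff_const
      exact integral_fderiv_mul_comp_sub hg hgc
        (fun z => (hc.differentiable (by norm_num) z).hasFDerivAt)
        (hc.continuous_fderiv (by norm_num)) x (basisVec i)
  rw [Finset.sum_congr rfl fun i _ => hi i, ← integral_finsetSum, ← integral_const_mul]
  · congr 1
    funext y
    rw [← Finset.mul_sum]
    have := laplacian_newtonKer hε (x - y)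
    unfold laplacian at this
    rw [fderiv_newtonKer hε] at this
    rw [show ∑ i, fderiv ℝ (fun z => newtonGrad D ε z (basisVec i)) (x - y) (basisVec i) = _ from this]
    ring
  · intro i _
    have hc : ContDiff ℝ 1 fun z => newtonGrad D ε z (basisVec i) :=
      (contDiff_newtonGrad hε).clm_apply contDiff_const
    have hc' := (continuous_fderiv_apply hc (basisVec i)).comp (by fun_prop : Continuous fun y => x - y)
    exact (hg.continuous.mul hc').integrable_of_hasCompactSupport hgc.mul_right

end PoissonEquation

section InverseLaplacian

variable {D : ℕ}

theorem IsDensity.abs_pot_le_of_lt (hD : 3 ≤ D) {M R : ℝ} {g : Euc D → ℝ}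
    (hg : IsDensity M R g) {x : Euc D} (hx : R < ‖x‖) :
    |pot g x| ≤ M * volume.real (Metric.closedBall (0 : Euc D) R)
      * ((‖x‖ - R) ^ 2) ^ (1 - D / 2 : ℝ) := by
  have hD' : (3 : ℝ) ≤ D := by exact_mod_cast hD
  have hs : 0 < ‖x‖ - R := by linarith
  have hi : Integrable ((Metric.closedBall (0 : Euc D) R).indicator
      fun _ => M * ((‖x‖ - R) ^ 2) ^ (1 - D / 2 : ℝ)) volume :=
    (integrable_indicator_iff Metric.isClosed_closedBall.measurableSet).2
      (continuousOn_const.integrableOn_compact (isCompact_closedBall _ _))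
  have h := norm_integral_le_of_norm_le hi (f := fun y => g y • newtonKer D 0 (x - y))
    (Eventually.of_forall fun y => by
      by_cases hy : R < ‖y‖
      · rw [hg.supp y hy]
        simpa using indicator_nonneg (fun _ _ => mul_nonneg hg.nonneg
          (Real.rpow_nonneg (sq_nonneg (‖x‖ - R)) _)) y
      · push Not at hy
        rw [indicator_of_mem (mem_closedBall_zero_iff.2 hy), norm_smul, Real.norm_eq_abs,
          Real.norm_of_nonneg (newtonKer_nonneg le_rfl _)]
        refine mul_le_mul (hg.bound y) ?_ (newtonKer_nonneg le_rfl _) hg.nonneg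
        refine Real.rpow_le_rpow_of_nonpos (by positivity) ?_ (by linarith)
        have : ‖x‖ - R ≤ ‖x - y‖ := by linarith [norm_sub_norm_le x y]
        nlinarith)
  rw [integral_indicator Metric.isClosed_closedBall.measurableSet, setIntegral_const,
    smul_eq_mul] at h
  refine h.trans (le_of_eq ?_)
  ring

theorem exists_abs_pot_le (hD : 3 ≤ D) (R : ℝ) : ∃ C : ℝ, 0 ≤ C ∧
    ∀ (M : ℝ) (g : Euc D → ℝ), IsDensity M R g → ∀ x, |pot g x| ≤ C * M := by
  have hD' : (3 : ℝ) ≤ D := by exact_mod_cast hD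
  have h0 : 0 ≤ ∫ z in Metric.closedBall 0 (R + (R + 1)), ‖newtonKer D 0 z‖ :=
    integral_nonneg fun _ => norm_nonneg _
  have h1 : 0 ≤ volume.real (Metric.closedBall (0 : Euc D) R) := measureReal_nonneg
  refine ⟨(∫ z in Metric.closedBall 0 (R + (R + 1)), ‖newtonKer D 0 z‖)
    + volume.real (Metric.closedBall (0 : Euc D) R), add_nonneg h0 h1, fun M g hg x => ?_⟩
  rcases le_or_gt ‖x‖ (R + 1) with hx | hx
  · have h := hg.norm_integral_smul_le (locallyIntegrable_newtonKer_zero hD) (x := x)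
      (S := R + (R + 1)) (by linarith)
    refine h.trans ?_
    nlinarith [mul_nonneg hg.nonneg h1]
  · refine (hg.abs_pot_le_of_lt hD (by linarith)).trans ?_
    have h2 : ((‖x‖ - R) ^ 2) ^ (1 - D / 2 : ℝ) ≤ 1 :=
      Real.rpow_le_one_of_one_le_of_nonpos (by nlinarith) (by linarith)
    have h3 := mul_le_mul_of_nonneg_left h2 (mul_nonneg hg.nonneg h1)
    nlinarith [mul_nonneg hg.nonneg h0]

theorem IsDensity.tendsto_pot (hD : 3 ≤ D) {M R : ℝ} {g : Euc D → ℝ} (hg : IsDensity M R g) :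
    Tendsto (pot g) (cocompact (Euc D)) (𝓝 0) := by
  have hD' : (3 : ℝ) ≤ D := by exact_mod_cast hD
  have hn : Tendsto (fun x : Euc D => ‖x‖) (cocompact (Euc D)) atTop := tendsto_norm_cocompact_atTop
  refine squeeze_zero_norm' (a := fun x : Euc D =>
    M * volume.real (Metric.closedBall (0 : Euc D) R) * ((‖x‖ - R) ^ 2) ^ (1 - D / 2 : ℝ)) ?_ ?_
  · filter_upwards [hn.eventually_gt_atTop R] with x hx using hg.abs_pot_le_of_lt hD hx
  · have h1 : Tendsto (fun s : ℝ => s ^ (-(D / 2 - 1 : ℝ))) atTop (𝓝 0) :=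
      tendsto_rpow_neg_atTop (by linarith)
    have h2 : Tendsto (fun x : Euc D => (‖x‖ - R) ^ 2) (cocompact (Euc D)) atTop :=
      (tendsto_pow_atTop (by norm_num)).comp (tendsto_atTop_add_const_right _ _ hn)
    have h3 := (h1.comp h2).const_mul (M * volume.real (Metric.closedBall (0 : Euc D) R))
    rw [mul_zero] at h3
    refine h3.congr fun x => ?_
    simp only [Function.comp_apply]
    congr 2
    ring

/-- The solution of `-Δw = g` vanishing at infinity. -/
noncomputable def invLap (g : Euc D → ℝ) (x : Euc D) : ℝ :=
  ((D - 2) * D * newtonMass D)⁻¹ * pot g x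

theorem newtonConst_pos (hD : 3 ≤ D) : (0 : ℝ) < (D - 2) * D * newtonMass D := by
  have hD' : (3 : ℝ) ≤ D := by exact_mod_cast hD
  have := newtonMass_pos (D := D)
  have : (0 : ℝ) < D - 2 := by linarith
  positivity

theorem IsDensity.contDiff_one_invLap (hD : 3 ≤ D) {M R : ℝ} {g : Euc D → ℝ}
    (hg : IsDensity M R g) : ContDiff ℝ 1 (invLap g) :=
  contDiff_const.mul (hg.contDiff_one_pot hD)

theorem contDiff_two_invLap (hD : 3 ≤ D) {g : Euc D → ℝ} (hg : ContDiff ℝ 1 g)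
    (hgc : HasCompactSupport g) : ContDiff ℝ 2 (invLap g) :=
  contDiff_const.mul (contDiff_two_pot hD hg hgc)

theorem laplacian_invLap (hD : 3 ≤ D) {g : Euc D → ℝ} (hg : ContDiff ℝ 1 g)
    (hgc : HasCompactSupport g) (x : Euc D) : laplacian (invLap g) x = -g x := by
  have h := laplacian_const_mul ((D - 2) * D * newtonMass D)⁻¹
    (contDiff_two_pot hD hg hgc).contDiffAt (x := x)
  rw [laplacian_pot hD hg hgc] at h
  refine h.trans ?_
  have := (newtonConst_pos hD).ne'
  rw [inv_mul_eq_iff_eq_mul₀ this]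
  ring

theorem IsDensity.tendsto_invLap (hD : 3 ≤ D) {M R : ℝ} {g : Euc D → ℝ} (hg : IsDensity M R g) :
    Tendsto (invLap g) (cocompact (Euc D)) (𝓝 0) := by
  have h := (hg.tendsto_pot hD).const_mul ((D - 2) * D * newtonMass D : ℝ)⁻¹
  rwa [mul_zero] at h

theorem exists_abs_invLap_le (hD : 3 ≤ D) (R : ℝ) : ∃ C : ℝ, 0 ≤ C ∧
    ∀ (M : ℝ) (g : Euc D → ℝ), IsDensity M R g → ∀ x, |invLap g x| ≤ C * M := by
  obtain ⟨C, hC, h⟩ := exists_abs_pot_le hD R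
  have hp := inv_pos.2 (newtonConst_pos hD)
  refine ⟨((D - 2) * D * newtonMass D : ℝ)⁻¹ * C, by positivity, fun M g hg x => ?_⟩
  rw [invLap, abs_mul, abs_of_pos hp, mul_assoc _ C M]
  exact mul_le_mul_of_nonneg_left (h M g hg x) hp.le

theorem IsDensity.invLap_sub (hD : 3 ≤ D) {M M' R R' : ℝ} {g g' : Euc D → ℝ}
    (hg : IsDensity M R g) (hg' : IsDensity M' R' g') (x : Euc D) :
    invLap (fun y => g y - g' y) x = invLap g x - invLap g' x := by
  simp only [invLap, pot, sub_smul]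
  rw [integral_sub (hg.integrable_smul (locallyIntegrable_newtonKer_zero hD) x)
    (hg'.integrable_smul (locallyIntegrable_newtonKer_zero hD) x), mul_sub]

/-- Potentials of a uniformly bounded, pointwise convergent sequence of densities converge. -/
theorem tendsto_invLap_of_tendsto (hD : 3 ≤ D) {M R : ℝ} {gn : ℕ → Euc D → ℝ} {g : Euc D → ℝ}
    (hgn : ∀ n, IsDensity M R (gn n)) (hlim : ∀ y, Tendsto (fun n => gn n y) atTop (𝓝 (g y)))
    (x : Euc D) : Tendsto (fun n => invLap (gn n) x) atTop (𝓝 (invLap g x)) := by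
  have hB : IsDensity M R ((Metric.closedBall (0 : Euc D) R).indicator fun _ => M) := by
    have hM := (hgn 0).nonneg
    refine ⟨(aestronglyMeasurable_const.indicator Metric.isClosed_closedBall.measurableSet),
      fun y => ?_, fun y hy => ?_⟩
    · by_cases hy : y ∈ Metric.closedBall (0 : Euc D) R
      · rw [indicator_of_mem hy, abs_of_nonneg hM]
      · rw [indicator_of_notMem hy, abs_zero]; exact hM
    · exact indicator_of_notMem (by simpa using hy) _
  refine Tendsto.const_mul _ ?_
  refine tendsto_integral_of_dominated_convergence
    (fun y => ‖(Metric.closedBall (0 : Euc D) R).indicator (fun _ => M) y • newtonKer D 0 (x - y)‖)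
    (fun n => ((hgn n).integrable_smul (locallyIntegrable_newtonKer_zero hD) x).aestronglyMeasurable)
    (hB.integrable_smul (locallyIntegrable_newtonKer_zero hD) x).norm
    (fun n => Eventually.of_forall fun y => ?_)
    (Eventually.of_forall fun y => (hlim y).smul_const _)
  rw [norm_smul, norm_smul]
  refine mul_le_mul_of_nonneg_right ?_ (norm_nonneg _)
  by_cases hy : R < ‖y‖
  · rw [(hgn n).supp y hy]; simp
  · rw [indicator_of_mem (by simpa using hy)]
    exact ((hgn n).bound y).trans (le_abs_self _)

theorem IsDensity.of_tendsto {M R : ℝ} {gn : ℕ → Euc D → ℝ} {g : Euc D → ℝ}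
    (hgn : ∀ n, IsDensity M R (gn n)) (hlim : ∀ y, Tendsto (fun n => gn n y) atTop (𝓝 (g y))) :
    IsDensity M R g where
  meas := aestronglyMeasurable_of_tendsto_ae atTop (fun n => (hgn n).meas)
    (Eventually.of_forall hlim)
  bound x := le_of_tendsto (hlim x).abs (Eventually.of_forall fun n => (hgn n).bound x)
  supp x hx := tendsto_nhds_unique (hlim x) (by simp [(hgn _).supp x hx])

end InverseLaplacian

section Semilinear

variable {D : ℕ}

open scoped BoundedContinuousFunction

theorem isDensity_mul_of_bounded {σ h : Euc D → ℝ} {S R M : ℝ} (hσ : IsDensity S R σ)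
    (hh : Continuous h) (hM : ∀ x, |h x| ≤ M) : IsDensity (S * M) R fun x => σ x * h x where
  meas := hσ.meas.mul hh.aestronglyMeasurable
  bound x := by
    rw [abs_mul]
    exact mul_le_mul (hσ.bound x) (hM x) (abs_nonneg _) hσ.nonneg
  supp x hx := by rw [hσ.supp x hx, zero_mul]

/-- A nonlinear integral operator: if `v` solves `v + T v = h` then `Δ v = Δ h + σ φ(v)`. -/
theorem exists_solution_operator (hD : 3 ≤ D) {σ : Euc D → ℝ} (hσ : Continuous σ)
    (hσc : HasCompactSupport σ) {φ : ℝ → ℝ} {L : ℝ} (hL : 0 ≤ L)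
    (hφL : ∀ s t, |φ s - φ t| ≤ L * |s - t|) :
    ∃ (T : (Euc D →ᵇ ℝ) → (Euc D →ᵇ ℝ)) (K : ℝ), 0 ≤ K ∧
      (∀ u x, T u x = invLap (fun y => σ y * φ (u y)) x) ∧
      (∀ u, ContDiff ℝ 1 (T u)) ∧ ∀ u v, ‖T u - T v‖ ≤ K * ‖u - v‖ := by
  obtain ⟨S, R, hd⟩ := isDensity_of_continuous hσ hσc
  obtain ⟨C, hC, hCb⟩ := exists_abs_invLap_le hD R
  have hS := hd.nonneg
  have hφc : Continuous φ := by
    have : LipschitzWith L.toNNReal φ := LipschitzWith.of_dist_le_mul fun s t => by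
      rw [Real.coe_toNNReal _ hL]; exact hφL s t
    exact this.continuous
  have hdu : ∀ u : Euc D →ᵇ ℝ, IsDensity (S * (L * ‖u‖ + |φ 0|)) R fun y => σ y * φ (u y) :=
    fun u => isDensity_mul_of_bounded hd (hφc.comp u.continuous) fun x => by
      have h1 := hφL (u x) 0
      rw [sub_zero] at h1
      have h2 : |u x| ≤ ‖u‖ := u.norm_coe_le_norm x
      have h3 := abs_add_le (φ (u x) - φ 0) (φ 0)
      rw [sub_add_cancel] at h3
      nlinarith
  refine ⟨fun u => BoundedContinuousFunction.ofNormedAddCommGroup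
    (invLap fun y => σ y * φ (u y)) ((hdu u).contDiff_one_invLap hD).continuous
    (C * (S * (L * ‖u‖ + |φ 0|))) (hCb _ _ (hdu u)), C * (S * L), by positivity, fun _ _ => rfl,
    fun u => (hdu u).contDiff_one_invLap hD, fun u v => ?_⟩
  rw [BoundedContinuousFunction.norm_le (by positivity)]
  intro x
  change ‖invLap _ x - invLap _ x‖ ≤ _
  rw [← (hdu u).invLap_sub hD (hdu v), mul_assoc, mul_assoc]
  refine hCb _ _ ?_ x
  simp only [← mul_sub]
  refine isDensity_mul_of_bounded hd
    ((hφc.comp u.continuous).sub (hφc.comp v.continuous)) fun x => ?_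
  exact (hφL _ _).trans (mul_le_mul_of_nonneg_left ((u - v).norm_coe_le_norm x) hL)

theorem exists_solution_of_integral_equation (hD : 3 ≤ D) {σ : Euc D → ℝ} (hσ : ContDiff ℝ 1 σ)
    (hσc : HasCompactSupport σ) (hσ0 : ∀ x, 0 ≤ σ x) {φ : ℝ → ℝ} (hφ : ContDiff ℝ 1 φ)
    (hφm : Monotone φ) {L : ℝ} (hφL : ∀ s t, |φ s - φ t| ≤ L * |s - t|) (a : ℝ) :
    ∃ u : Euc D → ℝ, ContDiff ℝ 2 u ∧ (∀ x, laplacian u x = σ x * φ (u x)) ∧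
      Tendsto u (cocompact (Euc D)) (𝓝 a) := by
  have hL : 0 ≤ L := by
    have := (abs_nonneg _).trans (hφL 1 0)
    simpa using this
  obtain ⟨T, K, hK, hT, hT1, hTK⟩ := exists_solution_operator hD hσ.continuous hσc hL hφL
  have hsrc : ∀ u : Euc D →ᵇ ℝ, ContDiff ℝ 1 u → ContDiff ℝ 1 fun y => σ y * φ (u y) :=
    fun u hu => hσ.mul (hφ.comp hu)
  have hcs : ∀ u : Euc D →ᵇ ℝ, HasCompactSupport fun y => σ y * φ (u y) := fun u => hσc.mul_right
  have hTeq : ∀ u : Euc D →ᵇ ℝ, (T u : Euc D → ℝ) = invLap (fun y => σ y * φ (u y)) :=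
    fun u => funext (hT u)
  have hT2 : ∀ u : Euc D →ᵇ ℝ, ContDiff ℝ 1 u → ContDiff ℝ 2 (T u) := fun u hu => by
    rw [hTeq]; exact contDiff_two_invLap hD (hsrc u hu) (hcs u)
  have hTΔ : ∀ u : Euc D →ᵇ ℝ, ContDiff ℝ 1 u → ∀ x, laplacian (T u) x = -(σ x * φ (u x)) :=
    fun u hu x => by rw [hTeq]; exact laplacian_invLap hD (hsrc u hu) (hcs u) x
  have hTlim : ∀ u : Euc D →ᵇ ℝ, ContDiff ℝ 1 u → Tendsto (T u) (cocompact (Euc D)) (𝓝 0) :=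
    fun u hu => by
      obtain ⟨M, R, hd⟩ := isDensity_of_continuous (hsrc u hu).continuous (hcs u)
      rw [hTeq]; exact hd.tendsto_invLap hD
  have hreg : ∀ (l : ℝ) (v h : Euc D →ᵇ ℝ), ContDiff ℝ 1 h → v + l • T v = h → ContDiff ℝ 1 v := by
    intro l v h hh hv
    have : (v : Euc D → ℝ) = fun x => h x - l * T v x := by
      funext x; rw [← hv]; simp
    rw [this]
    exact hh.sub (contDiff_const.mul (hT1 v))
  have hone : ∀ (l : ℝ) (v₁ v₂ h₁ h₂ : Euc D →ᵇ ℝ), 0 ≤ l → ContDiff ℝ 1 h₁ → ContDiff ℝ 1 h₂ →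
      v₁ + l • T v₁ = h₁ → v₂ + l • T v₂ = h₂ →
      ∀ x, l * T v₁ x - l * T v₂ x ≤ ‖h₁ - h₂‖ := by
    intro l v₁ v₂ h₁ h₂ hl hh₁ hh₂ e₁ e₂ x
    have hv₁ := hreg l v₁ h₁ hh₁ e₁
    have hv₂ := hreg l v₂ h₂ hh₂ e₂
    have c₁ : ContDiff ℝ 2 fun x => l * T v₁ x := contDiff_const.mul (hT2 v₁ hv₁)
    have c₂ : ContDiff ℝ 2 fun x => l * T v₂ x := contDiff_const.mul (hT2 v₂ hv₂)
    have key := nonpos_of_laplacian_nonneg (D := D) (by omega)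
      (w := fun x => (l * T v₁ x - l * T v₂ x) - ‖h₁ - h₂‖) ((c₁.sub c₂).sub contDiff_const)
      (fun z hz => by
        have hz' : ‖h₁ - h₂‖ < l * T v₁ z - l * T v₂ z := by linarith
        rw [laplacian_sub (c₁.sub c₂).contDiffAt contDiffAt_const, laplacian_const,
          laplacian_sub c₁.contDiffAt c₂.contDiffAt,
          laplacian_const_mul l (hT2 v₁ hv₁).contDiffAt,
          laplacian_const_mul l (hT2 v₂ hv₂).contDiffAt, hTΔ v₁ hv₁, hTΔ v₂ hv₂]
        have a₁ : v₁ z + l * T v₁ z = h₁ z := by rw [← e₁]; simp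
        have a₂ : v₂ z + l * T v₂ z = h₂ z := by rw [← e₂]; simp
        have a₃ : h₁ z - h₂ z ≤ ‖h₁ - h₂‖ :=
          (le_abs_self _).trans ((h₁ - h₂).norm_coe_le_norm z)
        have a₄ : φ (v₁ z) ≤ φ (v₂ z) := hφm (by linarith)
        have a₅ := mul_nonneg (mul_nonneg hl (hσ0 z)) (sub_nonneg.2 a₄)
        nlinarith)
      (fun δ hδ => by
        have h := (((hTlim v₁ hv₁).const_mul l).sub ((hTlim v₂ hv₂).const_mul l)).sub_const
          ‖h₁ - h₂‖
        refine (h.eventually (gt_mem_nhds (?_ : _ < δ))).mono fun z hz => le_of_lt hz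
        simp only [mul_zero, sub_zero, zero_sub]
        linarith [norm_nonneg (h₁ - h₂)]) x
    linarith
  have hstab : ∀ (l : ℝ) (v₁ v₂ h₁ h₂ : Euc D →ᵇ ℝ), 0 ≤ l → ContDiff ℝ 1 h₁ → ContDiff ℝ 1 h₂ →
      v₁ + l • T v₁ = h₁ → v₂ + l • T v₂ = h₂ → ‖v₁ - v₂‖ ≤ 2 * ‖h₁ - h₂‖ := by
    intro l v₁ v₂ h₁ h₂ hl hh₁ hh₂ e₁ e₂
    rw [BoundedContinuousFunction.norm_le (by positivity)]
    intro x
    have b₁ := hone l v₁ v₂ h₁ h₂ hl hh₁ hh₂ e₁ e₂ x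
    have b₂ := hone l v₂ v₁ h₂ h₁ hl hh₂ hh₁ e₂ e₁ x
    rw [norm_sub_rev] at b₂
    have a₁ : v₁ x + l * T v₁ x = h₁ x := by rw [← e₁]; simp
    have a₂ : v₂ x + l * T v₂ x = h₂ x := by rw [← e₂]; simp
    have a₃ : |h₁ x - h₂ x| ≤ ‖h₁ - h₂‖ := (h₁ - h₂).norm_coe_le_norm x
    rw [abs_le] at a₃
    change |v₁ x - v₂ x| ≤ _
    rw [abs_le]
    constructor <;> linarith
  obtain ⟨m, hm⟩ := exists_nat_gt (4 * K)
  have hm0 : (0 : ℝ) < m := by linarith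
  have hmain : ∀ j : ℕ, ∀ h : Euc D →ᵇ ℝ, ContDiff ℝ 1 h →
      ∃ v : Euc D →ᵇ ℝ, v + ((j : ℝ) / m) • T v = h := by
    intro j
    induction j with
    | zero => exact fun h _ => ⟨h, by simp⟩
    | succ j ih =>
      intro h hh
      have hsm : ∀ u : Euc D →ᵇ ℝ, ContDiff ℝ 1 (h - (1 / m : ℝ) • T u : Euc D →ᵇ ℝ) := fun u =>
        hh.sub (contDiff_const.mul (hT1 u))
      choose A hA using fun u : Euc D →ᵇ ℝ => ih (h - (1 / m : ℝ) • T u) (hsm u)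
      have hcontr : ContractingWith (1 / 2) A := by
        refine ⟨by norm_num, LipschitzWith.of_dist_le_mul fun u v => ?_⟩
        rw [dist_eq_norm, dist_eq_norm]
        have h1 := hstab (j / m) (A u) (A v) _ _ (by positivity) (hsm u) (hsm v) (hA u) (hA v)
        have h2 : (h - (1 / m : ℝ) • T u) - (h - (1 / m : ℝ) • T v)
            = (1 / m : ℝ) • (T v - T u) := by rw [smul_sub]; abel
        rw [h2, norm_smul, Real.norm_of_nonneg (by positivity)] at h1
        have h3 := hTK v u
        rw [norm_sub_rev v u] at h3
        have h4 : (1 / m : ℝ) * ‖T v - T u‖ ≤ 1 / 4 * ‖u - v‖ := by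
          rw [one_div_mul_eq_div, div_le_iff₀ hm0]
          nlinarith [norm_nonneg (u - v)]
        have h5 : ((1 / 2 : NNReal) : ℝ) = 1 / 2 := by norm_num
        rw [h5]
        linarith
      obtain ⟨v, hv⟩ : ∃ v, A v = v := ⟨_, hcontr.fixedPoint_isFixedPt⟩
      refine ⟨v, ?_⟩
      have h1 := hA v
      rw [hv] at h1
      rw [eq_sub_iff_add_eq] at h1
      rw [← h1, add_assoc, ← add_smul]
      congr 2
      push_cast
      ring
  obtain ⟨v, hv⟩ := hmain m (BoundedContinuousFunction.const _ a) contDiff_const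
  rw [div_self hm0.ne', one_smul] at hv
  have hv1 : ContDiff ℝ 1 v :=
    hreg 1 v (BoundedContinuousFunction.const _ a) contDiff_const (by rw [one_smul, hv])
  have he : (v : Euc D → ℝ) = fun x => a - T v x := by
    funext x
    have : v x + T v x = a := by
      rw [← BoundedContinuousFunction.add_apply, hv]; rfl
    linarith
  refine ⟨v, ?_, fun x => ?_, ?_⟩
  · rw [he]; exact contDiff_const.sub (hT2 v hv1)
  · have h := laplacian_sub (contDiffAt_const (c := a)) (hT2 v hv1).contDiffAt (x := x)
    rw [← he, laplacian_const, hTΔ v hv1] at h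
    rw [h]; ring
  · have h := (hTlim v hv1).const_sub a
    rw [sub_zero] at h
    rw [he]
    exact h

end Semilinear

section Approximation

variable {D : ℕ}

/-- Truncation of a `C¹` nondecreasing nonlinearity to a globally Lipschitz one. -/
theorem exists_lipschitz_truncation {f : ℝ → ℝ} (hf : ContDiffOn ℝ 1 f (Ici 0)) (hf0 : f 0 = 0)
    (hmono : MonotoneOn f (Ici 0)) {N : ℝ} (hN : 0 ≤ N) :
    ∃ (φ : ℝ → ℝ) (L : ℝ), ContDiff ℝ 1 φ ∧ Monotone φ ∧ (∀ s t, |φ s - φ t| ≤ L * |s - t|) ∧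
      ∀ t ∈ Icc 0 N, φ t = f t := by
  have hud : UniqueDiffOn ℝ (Ici (0 : ℝ)) := uniqueDiffOn_Ici 0
  have hd : ContinuousOn (derivWithin f (Ici 0)) (Ici 0) :=
    hf.continuousOn_derivWithin hud (by norm_num)
  have hdn : ∀ x, 0 ≤ derivWithin f (Ici 0) x := fun x => hmono.derivWithin_nonneg
  set g : ℝ → ℝ := fun s => derivWithin f (Ici 0) (max 0 (min s N)) with hg
  have hgc : Continuous g := hd.comp_continuous (by fun_prop) fun x => mem_Ici.2 (le_max_left _ _)
  have hφ : ∀ t, HasDerivAt (fun t => ∫ s in (0 : ℝ)..t, g s) (g t) t := fun t =>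
    (hgc.integral_hasStrictDerivAt 0 t).hasDerivAt
  obtain ⟨L, hL⟩ := isCompact_Icc.exists_bound_of_continuousOn
    (hd.mono (fun x hx => hx.1 : Icc 0 N ⊆ Ici 0))
  have hdiff : Differentiable ℝ fun t => ∫ s in (0 : ℝ)..t, g s := fun t => (hφ t).differentiableAt
  have hderiv : deriv (fun t => ∫ s in (0 : ℝ)..t, g s) = g := funext fun t => (hφ t).deriv
  refine ⟨fun t => ∫ s in (0 : ℝ)..t, g s, L, ?_, ?_, fun s t => ?_, fun t ht => ?_⟩
  · rw [contDiff_one_iff_deriv, hderiv]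
    exact ⟨hdiff, hgc⟩
  · exact monotone_of_deriv_nonneg hdiff fun t => by rw [hderiv]; exact hdn _
  · exact Convex.norm_image_sub_le_of_norm_deriv_le (fun x _ => hdiff x)
      (fun x _ => by
        rw [hderiv]
        exact hL _ ⟨le_max_left _ _, max_le hN (min_le_right _ _)⟩) convex_univ (mem_univ t)
        (mem_univ s)
  · have h := intervalIntegral.integral_eq_sub_of_hasDeriv_right_of_le (f := f) (f' := g) ht.1
      (hf.continuousOn.mono fun x hx => hx.1)
      (fun x hx => by
        have h1 := ((hf.differentiableOn (by norm_num)) x hx.1.le).hasDerivWithinAt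
        have h2 : g x = derivWithin f (Ici 0) x := by
          rw [hg]
          simp only
          rw [min_eq_left (hx.2.le.trans ht.2), max_eq_right hx.1.le]
        rw [h2]
        exact h1.mono fun y hy => (hx.1.trans hy).le)
      (hgc.intervalIntegrable _ _)
    simpa [hf0] using h

theorem eventually_le_of_tendsto_sub {w : Euc D → ℝ} {a : ℝ} (ha : a ≤ 0)
    (hw : Tendsto w (cocompact (Euc D)) (𝓝 a)) :
    ∀ δ > 0, ∀ᶠ x in cocompact (Euc D), w x ≤ δ := fun _ hδ =>
  (hw.eventually (gt_mem_nhds (ha.trans_lt hδ))).mono fun _ h => le_of_lt h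

/-- Comparison principle for bounded solutions with different weights. -/
theorem solution_le_solution (hD : 3 ≤ D) {f : ℝ → ℝ} (hf0 : f 0 = 0)
    (hmono : MonotoneOn f (Ici 0)) {σ₁ σ₂ u₁ u₂ : Euc D → ℝ} {a₁ a₂ : ℝ}
    (hσ₂ : ∀ x, 0 ≤ σ₂ x) (hσ : ∀ x, σ₂ x ≤ σ₁ x)
    (hu₁ : ContDiff ℝ 2 u₁) (hu₂ : ContDiff ℝ 2 u₂) (hn₂ : ∀ x, 0 ≤ u₂ x)
    (hΔ₁ : ∀ x, laplacian u₁ x = σ₁ x * f (u₁ x)) (hΔ₂ : ∀ x, laplacian u₂ x = σ₂ x * f (u₂ x))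
    (hl₁ : Tendsto u₁ (cocompact (Euc D)) (𝓝 a₁)) (hl₂ : Tendsto u₂ (cocompact (Euc D)) (𝓝 a₂))
    (ha : a₁ ≤ a₂) (x : Euc D) : u₁ x ≤ u₂ x := by
  have h := nonpos_of_laplacian_nonneg (D := D) (by omega) (w := fun x => u₁ x - u₂ x)
    (hu₁.sub hu₂)
    (fun z hz => by
      have hz' : u₂ z < u₁ z := by linarith
      rw [laplacian_sub hu₁.contDiffAt hu₂.contDiffAt, hΔ₁, hΔ₂, sub_nonneg]
      have h1 : f (u₂ z) ≤ f (u₁ z) := hmono (hn₂ z) ((hn₂ z).trans hz'.le) hz'.le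
      have h2 : 0 ≤ f (u₂ z) := by
        have := hmono (mem_Ici.2 le_rfl) (hn₂ z) (hn₂ z)
        rwa [hf0] at this
      exact mul_le_mul (hσ z) h1 h2 ((hσ₂ z).trans (hσ z)))
    (eventually_le_of_tendsto_sub (by linarith) (hl₁.sub hl₂)) x
  linarith

theorem exists_bounded_solution (hD : 3 ≤ D) {f : ℝ → ℝ} (hf : ContDiffOn ℝ 1 f (Ici 0))
    (hf0 : f 0 = 0) (hmono : MonotoneOn f (Ici 0)) {σ : Euc D → ℝ} (hσ : ContDiff ℝ 1 σ)
    (hσc : HasCompactSupport σ) (hσ0 : ∀ x, 0 ≤ σ x) {N : ℝ} (hN : 0 ≤ N) :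
    ∃ u : Euc D → ℝ, ContDiff ℝ 2 u ∧ (∀ x, u x ∈ Icc 0 N) ∧
      (∀ x, laplacian u x = σ x * f (u x)) ∧ Tendsto u (cocompact (Euc D)) (𝓝 N) := by
  obtain ⟨φ, L, hφ, hφm, hφL, hφf⟩ := exists_lipschitz_truncation hf hf0 hmono hN
  have hφ0 : φ 0 = 0 := by rw [hφf 0 ⟨le_rfl, hN⟩, hf0]
  obtain ⟨u, hu, hΔ, hlim⟩ := exists_solution_of_integral_equation hD hσ hσc hσ0 hφ hφm hφL N
  have h0 : ∀ x, 0 ≤ u x := fun x => by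
    have h := nonpos_of_laplacian_nonneg (D := D) (by omega) (w := fun x => 0 - u x)
      (contDiff_const.sub hu)
      (fun z hz => by
        rw [laplacian_sub contDiffAt_const hu.contDiffAt, laplacian_const, hΔ]
        have h1 : φ (u z) ≤ φ 0 := hφm (by linarith)
        rw [hφ0] at h1
        nlinarith [hσ0 z])
      (eventually_le_of_tendsto_sub (by linarith) (hlim.const_sub 0)) x
    linarith
  have hN' : ∀ x, u x ≤ N := fun x => by
    have h := nonpos_of_laplacian_nonneg (D := D) (by omega) (w := fun x => u x - N)
      (hu.sub contDiff_const)
      (fun z hz => by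
        rw [laplacian_sub hu.contDiffAt contDiffAt_const, laplacian_const, hΔ, sub_zero]
        have h1 : φ 0 ≤ φ (u z) := hφm (h0 z)
        rw [hφ0] at h1
        exact mul_nonneg (hσ0 z) h1)
      (eventually_le_of_tendsto_sub (by linarith) (hlim.sub_const N)) x
    linarith
  exact ⟨u, hu, fun x => ⟨h0 x, hN' x⟩, fun x => by rw [hΔ, hφf _ ⟨h0 x, hN' x⟩], hlim⟩

theorem laplacian_one_add_norm_sq_rpow (q : ℝ) (x : Euc D) :
    laplacian (fun y : Euc D => (1 + ‖y‖ ^ 2) ^ q) x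
      = q * (1 + ‖x‖ ^ 2) ^ (q - 2) * ((4 * (q - 1) + 2 * D) * ‖x‖ ^ 2 + 2 * D) := by
  have hd : ∀ s q : ℝ, 0 < 1 + s → HasDerivAt (fun s : ℝ => (1 + s) ^ q) (q * (1 + s) ^ (q - 1)) s :=
    fun s q hs => by
      simpa using ((hasDerivAt_id s).const_add 1).rpow_const (p := q) (Or.inl hs.ne')
  have hx : 0 < 1 + ‖x‖ ^ 2 := by positivity
  have h := laplacian_comp_norm_sq (D := D) (x := x) (β := fun s : ℝ => (1 + s) ^ q)
    (β' := fun s => q * (1 + s) ^ (q - 1))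
    (b := q * ((q - 1) * (1 + ‖x‖ ^ 2) ^ (q - 1 - 1)))
    (by
      filter_upwards [lt_mem_nhds (by linarith : -1 < ‖x‖ ^ 2)] with s hs
      exact hd s _ (by linarith))
    ((hd _ _ hx).const_mul _)
  refine h.trans ?_
  have e : (1 + ‖x‖ ^ 2) ^ (q - 1) = (1 + ‖x‖ ^ 2) ^ (q - 2) * (1 + ‖x‖ ^ 2) := by
    rw [← Real.rpow_add_one hx.ne']
    congr 1
    ring
  rw [e, show q - 1 - 1 = q - 2 by ring]
  ring

/-- A strictly superharmonic function vanishing at infinity and dominating the weight. -/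
theorem exists_superharmonic_barrier (hD : 3 ≤ D) {ρ : Euc D → ℝ} (hρ : Continuous ρ) {α : ℝ}
    (hα : 2 < α) (hρpow : ∀ x : Euc D, 1 ≤ ‖x‖ → ρ x = ‖x‖ ^ (-α)) :
    ∃ ψ : Euc D → ℝ, ContDiff ℝ 2 ψ ∧ (∀ x, laplacian ψ x ≤ -ρ x) ∧
      Tendsto ψ (cocompact (Euc D)) (𝓝 0) := by
  have hD' : (3 : ℝ) ≤ D := by exact_mod_cast hD
  obtain ⟨κ, hκ0, hκ⟩ : ∃ κ : ℝ, 0 < κ ∧ κ < min (α - 2) (D - 2) :=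
    exists_between (lt_min (by linarith) (by linarith))
  obtain ⟨hκα, hκD⟩ := lt_min_iff.1 hκ
  have hpos : ∀ x : Euc D, (0 : ℝ) < 1 + ‖x‖ ^ 2 := fun x => by positivity
  obtain ⟨C₁, hC₁⟩ := (isCompact_closedBall (0 : Euc D) 1).exists_bound_of_continuousOn
    (f := fun x : Euc D => ρ x * (1 + ‖x‖ ^ 2) ^ ((κ + 2) / 2))
    (hρ.mul (Continuous.rpow_const (by fun_prop) fun x => Or.inl (hpos x).ne')).continuousOn
  have hC₁0 : 0 ≤ C₁ := (norm_nonneg _).trans (hC₁ 0 (by simp))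
  set C := C₁ + 2 ^ ((κ + 2) / 2) with hC
  have h2 : (0 : ℝ) < 2 ^ ((κ + 2) / 2) := by positivity
  have hρC : ∀ x, ρ x ≤ C * (1 + ‖x‖ ^ 2) ^ (-(κ + 2) / 2) := fun x => by
    rw [show -(κ + 2) / 2 = -((κ + 2) / 2) by ring, Real.rpow_neg (hpos x).le, ← div_eq_mul_inv,
      le_div_iff₀ (Real.rpow_pos_of_pos (hpos x) _)]
    rcases le_or_gt ‖x‖ 1 with hx | hx
    · have := (le_abs_self _).trans (hC₁ x (by simpa using hx))
      linarith
    · rw [hρpow x hx.le]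
      have hx0 : 0 < ‖x‖ := by linarith
      calc ‖x‖ ^ (-α) * (1 + ‖x‖ ^ 2) ^ ((κ + 2) / 2)
          ≤ ‖x‖ ^ (-α) * (2 * ‖x‖ ^ 2) ^ ((κ + 2) / 2) := by
            gcongr
            nlinarith
        _ = 2 ^ ((κ + 2) / 2) * ‖x‖ ^ (κ + 2 - α) := by
            rw [Real.mul_rpow (by norm_num) (by positivity), ← Real.rpow_natCast ‖x‖ 2,
              ← Real.rpow_mul hx0.le, mul_left_comm, ← Real.rpow_add hx0]
            congr 2
            push_cast
            ring
        _ ≤ 2 ^ ((κ + 2) / 2) * 1 := by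
            gcongr
            exact Real.rpow_le_one_of_one_le_of_nonpos hx.le (by linarith)
        _ ≤ C := by linarith
  set c := κ * (D - 2 - κ) with hc
  have hc0 : 0 < c := mul_pos hκ0 (by linarith)
  have hsm : ContDiff ℝ 2 fun y : Euc D => (1 + ‖y‖ ^ 2) ^ (-κ / 2) :=
    (contDiff_const.add contDiff_norm_sq_euc).rpow_const_of_ne fun x => (hpos x).ne'
  refine ⟨fun x => C / c * (1 + ‖x‖ ^ 2) ^ (-κ / 2), contDiff_const.mul hsm, fun x => ?_, ?_⟩
  · rw [laplacian_const_mul _ hsm.contDiffAt, laplacian_one_add_norm_sq_rpow]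
    have e : (1 + ‖x‖ ^ 2) ^ (-(κ + 2) / 2) = (1 + ‖x‖ ^ 2) ^ (-κ / 2 - 2) * (1 + ‖x‖ ^ 2) := by
      rw [← Real.rpow_add_one (hpos x).ne']
      congr 1
      ring
    have h3 := hρC x
    rw [e] at h3
    set P := (1 + ‖x‖ ^ 2) ^ (-κ / 2 - 2)
    have hP : 0 < P := Real.rpow_pos_of_pos (hpos x) _
    have h4 : (2 * D - 4 - 2 * κ) * (1 + ‖x‖ ^ 2) ≤ (4 * (-κ / 2 - 1) + 2 * D) * ‖x‖ ^ 2 + 2 * D := by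
      nlinarith
    have h5 : C / c * (-κ / 2 * P * ((4 * (-κ / 2 - 1) + 2 * D) * ‖x‖ ^ 2 + 2 * D))
        ≤ C / c * (-κ / 2 * P * ((2 * D - 4 - 2 * κ) * (1 + ‖x‖ ^ 2))) := by
      refine mul_le_mul_of_nonneg_left ?_ (by positivity)
      nlinarith [mul_pos hκ0 hP]
    have h6 : C / c * (-κ / 2 * P * ((2 * D - 4 - 2 * κ) * (1 + ‖x‖ ^ 2)))
        = -(C * (P * (1 + ‖x‖ ^ 2))) := by
      rw [div_mul_eq_mul_div, div_eq_iff hc0.ne', hc]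
      ring
    linarith
  · have hn : Tendsto (fun x : Euc D => ‖x‖) (cocompact (Euc D)) atTop :=
      tendsto_norm_cocompact_atTop
    have h3 : Tendsto (fun x : Euc D => 1 + ‖x‖ ^ 2) (cocompact (Euc D)) atTop :=
      tendsto_atTop_add_const_left _ _ ((tendsto_pow_atTop (by norm_num)).comp hn)
    have h4 := ((tendsto_rpow_neg_atTop (by linarith : 0 < κ / 2)).comp h3).const_mul (C / c)
    rw [mul_zero] at h4
    refine h4.congr fun x => ?_
    simp only [Function.comp_apply, neg_div]

/-- Increasing compactly supported approximations of the constant one. -/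
theorem exists_cutoff_sequence : ∃ χ : ℕ → Euc D → ℝ, (∀ k, ContDiff ℝ 2 (χ k)) ∧
    (∀ k, HasCompactSupport (χ k)) ∧ (∀ k x, χ k x ∈ Icc (0 : ℝ) 1) ∧ (∀ k x, χ k x ≤ χ (k + 1) x) ∧
    ∀ (k : ℕ) x, ‖x‖ ^ 2 ≤ k → χ k x = 1 := by
  refine ⟨fun k x => Real.smoothTransition (k + 1 - ‖x‖ ^ 2), fun k => ?_, fun k => ?_,
    fun k x => ⟨Real.smoothTransition.nonneg _, Real.smoothTransition.le_one _⟩, fun k x => ?_,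
    fun k x hx => Real.smoothTransition.one_of_one_le (by linarith)⟩
  · exact Real.smoothTransition.contDiff.comp (contDiff_const.sub contDiff_norm_sq_euc)
  · refine HasCompactSupport.intro (isCompact_closedBall (0 : Euc D) (k + 1)) fun x hx => ?_
    refine Real.smoothTransition.zero_of_nonpos ?_
    rw [mem_closedBall_zero_iff, not_le] at hx
    nlinarith [(k.cast_nonneg : (0 : ℝ) ≤ k)]
  · refine Real.smoothTransition.monotone ?_
    push_cast
    linarith

end Approximation

section KellerOsserman

variable {D : ℕ}

/-- The Laplacian of a composition with a scalar function. -/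
theorem laplacian_comp {u : Euc D → ℝ} {β β' : ℝ → ℝ} {b : ℝ} {x : Euc D}
    (hu : ContDiffAt ℝ 2 u x)
    (h₁ : ∀ᶠ s in 𝓝 (u x), HasDerivAt β (β' s) s) (h₂ : HasDerivAt β' b (u x)) :
    laplacian (fun y : Euc D => β (u y)) x
      = b * ∑ i, (fderiv ℝ u x (basisVec i)) ^ 2 + β' (u x) * laplacian u x := by
  have hfd : ∀ᶠ y in 𝓝 x, HasFDerivAt (fun y => β (u y)) (β' (u y) • fderiv ℝ u y) y := by
    filter_upwards [hu.continuousAt.eventually h₁, hu.eventually (by simp)] with y hy h2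
    exact hy.comp_hasFDerivAt y (h2.differentiableAt (by norm_num)).hasFDerivAt
  have hd2 := differentiableAt_fderiv_of_contDiffAt hu
  rw [laplacian, laplacian, Finset.mul_sum, Finset.mul_sum, ← Finset.sum_add_distrib]
  refine Finset.sum_congr rfl fun i _ => ?_
  change fderiv ℝ (fun y => fderiv ℝ (fun y => β (u y)) y (basisVec i)) x (basisVec i) = _
  have e : (fun y => fderiv ℝ (fun y => β (u y)) y (basisVec i))
      =ᶠ[𝓝 x] fun y => β' (u y) * fderiv ℝ u y (basisVec i) := by
    filter_upwards [hfd] with y hy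
    rw [hy.fderiv]
    rfl
  have h3 : HasFDerivAt (fun y => β' (u y)) (b • fderiv ℝ u x) x :=
    h₂.comp_hasFDerivAt x (hu.differentiableAt (by norm_num)).hasFDerivAt
  have h4 : DifferentiableAt ℝ (fun y => fderiv ℝ u y (basisVec i)) x :=
    hd2.clm_apply (differentiableAt_const _)
  have h5 : HasFDerivAt (fun y => β' (u y) * fderiv ℝ u y (basisVec i)) _ x :=
    h3.mul h4.hasFDerivAt
  rw [e.fderiv_eq, h5.fderiv]
  simp only [add_apply, smul_apply, smul_eq_mul]
  change β' (u x) * fderiv ℝ (fun y => fderiv ℝ u y (basisVec i)) x (basisVec i) + _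
    = _ + β' (u x) * fderiv ℝ (fun y => fderiv ℝ u y (basisVec i)) x (basisVec i)
  ring

/-- The Keller–Osserman transform `Φ(t) = ∫_t^∞ F^{-1/2}` and its properties. -/
theorem exists_kellerOsserman_transform {f : ℝ → ℝ} (hfc : ContinuousOn f (Ici 0))
    (hfpos : ∀ t : ℝ, 0 < t → 0 < f t) (hfmono : MonotoneOn f (Ici 0))
    (hKO : ∃ b : ℝ, 0 < b ∧
      IntegrableOn (fun s => 1 / Real.sqrt (∫ t in (0:ℝ)..s, f t)) (Ici b)) :
    ∃ (Φ g : ℝ → ℝ) (b K : ℝ), 0 < b ∧ 0 < K ∧ (∀ t, 0 < t → 0 < g t) ∧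
      (∀ t, 0 < t → HasDerivAt Φ (-g t) t) ∧
      (∀ t, 0 < t → HasDerivAt g (-(1 / 2 * f t * g t ^ 3)) t) ∧
      (∀ t, b ≤ t → 0 < Φ t) ∧ (∀ t, b ≤ t → 1 ≤ K * (f t * g t)) ∧ Tendsto Φ atTop (𝓝 0) := by
  obtain ⟨b, hb, hint⟩ := hKO
  set F : ℝ → ℝ := fun s => ∫ t in (0 : ℝ)..s, f t with hF
  have hii : ∀ s, 0 ≤ s → IntervalIntegrable f volume 0 s := fun s hs =>
    ContinuousOn.intervalIntegrable (hfc.mono (by rw [uIcc_of_le hs]; exact fun x hx => hx.1))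
  have hFd : ∀ s, 0 < s → HasDerivAt F (f s) s := fun s hs =>
    intervalIntegral.integral_hasDerivAt_right (hii s hs.le)
      ((hfc.mono Ioi_subset_Ici_self).stronglyMeasurableAtFilter isOpen_Ioi s hs)
      (hfc.continuousAt (Ici_mem_nhds hs))
  have hFpos : ∀ s, 0 < s → 0 < F s := fun s hs =>
    intervalIntegral.intervalIntegral_pos_of_pos_on (hii s hs.le) (fun x hx => hfpos x hx.1) hs
  have hFle : ∀ s, 0 < s → F s ≤ s * f s := fun s hs => by
    have h := intervalIntegral.integral_mono_on hs.le (hii s hs.le)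
      (intervalIntegrable_const (c := f s)) (fun x hx => hfmono hx.1 hs.le hx.2)
    simpa using h
  set g : ℝ → ℝ := fun s => 1 / Real.sqrt (F s) with hg
  have hgpos : ∀ t, 0 < t → 0 < g t := fun t ht => one_div_pos.2 (Real.sqrt_pos.2 (hFpos t ht))
  have hgd : ∀ t, 0 < t → HasDerivAt g (-(1 / 2 * f t * g t ^ 3)) t := fun t ht => by
    have hs := Real.sqrt_pos.2 (hFpos t ht)
    have h := ((hFd t ht).sqrt (hFpos t ht).ne').inv hs.ne'
    have hg' : g = fun s => (Real.sqrt (F s))⁻¹ := funext fun s => one_div _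
    rw [hg']
    refine h.congr_deriv ?_
    field_simp
  have hgc : ContinuousOn g (Ioi 0) := fun t ht => (hgd t ht).continuousAt.continuousWithinAt
  have hganti : AntitoneOn g (Ioi 0) := by
    refine antitoneOn_of_deriv_nonpos (convex_Ioi 0) hgc ?_ ?_
    · rw [interior_Ioi]
      exact fun t ht => (hgd t ht).differentiableAt.differentiableWithinAt
    · rw [interior_Ioi]
      intro t ht
      rw [(hgd t ht).deriv]
      have := hfpos t ht
      have := hgpos t ht
      have : 0 ≤ 1 / 2 * f t * g t ^ 3 := by positivity
      linarith
  set I := ∫ s in Ioi b, g s with hI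
  set Φ : ℝ → ℝ := fun t => I - ∫ s in b..t, g s with hΦ
  have hΦd : ∀ t, 0 < t → HasDerivAt Φ (-g t) t := fun t ht => by
    refine HasDerivAt.const_sub I ?_
    refine intervalIntegral.integral_hasDerivAt_right ?_
      (hgc.stronglyMeasurableAtFilter isOpen_Ioi t ht) (hgd t ht).continuousAt
    refine ContinuousOn.intervalIntegrable (hgc.mono fun x hx => ?_)
    exact (lt_min hb ht).trans_le hx.1
  have hΦlim : Tendsto Φ atTop (𝓝 0) := by
    have h := (intervalIntegral_tendsto_integral_Ioi b (hint.mono_set Ioi_subset_Ici_self)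
      tendsto_id).const_sub I
    rw [sub_self] at h
    exact h
  have hΦanti : StrictAntiOn Φ (Ioi 0) := by
    refine strictAntiOn_of_deriv_neg (convex_Ioi 0)
      (fun t ht => (hΦd t ht).continuousAt.continuousWithinAt) ?_
    rw [interior_Ioi]
    intro t ht
    rw [(hΦd t ht).deriv]
    linarith [hgpos t ht]
  have hΦpos : ∀ t, 0 < t → 0 < Φ t := fun t ht => by
    have h1 : Φ (t + 1) < Φ t := hΦanti ht (by simp; linarith) (by linarith)
    have h2 : 0 ≤ Φ (t + 1) := by
      refine le_of_tendsto hΦlim ?_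
      filter_upwards [eventually_gt_atTop (t + 1)] with s hs
      exact (hΦanti (by simp; linarith) (by simp; linarith) hs).le
    linarith
  refine ⟨Φ, g, b, 2 * Φ (b / 2), hb, by have := hΦpos (b / 2) (by linarith); positivity, hgpos, hΦd,
    hgd, fun t ht => hΦpos t (by linarith), fun t ht => ?_, hΦlim⟩
  have ht0 : 0 < t := by linarith
  obtain ⟨ξ, hξ, hξe⟩ := exists_hasDerivAt_eq_slope Φ (fun s => -g s) (by linarith : t / 2 < t)
    (fun s hs => (hΦd s (by linarith [hs.1])).continuousAt.continuousWithinAt)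
    (fun s hs => hΦd s (by linarith [hs.1]))
  have h1 : g t ≤ g ξ := hganti (by simp; linarith [hξ.1]) ht0 hξ.2.le
  have h2 : Φ (t / 2) ≤ Φ (b / 2) := hΦanti.antitoneOn (by simp; linarith) (by simp; linarith)
    (by linarith)
  have h3 := hΦpos t ht0
  have h4 : g t * t ≤ 2 * Φ (b / 2) := by
    rw [eq_div_iff (by linarith)] at hξe
    nlinarith
  have h5 : F t * g t ^ 2 = 1 := by
    simp only [hg]
    rw [div_pow, Real.sq_sqrt (hFpos t ht0).le, one_pow, mul_one_div_cancel (hFpos t ht0).ne']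
  have h6 := hgpos t ht0
  have h7 := hfpos t ht0
  calc (1 : ℝ) = F t * g t ^ 2 := h5.symm
    _ ≤ t * f t * g t ^ 2 := by gcongr; exact hFle t ht0
    _ = (g t * t) * (f t * g t) := by ring
    _ ≤ _ := by gcongr

theorem contDiffOn_two_of_hasDerivAt {φ φ' φ'' : ℝ → ℝ} {s : Set ℝ} (hs : IsOpen s)
    (h₁ : ∀ t ∈ s, HasDerivAt φ (φ' t) t) (h₂ : ∀ t ∈ s, HasDerivAt φ' (φ'' t) t)
    (hc : ContinuousOn φ'' s) : ContDiffOn ℝ 2 φ s := by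
  have e : (2 : WithTop ℕ∞) = 1 + 1 := by norm_num
  have h1 : ContDiffOn ℝ 1 φ' s := by
    rw [show (1 : WithTop ℕ∞) = 0 + 1 by norm_num, contDiffOn_succ_iff_deriv_of_isOpen hs]
    exact ⟨fun t ht => (h₂ t ht).differentiableAt.differentiableWithinAt, by simp,
      (contDiffOn_zero.2 hc).congr fun t ht => (h₂ t ht).deriv⟩
  rw [e, contDiffOn_succ_iff_deriv_of_isOpen hs]
  exact ⟨fun t ht => (h₁ t ht).differentiableAt.differentiableWithinAt, by simp,
    h1.congr fun t ht => (h₁ t ht).deriv⟩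

/-- The Keller–Osserman a priori bound on balls. -/
theorem exists_kellerOsserman_bound {f : ℝ → ℝ} (hfc : ContinuousOn f (Ici 0))
    (hfpos : ∀ t : ℝ, 0 < t → 0 < f t) (hfmono : MonotoneOn f (Ici 0))
    (hKO : ∃ b : ℝ, 0 < b ∧
      IntegrableOn (fun s => 1 / Real.sqrt (∫ t in (0:ℝ)..s, f t)) (Ici b))
    {ρ : Euc D → ℝ} (hρ : Continuous ρ) (hρpos : ∀ x, 0 < ρ x) {r : ℝ} (hr : 0 ≤ r) :
    ∃ C : ℝ, ∀ u : Euc D → ℝ, ContDiff ℝ 2 u → (∀ x, laplacian u x = ρ x * f (u x)) →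
      ∀ x, ‖x‖ ≤ r → u x ≤ C := by
  obtain ⟨Φ, g, b, K, hb, hK, hgpos, hΦd, hgd, hΦpos, hKg, hΦlim⟩ :=
    exists_kellerOsserman_transform hfc hfpos hfmono hKO
  set R := r + 1 with hR
  obtain ⟨c, hc0, hc⟩ : ∃ c : ℝ, 0 < c ∧ ∀ x : Euc D, ‖x‖ ≤ R → c ≤ ρ x := by
    obtain ⟨y, _, hy⟩ := (isCompact_closedBall (0 : Euc D) R).exists_isMinOn ⟨0, by simp; linarith⟩
      hρ.continuousOn
    exact ⟨ρ y, hρpos y, fun x hx => hy (mem_closedBall_zero_iff.2 hx)⟩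
  have hD0 : (0 : ℝ) ≤ D := D.cast_nonneg
  obtain ⟨κ, hκ0, hκ1, hκ2, hκ3⟩ : ∃ κ : ℝ, 0 < κ ∧ κ * R ^ 2 < Φ b ∧ 2 * κ ^ 2 * R ^ 2 < c / 2 ∧
      2 * D * κ * K < c / 2 := by
    have h1 : Tendsto (fun κ : ℝ => κ * R ^ 2) (𝓝 0) (𝓝 (0 * R ^ 2)) :=
      Continuous.tendsto (by fun_prop) 0
    have h2 : Tendsto (fun κ : ℝ => 2 * κ ^ 2 * R ^ 2) (𝓝 0) (𝓝 (2 * 0 ^ 2 * R ^ 2)) :=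
      Continuous.tendsto (by fun_prop) 0
    have h3 : Tendsto (fun κ : ℝ => 2 * D * κ * K) (𝓝 0) (𝓝 (2 * D * 0 * K)) :=
      Continuous.tendsto (by fun_prop) 0
    have h : ∀ᶠ κ in 𝓝 (0 : ℝ), κ * R ^ 2 < Φ b ∧ 2 * κ ^ 2 * R ^ 2 < c / 2 ∧
        2 * D * κ * K < c / 2 :=
      (h1.eventually (gt_mem_nhds (by simpa using hΦpos b le_rfl))).and
        ((h2.eventually (gt_mem_nhds (by simpa using hc0))).and
          (h3.eventually (gt_mem_nhds (by simpa using hc0))))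
    obtain ⟨κ, hκ, hκ0⟩ := ((h.filter_mono nhdsWithin_le_nhds).and
      (self_mem_nhdsWithin : Ioi (0 : ℝ) ∈ 𝓝[>] 0)).exists
    exact ⟨κ, hκ0, hκ⟩
  have hm : 0 < κ * (R ^ 2 - r ^ 2) := mul_pos hκ0 (by nlinarith)
  obtain ⟨C, hC⟩ := (hΦlim.eventually (gt_mem_nhds hm)).exists_forall_of_atTop
  refine ⟨C, fun u hu hΔ x hx => ?_⟩
  by_contra! hCx
  set w : Euc D → ℝ := fun y => κ * (R ^ 2 - ‖y‖ ^ 2) - Φ (max (u y) b) with hw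
  have hΦc : ContinuousOn Φ (Ici b) := fun t ht =>
    (hΦd t (hb.trans_le ht)).continuousAt.continuousWithinAt
  have hwc : Continuous w := by
    have h1 : Continuous fun y => Φ (max (u y) b) :=
      hΦc.comp_continuous (hu.continuous.max continuous_const) fun y => mem_Ici.2 (le_max_right _ _)
    have h2 : Continuous fun y : Euc D => κ * (R ^ 2 - ‖y‖ ^ 2) := by fun_prop
    exact h2.sub h1
  have hwx : 0 < w x := by
    have h1 := hC (max (u x) b) (hCx.le.trans (le_max_left _ _))
    have h2 : ‖x‖ ^ 2 ≤ r ^ 2 := by gcongr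
    simp only [hw]
    nlinarith
  obtain ⟨y, hyR, hy⟩ := (isCompact_closedBall (0 : Euc D) R).exists_isMaxOn ⟨0, by simp; linarith⟩
    hwc.continuousOn
  rw [mem_closedBall_zero_iff] at hyR
  have hwy : 0 < w y := hwx.trans_le (hy (mem_closedBall_zero_iff.2 (by linarith)))
  have hub : b < u y := by
    by_contra! h
    simp only [hw, max_eq_right h] at hwy
    nlinarith [mul_nonneg hκ0.le (sq_nonneg ‖y‖)]
  have hyR' : ‖y‖ < R := by
    refine lt_of_le_of_ne hyR fun h => ?_
    simp only [hw, h, sub_self, mul_zero] at hwy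
    linarith [hΦpos (max (u y) b) (le_max_right _ _)]
  have hev : w =ᶠ[𝓝 y] fun z => κ * (R ^ 2 - ‖z‖ ^ 2) - Φ (u z) := by
    filter_upwards [hu.continuous.continuousAt.eventually (lt_mem_nhds hub)] with z hz
    simp only [hw, max_eq_left hz.le]
  have hlmax : IsLocalMax (fun z => κ * (R ^ 2 - ‖z‖ ^ 2) - Φ (u z)) y := by
    have h : IsLocalMax w y := hy.isLocalMax
      (Filter.mem_of_superset (Metric.isOpen_ball.mem_nhds (mem_ball_zero_iff.2 hyR'))
        Metric.ball_subset_closedBall)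
    exact h.congr hev
  have hu0 : 0 < u y := hb.trans hub
  have hΦ2 : ContDiffOn ℝ 2 Φ (Ioi 0) := contDiffOn_two_of_hasDerivAt isOpen_Ioi
    (fun t ht => hΦd t ht) (fun t ht => (hgd t ht).neg)
    (((((hfc.mono Ioi_subset_Ici_self).const_smul (1 / 2 : ℝ)).mul
      (ContinuousOn.pow (fun t ht => (hgd t ht).continuousAt.continuousWithinAt) 3)).neg).neg)
  have hΦu : ContDiffAt ℝ 2 (fun z => Φ (u z)) y :=
    (hΦ2.contDiffAt (Ioi_mem_nhds hu0)).comp y hu.contDiffAt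
  have hη : ContDiff ℝ 2 fun z : Euc D => κ * (R ^ 2 - ‖z‖ ^ 2) :=
    contDiff_const.mul (contDiff_const.sub contDiff_norm_sq_euc)
  have hηΔ : laplacian (fun z : Euc D => κ * (R ^ 2 - ‖z‖ ^ 2)) y = -(2 * D * κ) := by
    rw [laplacian_const_mul κ (contDiff_const.sub contDiff_norm_sq_euc).contDiffAt,
      laplacian_sub contDiff_const.contDiffAt contDiff_norm_sq_euc.contDiffAt, laplacian_const,
      laplacian_norm_sq]
    ring
  have hΦΔ := laplacian_comp (β := Φ) (β' := fun s => -g s) hu.contDiffAt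
    (by filter_upwards [Ioi_mem_nhds hu0] with s hs using hΦd s hs) (hgd _ hu0).neg
  have hgrad : ∀ i, g (u y) * fderiv ℝ u y (basisVec i) = 2 * κ * y i := fun i => by
    have h1 : HasFDerivAt (fun z : Euc D => κ * (R ^ 2 - ‖z‖ ^ 2)) _ y :=
      (((hasStrictFDerivAt_norm_sq y).hasFDerivAt).const_sub (R ^ 2)).const_mul κ
    have h2 : HasFDerivAt (fun z => Φ (u z)) _ y :=
      (hΦd _ hu0).comp_hasFDerivAt y (hu.contDiffAt.differentiableAt (by norm_num)).hasFDerivAt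
    have h3 := hlmax.hasFDerivAt_eq_zero (h1.sub h2)
    have h4 := congrArg (fun L => L (basisVec i)) h3
    simp [basisVec, EuclideanSpace.inner_single_right] at h4
    simp only [basisVec]
    linarith
  have hsum : g (u y) ^ 2 * ∑ i, (fderiv ℝ u y (basisVec i)) ^ 2 = 4 * κ ^ 2 * ‖y‖ ^ 2 := by
    rw [EuclideanSpace.real_norm_sq_eq, Finset.mul_sum, Finset.mul_sum]
    refine Finset.sum_congr rfl fun i _ => ?_
    rw [← mul_pow, hgrad i]
    ring
  have hle := laplacian_nonpos_of_isLocalMax (hη.contDiffAt.sub hΦu) hlmax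
  rw [laplacian_sub hη.contDiffAt hΦu, hηΔ, hΦΔ, hΔ y] at hle
  have hfg : f (u y) * g (u y) * (ρ y - 2 * κ ^ 2 * ‖y‖ ^ 2) ≤ 2 * D * κ := by
    have e : -(-(1 / 2 * f (u y) * g (u y) ^ 3)) * ∑ i, (fderiv ℝ u y (basisVec i)) ^ 2
        = 1 / 2 * f (u y) * g (u y) * (g (u y) ^ 2 * ∑ i, (fderiv ℝ u y (basisVec i)) ^ 2) := by
      ring
    rw [e, hsum] at hle
    linarith
  have h1 := hKg (u y) hub.le
  have h2 : c / 2 < ρ y - 2 * κ ^ 2 * ‖y‖ ^ 2 := by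
    have h3 : 2 * κ ^ 2 * ‖y‖ ^ 2 ≤ 2 * κ ^ 2 * R ^ 2 := by gcongr
    linarith [hc y hyR]
  have h3 : K * (f (u y) * g (u y) * (ρ y - 2 * κ ^ 2 * ‖y‖ ^ 2)) ≤ K * (2 * D * κ) := by gcongr
  nlinarith [mul_le_mul_of_nonneg_right h1 (by linarith : 0 ≤ ρ y - 2 * κ ^ 2 * ‖y‖ ^ 2)]

end KellerOsserman

section Limit

variable {D : ℕ}

/-- A radial mollifier `m` together with a function `M` such that `∇M(y) = m(y) y`. -/
theorem exists_radial_mollifier : ∃ m M : Euc D → ℝ, ContDiff ℝ 2 m ∧ (∀ y, 1 < ‖y‖ → m y = 0) ∧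
    (∀ y, m (-y) = m y) ∧ ∫ y, m y = 1 ∧ (∀ y, HasFDerivAt M (m y • innerSL ℝ y) y) ∧
    ∀ y, 1 < ‖y‖ → M y = 0 := by
  set B : ℝ → ℝ := fun s => Real.smoothTransition (1 - s) with hB
  have hBc : ContDiff ℝ 2 B := Real.smoothTransition.contDiff.comp (contDiff_const.sub contDiff_id)
  have hB0 : ∀ s, 1 ≤ s → B s = 0 := fun s hs =>
    Real.smoothTransition.zero_of_nonpos (by linarith)
  set m₀ : Euc D → ℝ := fun y => B (‖y‖ ^ 2) with hm₀
  have hm₀c : ContDiff ℝ 2 m₀ := hBc.comp contDiff_norm_sq_euc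
  have hm₀0 : ∀ y, 1 < ‖y‖ → m₀ y = 0 := fun y hy => hB0 _ (by nlinarith)
  have hm₀s : HasCompactSupport m₀ := HasCompactSupport.intro (isCompact_closedBall (0 : Euc D) 1)
    fun y hy => hm₀0 y (by simpa using hy)
  have hI : 0 < ∫ y, m₀ y := hm₀c.continuous.integral_pos_of_hasCompactSupport_nonneg_nonzero hm₀s
    (fun y => Real.smoothTransition.nonneg _) (x := 0)
    (by simp [hm₀, hB, Real.smoothTransition.one_of_one_le])
  set I := ∫ y, m₀ y with hIdef
  set β : ℝ → ℝ := fun s => ∫ t in (1 : ℝ)..s, B t with hβ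
  have hβd : ∀ s, HasDerivAt β (B s) s := fun s =>
    intervalIntegral.integral_hasDerivAt_right (hBc.continuous.intervalIntegrable _ _)
      hBc.continuous.stronglyMeasurable.stronglyMeasurableAtFilter hBc.continuous.continuousAt
  refine ⟨fun y => I⁻¹ * m₀ y, fun y => I⁻¹ * (1 / 2 * β (‖y‖ ^ 2)), contDiff_const.mul hm₀c,
    fun y hy => by simp [hm₀0 y hy], fun y => by simp [hm₀], ?_, fun y => ?_, fun y hy => ?_⟩
  · rw [integral_const_mul, inv_mul_cancel₀ hI.ne']
  · have h := (((hβd (‖y‖ ^ 2)).comp_hasFDerivAt y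
      (hasStrictFDerivAt_norm_sq y).hasFDerivAt).const_mul (1 / 2)).const_mul I⁻¹
    refine h.congr_fderiv ?_
    ext v
    simp [hm₀]
    ring
  · have h : β (‖y‖ ^ 2) = 0 := by
      have h1 : 1 ≤ ‖y‖ ^ 2 := by nlinarith
      simp only [hβ]
      rw [intervalIntegral.integral_congr (g := fun _ => (0 : ℝ)) fun t ht => ?_]
      · simp
      · rw [uIcc_of_le h1] at ht
        exact hB0 t ht.1
    simp [h]

/-- The mean value property with respect to a radial mollifier. -/
theorem eq_integral_mul_mollifier {m M : Euc D → ℝ} (hm : Continuous m)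
    (hm0 : ∀ y, 1 < ‖y‖ → m y = 0) (hmi : ∫ y, m y = 1)
    (hM : ∀ y, HasFDerivAt M (m y • innerSL ℝ y) y) (hM0 : ∀ y, 1 < ‖y‖ → M y = 0)
    {h : Euc D → ℝ} (hh : ContDiff ℝ 2 h) {r : ℝ} (hΔ : ∀ z, ‖z‖ ≤ r + 1 → laplacian h z = 0)
    {x : Euc D} (hx : ‖x‖ ≤ r) : h x = ∫ y, h (x + y) * m y := by
  have hsupp : ∀ {k : Euc D → ℝ}, (∀ y, 1 < ‖y‖ → k y = 0) → HasCompactSupport k := fun hk =>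
    HasCompactSupport.intro (isCompact_closedBall (0 : Euc D) 1) fun y hy => hk y (by simpa using hy)
  have hms := hsupp hm0
  have hMs := hsupp hM0
  have hMc : Continuous M := continuous_iff_continuousAt.2 fun y => (hM y).continuousAt
  have hh1 : ContDiff ℝ 1 h := hh.of_le (by norm_num)
  have hfd : Continuous (fderiv ℝ h) := hh.continuous_fderiv (by norm_num)
  set φ : ℝ → ℝ := fun t => ∫ y, h (x + t • y) * m y with hφ
  have hφd : ∀ t₀ : ℝ, HasDerivAt φ (∫ y, fderiv ℝ h (x + t₀ • y) y * m y) t₀ := fun t₀ => by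
    obtain ⟨C, hC⟩ := ((isCompact_closedBall t₀ (1 : ℝ)).prod
      (isCompact_closedBall (0 : Euc D) 1)).exists_bound_of_continuousOn
      (f := fun p : ℝ × Euc D => fderiv ℝ h (x + p.1 • p.2) p.2)
      (Continuous.continuousOn (by fun_prop))
    refine (hasDerivAt_integral_of_dominated_loc_of_deriv_le (F := fun t y => h (x + t • y) * m y)
      (F' := fun t y => fderiv ℝ h (x + t • y) y * m y) (bound := fun y => C * ‖m y‖)
      (Metric.ball_mem_nhds t₀ one_pos) (Eventually.of_forall fun t => ?_) ?_ ?_ ?_ ?_ ?_).2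
    · exact Continuous.aestronglyMeasurable (by have := hh.continuous; fun_prop)
    · exact Continuous.integrable_of_hasCompactSupport (by have := hh.continuous; fun_prop)
        hms.mul_left
    · exact Continuous.aestronglyMeasurable (by fun_prop)
    · refine Eventually.of_forall fun y t ht => ?_
      rw [norm_mul]
      rcases le_or_gt ‖y‖ 1 with hy | hy
      · gcongr
        exact hC (t, y) ⟨Metric.ball_subset_closedBall ht, by simpa using hy⟩
      · simp [hm0 y hy]
    · exact (hm.norm.integrable_of_hasCompactSupport hms.norm).const_mul C
    · refine Eventually.of_forall fun y t _ => ?_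
      have h1 : HasDerivAt (fun t : ℝ => x + t • y) y t := by
        simpa using ((hasDerivAt_id t).smul_const y).const_add x
      exact (((hh.differentiable (by norm_num)) _).hasFDerivAt.comp_hasDerivAt t h1).mul_const _
  have hφ0 : ∀ t ∈ Icc (0 : ℝ) 1, ∫ y, fderiv ℝ h (x + t • y) y * m y = 0 := fun t ht => by
    set q : Fin D → Euc D → ℝ := fun i z => fderiv ℝ h z (basisVec i) with hq
    have hqC : ∀ i, ContDiff ℝ 1 (q i) := fun i =>
      (hh.fderiv_right (m := 1) (by norm_num)).clm_apply contDiff_const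
    have hqd : ∀ i y, HasFDerivAt (fun y => q i (x + t • y)) (t • fderiv ℝ (q i) (x + t • y)) y :=
      fun i y => by
        have h1 : HasFDerivAt (fun y : Euc D => x + t • y) (t • ContinuousLinearMap.id ℝ (Euc D)) y :=
          ((hasFDerivAt_id y).const_smul t).const_add x
        refine ((((hqC i).differentiable (by norm_num)) _).hasFDerivAt.comp y h1).congr_fderiv ?_
        ext v
        simp
    have hqf : ∀ i, Continuous (fderiv ℝ (q i)) := fun i => (hqC i).continuous_fderiv (by norm_num)
    have hqc : ∀ i, Continuous (q i) := fun i => (hqC i).continuous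
    have hexp : ∀ y : Euc D, fderiv ℝ h (x + t • y) y * m y
        = ∑ i, q i (x + t • y) * fderiv ℝ M y (basisVec i) := fun y => by
      have e : y = ∑ i, y i • basisVec i := by
        have := (EuclideanSpace.basisFun (Fin D) ℝ).sum_repr y
        simpa [basisVec] using this.symm
      have e2 : fderiv ℝ h (x + t • y) y = ∑ i, y i * q i (x + t • y) := by
        conv_lhs => rw [e]
        rw [map_sum]
        refine Finset.sum_congr rfl fun i _ => ?_
        rw [map_smul, ← e, smul_eq_mul]
      rw [e2, Finset.sum_mul]
      refine Finset.sum_congr rfl fun i _ => ?_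
      rw [(hM y).fderiv]
      simp [basisVec, EuclideanSpace.inner_single_right]
      ring
    have hMf : ∀ i, Continuous fun y => fderiv ℝ M y (basisVec i) := fun i => by
      have : (fun y => fderiv ℝ M y (basisVec i)) = fun y => m y * inner ℝ y (basisVec i) :=
        funext fun y => by rw [(hM y).fderiv]; simp
      rw [this]
      fun_prop
    have hint1 : ∀ i, Integrable fun y => q i (x + t • y) * fderiv ℝ M y (basisVec i) := fun i =>
      Continuous.integrable_of_hasCompactSupport
        (((hqc i).comp (by fun_prop)).mul (hMf i))
        (HasCompactSupport.mul_left (hsupp fun y hy => by rw [(hM y).fderiv, hm0 y hy]; simp))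
    have hint2 : ∀ i, Integrable fun y => t * fderiv ℝ (q i) (x + t • y) (basisVec i) * M y :=
      fun i => Continuous.integrable_of_hasCompactSupport
        (by have := hqf i; fun_prop) hMs.mul_left
    have hparts : ∀ i, ∫ y, q i (x + t • y) * fderiv ℝ M y (basisVec i)
        = -∫ y, t * fderiv ℝ (q i) (x + t • y) (basisVec i) * M y := fun i => by
      have e : ∀ y, fderiv ℝ (fun y => q i (x + t • y)) y (basisVec i)
          = t * fderiv ℝ (q i) (x + t • y) (basisVec i) := fun y => by
        rw [(hqd i y).fderiv]; rfl
      rw [integral_mul_fderiv_eq_neg_fderiv_mul_of_integrable (f := fun y => q i (x + t • y))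
        (g := M) (v := basisVec i) (by simp only [e]; exact hint2 i) (hint1 i)
        (Continuous.integrable_of_hasCompactSupport (((hqc i).comp (by fun_prop)).mul hMc)
          hMs.mul_left)
        (fun y _ => (hqd i y).differentiableAt) (fun y _ => (hM y).differentiableAt)]
      simp only [e]
    simp only [hexp]
    rw [integral_finsetSum _ fun i _ => hint1 i, Finset.sum_congr rfl fun i _ => hparts i,
      Finset.sum_neg_distrib, ← integral_finsetSum _ fun i _ => hint2 i]
    rw [integral_eq_zero_of_ae (Eventually.of_forall fun y => ?_), neg_zero]
    change ∑ i, t * fderiv ℝ (q i) (x + t • y) (basisVec i) * M y = 0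
    rw [← Finset.sum_mul, ← Finset.mul_sum]
    change t * laplacian h (x + t • y) * M y = 0
    rcases le_or_gt ‖y‖ 1 with hy | hy
    · rw [hΔ, mul_zero, zero_mul]
      refine (norm_add_le _ _).trans ?_
      rw [norm_smul, Real.norm_of_nonneg ht.1]
      nlinarith [ht.1, ht.2, norm_nonneg y]
    · rw [hM0 y hy, mul_zero]
  have h01 := constant_of_has_deriv_right_zero (f := φ) (a := 0) (b := 1)
    (fun t _ => (hφd t).continuousAt.continuousWithinAt)
    (fun t ht => by
      have := (hφd t).hasDerivWithinAt (s := Ici t)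
      rwa [hφ0 t ⟨ht.1, ht.2.le⟩] at this) 1 (by simp)
  simp only [hφ, one_smul, zero_smul, add_zero, integral_const_mul, hmi, mul_one] at h01
  exact h01.symm

open ContinuousLinearMap in
/-- The Laplacian of a convolution. -/
theorem laplacian_convolution {h m : Euc D → ℝ} (hh : LocallyIntegrable h) (hm : ContDiff ℝ 2 m)
    (hms : HasCompactSupport m) (x : Euc D) :
    laplacian (convolution h m (lsmul ℝ ℝ) volume) x
      = convolution h (laplacian m) (lsmul ℝ ℝ) volume x := by
  have key : ∀ {k : Euc D → ℝ}, ContDiff ℝ 1 k → HasCompactSupport k → ∀ v x,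
      fderiv ℝ (convolution h k (lsmul ℝ ℝ) volume) x v
        = convolution h (fun y => fderiv ℝ k y v) (lsmul ℝ ℝ) volume x := fun hk hks v x => by
    rw [(hks.hasFDerivAt_convolution_right (lsmul ℝ ℝ) hh hk x).fderiv]
    exact convolution_precompR_apply (lsmul ℝ ℝ) hh (hks.fderiv ℝ)
      (hk.continuous_fderiv (by norm_num)) x v
  have hC : ∀ i, ContDiff ℝ 1 fun y => fderiv ℝ m y (basisVec i) := fun i =>
    (hm.fderiv_right (m := 1) (by norm_num)).clm_apply contDiff_const
  have hS : ∀ i, HasCompactSupport fun y => fderiv ℝ m y (basisVec i) := fun i =>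
    hms.fderiv_apply ℝ _
  have h1 : laplacian (convolution h m (lsmul ℝ ℝ) volume) x = ∑ i, convolution h
      (fun y => fderiv ℝ (fun z => fderiv ℝ m z (basisVec i)) y (basisVec i))
      (lsmul ℝ ℝ) volume x := by
    refine Finset.sum_congr rfl fun i _ => ?_
    have e : (fun y => fderiv ℝ (convolution h m (lsmul ℝ ℝ) volume) y (basisVec i))
        = convolution h (fun y => fderiv ℝ m y (basisVec i)) (lsmul ℝ ℝ) volume :=
      funext fun y => key (hm.of_le (by norm_num)) hms _ y
    change fderiv ℝ (fun y => fderiv ℝ (convolution h m (lsmul ℝ ℝ) volume) y (basisVec i)) x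
      (basisVec i) = _
    rw [e, key (hC i) (hS i)]
  rw [h1]
  simp only [convolution_def]
  rw [← integral_finsetSum]
  · refine integral_congr_ae (Eventually.of_forall fun y => ?_)
    simp only [lsmul_apply, smul_eq_mul]
    rw [← Finset.mul_sum]
    rfl
  · intro i _
    exact ((hS i).fderiv_apply ℝ _).convolutionExists_right (lsmul ℝ ℝ) hh
      (((hC i).continuous_fderiv (by norm_num)).clm_apply continuous_const) x

open ContinuousLinearMap in
theorem tendsto_convolution {M R : ℝ} {hn : ℕ → Euc D → ℝ} {h q : Euc D → ℝ}
    (hhn : ∀ n, IsDensity M R (hn n)) (hlim : ∀ y, Tendsto (fun n => hn n y) atTop (𝓝 (h y)))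
    (hq : Continuous q) (hqs : HasCompactSupport q) (x : Euc D) :
    Tendsto (fun n => convolution (hn n) q (lsmul ℝ ℝ) volume x) atTop
      (𝓝 (convolution h q (lsmul ℝ ℝ) volume x)) := by
  simp only [convolution_def]
  refine tendsto_integral_of_dominated_convergence (fun y => M * ‖q (x - y)‖) (fun n => ?_) ?_
    (fun n => Eventually.of_forall fun y => ?_) (Eventually.of_forall fun y => ?_)
  · exact (hhn n).meas.mul (Continuous.aestronglyMeasurable (by fun_prop))
  · exact ((hq.integrable_of_hasCompactSupport hqs).norm.comp_sub_left x).const_mul M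
  · simp only [lsmul_apply, smul_eq_mul, norm_mul]
    gcongr
    exact (hhn n).bound y
  · exact (hlim y).mul_const _

end Limit

section LimitEquation

variable {D : ℕ}

/-- A locally bounded pointwise limit of solutions is, on each ball, the sum of a harmonic function
and a Newtonian potential. -/
theorem exists_local_representation (hD : 3 ≤ D) {f : ℝ → ℝ} (hf : ContDiffOn ℝ 1 f (Ici 0))
    (hf0 : f 0 = 0) (hfmono : MonotoneOn f (Ici 0)) {ρ : Euc D → ℝ} (hρ : ContDiff ℝ 1 ρ)
    {un : ℕ → Euc D → ℝ} {u : Euc D → ℝ} (hun : ∀ k, ContDiff ℝ 2 (un k))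
    (hun0 : ∀ k x, 0 ≤ un k x)
    (hΔ : ∀ R : ℝ, ∀ᶠ k in atTop, ∀ x, ‖x‖ ≤ R → laplacian (un k) x = ρ x * f (un k x))
    (hbd : ∀ R : ℝ, ∃ C, ∀ k x, ‖x‖ ≤ R → un k x ≤ C)
    (hlim : ∀ x, Tendsto (fun k => un k x) atTop (𝓝 (u x))) (r : ℝ) :
    ∃ η H : Euc D → ℝ, ContDiff ℝ 1 η ∧ HasCompactSupport η ∧ (∀ x, ‖x‖ < r → η x = 1) ∧
      ContDiff ℝ 2 H ∧ (∀ x, ‖x‖ < r → laplacian H x = 0) ∧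
      (∃ M R, IsDensity M R fun x => η x * ρ x * f (u x)) ∧
      ∀ x, ‖x‖ < r → u x = H x - invLap (fun x => η x * ρ x * f (u x)) x := by
  obtain ⟨m, M, hm, hm0, hmneg, hmi, hM, hM0⟩ := exists_radial_mollifier (D := D)
  have hms : HasCompactSupport m := HasCompactSupport.intro (isCompact_closedBall (0 : Euc D) 1)
    fun y hy => hm0 y (by simpa using hy)
  obtain ⟨χ, hχC, hχs, hχI, -, hχ1⟩ := exists_cutoff_sequence (D := D)
  obtain ⟨j, hj⟩ := exists_nat_ge ((r + 1) ^ 2)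
  set η := χ j with hη
  have hη1 : ∀ x, ‖x‖ ≤ r + 1 → η x = 1 := fun x hx =>
    hχ1 j x (le_trans (by gcongr) hj)
  have hηC : ContDiff ℝ 1 η := (hχC j).of_le (by norm_num)
  have hηρ : ContDiff ℝ 1 fun x => η x * ρ x := hηC.mul hρ
  have hηρs : HasCompactSupport fun x => η x * ρ x := (hχs j).mul_right
  obtain ⟨S, R, hSR⟩ := isDensity_of_continuous hηρ.continuous hηρs
  obtain ⟨C, hC⟩ := hbd (max R (r + 1))
  have hu0 : ∀ x, 0 ≤ u x := fun x => ge_of_tendsto' (hlim x) fun k => hun0 k x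
  have hC0 : ∀ x : Euc D, ‖x‖ ≤ max R (r + 1) → 0 ≤ C := fun x hx => (hun0 0 x).trans (hC 0 x hx)
  have hfn : ∀ t, 0 ≤ t → 0 ≤ f t := fun t ht => hf0 ▸ hfmono (by simp) ht ht
  set gn : ℕ → Euc D → ℝ := fun k x => η x * ρ x * f (un k x) with hgn
  set g : Euc D → ℝ := fun x => η x * ρ x * f (u x) with hg
  have hgnC : ∀ k, ContDiff ℝ 1 (gn k) := fun k =>
    hηρ.mul (hf.comp_contDiff ((hun k).of_le (by norm_num)) fun x => hun0 k x)
  have hgns : ∀ k, HasCompactSupport (gn k) := fun k => hηρs.mul_right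
  have hgnD : ∀ k, IsDensity (S * f (max C 0)) R (gn k) := fun k =>
    ⟨(hgnC k).continuous.aestronglyMeasurable, fun x => by
      rcases le_or_gt ‖x‖ R with hx | hx
      · have h1 := hC k x (hx.trans (le_max_left _ _))
        have h2 := hfmono (hun0 k x) (mem_Ici.2 (le_max_right C 0)) (h1.trans (le_max_left _ _))
        simp only [hgn]
        rw [abs_mul, abs_of_nonneg (hfn _ (hun0 k x))]
        exact mul_le_mul (hSR.bound x) h2 (hfn _ (hun0 k x)) hSR.nonneg
      · have h1 := hSR.supp x hx
        simp only [hgn, h1, zero_mul, abs_zero]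
        exact mul_nonneg hSR.nonneg (hfn _ (le_max_right _ _)),
      fun x hx => by
        have h1 := hSR.supp x hx
        simp only [hgn, h1, zero_mul]⟩
  have hgl : ∀ x, Tendsto (fun k => gn k x) atTop (𝓝 (g x)) := fun x => by
    refine Tendsto.const_mul _ ?_
    have h1 : Tendsto (fun k => un k x) atTop (𝓝[Ici 0] (u x)) :=
      tendsto_nhdsWithin_iff.2 ⟨hlim x, Eventually.of_forall fun k => hun0 k x⟩
    exact (hf.continuousOn (u x) (hu0 x)).tendsto.comp h1
  have hgD := IsDensity.of_tendsto hgnD hgl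
  obtain ⟨Q, hQ0, hQ⟩ := exists_abs_invLap_le hD R
  set S' := S * f (max C 0) with hS'
  set hk : ℕ → Euc D → ℝ := fun k x => un k x + invLap (gn k) x with hhk
  have hhkC : ∀ k, ContDiff ℝ 2 (hk k) := fun k => (hun k).add (contDiff_two_invLap hD (hgnC k) (hgns k))
  set A := Metric.closedBall (0 : Euc D) (r + 1) with hA
  have hind : ∀ k, IsDensity (max C 0 + Q * S') (r + 1) (A.indicator (hk k)) := fun k =>
    ⟨(hhkC k).continuous.aestronglyMeasurable.indicator Metric.isClosed_closedBall.measurableSet,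
      fun x => by
        by_cases hx : x ∈ A
        · rw [indicator_of_mem hx]
          have hx' : ‖x‖ ≤ r + 1 := by simpa [hA] using hx
          refine (abs_add_le _ _).trans (add_le_add ?_ (hQ _ _ (hgnD k) x))
          rw [abs_of_nonneg (hun0 k x)]
          exact (hC k x (hx'.trans (le_max_right _ _))).trans (le_max_left _ _)
        · rw [indicator_of_notMem hx, abs_zero]
          have := (hgnD k).nonneg
          positivity,
      fun x hx => indicator_of_notMem (by simpa [hA] using hx) _⟩
  have hindl : ∀ x, Tendsto (fun k => A.indicator (hk k) x) atTop
      (𝓝 (A.indicator (fun x => u x + invLap g x) x)) := fun x => by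
    by_cases hx : x ∈ A
    · simp only [indicator_of_mem hx]
      exact (hlim x).add (tendsto_invLap_of_tendsto hD hgnD hgl x)
    · simp only [indicator_of_notMem hx]
      exact tendsto_const_nhds
  set T : (Euc D → ℝ) → (Euc D → ℝ) → Euc D → ℝ := fun a b =>
    convolution a b (ContinuousLinearMap.lsmul ℝ ℝ) volume with hT
  have hharm : ∀ᶠ k in atTop, ∀ x, ‖x‖ ≤ r + 1 → laplacian (hk k) x = 0 := by
    filter_upwards [hΔ (r + 1)] with k hΔk x hx
    rw [hhk, laplacian_add (hun k).contDiffAt (contDiff_two_invLap hD (hgnC k) (hgns k)).contDiffAt,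
      laplacian_invLap hD (hgnC k) (hgns k), hΔk x hx, hgn]
    simp only [hη1 x hx]
    ring
  have hmean : ∀ᶠ k in atTop, ∀ x, ‖x‖ ≤ r → hk k x = T (A.indicator (hk k)) m x := by
    filter_upwards [hharm] with k hk0 x hx
    rw [eq_integral_mul_mollifier hm.continuous hm0 hmi hM hM0 (hhkC k) hk0 hx]
    have h1 := integral_add_left_eq_self (μ := (volume : Measure (Euc D)))
      (fun z => hk k z * m (z - x)) x
    simp only [add_sub_cancel_left] at h1
    rw [h1]
    simp only [hT, convolution_def]
    refine integral_congr_ae (Eventually.of_forall fun z => ?_)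
    simp only [ContinuousLinearMap.lsmul_apply, smul_eq_mul]
    rw [← neg_sub z x, hmneg]
    by_cases hz : z ∈ A
    · rw [indicator_of_mem hz]
    · rw [hm0, mul_zero, mul_zero]
      have h2 : r + 1 < ‖z‖ := by simpa [hA] using hz
      have h3 := norm_sub_norm_le z x
      linarith
  have hid := IsDensity.of_tendsto hind hindl
  refine ⟨η, T (A.indicator fun x => u x + invLap g x) m, hηC, hχs j,
    fun x hx => hη1 x (by linarith), ?_, fun x hx => ?_, ⟨_, _, hgD⟩, fun x hx => ?_⟩
  · exact_mod_cast hms.contDiff_convolution_right (n := 2) (ContinuousLinearMap.lsmul ℝ ℝ)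
      hid.integrable.locallyIntegrable (by exact_mod_cast hm)
  · have hl := hid.integrable.locallyIntegrable
    have hΔm : Continuous (laplacian m) := continuous_finsetSum _ fun i _ =>
      ((((hm.fderiv_right (m := 1) (by norm_num)).clm_apply contDiff_const).continuous_fderiv
        (by norm_num)).clm_apply continuous_const)
    have hΔms : HasCompactSupport (laplacian m) :=
      HasCompactSupport.intro (isCompact_closedBall (0 : Euc D) 1) fun y hy => by
        have h1 : m =ᶠ[𝓝 y] fun _ => 0 := by
          filter_upwards [Metric.isClosed_closedBall.isOpen_compl.mem_nhds hy] with z hz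
          exact hm0 z (by simpa using hz)
        rw [laplacian_congr h1, laplacian_const]
    have h1 := tendsto_convolution hind hindl hΔm hΔms x
    rw [hT, laplacian_convolution hl hm hms]
    refine tendsto_nhds_unique h1 (tendsto_const_nhds.congr' ?_)
    filter_upwards [hharm, hmean] with k hk0 hkm
    rw [← laplacian_convolution (hind k).integrable.locallyIntegrable hm hms,
      ← hk0 x (by linarith)]
    refine laplacian_congr ?_
    filter_upwards [Metric.isOpen_ball.mem_nhds (mem_ball_zero_iff.2 hx)] with z hz
    exact hkm z (mem_ball_zero_iff.1 hz).le
  · have h1 := tendsto_convolution hind hindl hm.continuous hms x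
    have h2 := ((hlim x).add (tendsto_invLap_of_tendsto hD hgnD hgl x))
    have h3 := tendsto_nhds_unique h2 (h1.congr' (by
      filter_upwards [hmean] with k hkm
      exact (hkm x hx.le).symm))
    exact eq_sub_of_add_eq h3

/-- A locally bounded pointwise limit of solutions is a solution. -/
theorem solution_of_tendsto (hD : 3 ≤ D) {f : ℝ → ℝ} (hf : ContDiffOn ℝ 1 f (Ici 0))
    (hf0 : f 0 = 0) (hfmono : MonotoneOn f (Ici 0)) {ρ : Euc D → ℝ} (hρ : ContDiff ℝ 1 ρ)
    {un : ℕ → Euc D → ℝ} {u : Euc D → ℝ} (hun : ∀ k, ContDiff ℝ 2 (un k))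
    (hun0 : ∀ k x, 0 ≤ un k x)
    (hΔ : ∀ R : ℝ, ∀ᶠ k in atTop, ∀ x, ‖x‖ ≤ R → laplacian (un k) x = ρ x * f (un k x))
    (hbd : ∀ R : ℝ, ∃ C, ∀ k x, ‖x‖ ≤ R → un k x ≤ C)
    (hlim : ∀ x, Tendsto (fun k => un k x) atTop (𝓝 (u x))) :
    ContDiff ℝ 2 u ∧ ∀ x, laplacian u x = ρ x * f (u x) := by
  have hu0 : ∀ x, 0 ≤ u x := fun x => ge_of_tendsto' (hlim x) fun k => hun0 k x
  have hrep := exists_local_representation hD hf hf0 hfmono hρ hun hun0 hΔ hbd hlim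
  have hnear : ∀ x : Euc D, ∀ᶠ y in 𝓝 x, ‖y‖ < ‖x‖ + 1 := fun x =>
    (continuous_norm.tendsto x).eventually (gt_mem_nhds (by linarith))
  have hu1 : ContDiff ℝ 1 u := contDiff_iff_contDiffAt.2 fun x => by
    obtain ⟨η, H, -, -, -, hH, -, ⟨M, R, hMR⟩, hu⟩ := hrep (‖x‖ + 1)
    refine ((hH.of_le (by norm_num)).sub (hMR.contDiff_one_invLap hD)).contDiffAt.congr_of_eventuallyEq ?_
    filter_upwards [hnear x] with y hy using hu y hy
  have hloc : ∀ x, ContDiffAt ℝ 2 u x ∧ laplacian u x = ρ x * f (u x) := fun x => by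
    obtain ⟨η, H, hη, hηs, hη1, hH, hΔH, -, hu⟩ := hrep (‖x‖ + 1)
    have hg : ContDiff ℝ 1 fun x => η x * ρ x * f (u x) :=
      (hη.mul hρ).mul (hf.comp_contDiff hu1 fun x => hu0 x)
    have hgs : HasCompactSupport fun x => η x * ρ x * f (u x) := hηs.mul_right.mul_right
    have hw := contDiff_two_invLap hD hg hgs
    have he : u =ᶠ[𝓝 x] fun y => H y - invLap (fun x => η x * ρ x * f (u x)) y := by
      filter_upwards [hnear x] with y hy using hu y hy
    refine ⟨(hH.sub hw).contDiffAt.congr_of_eventuallyEq he, ?_⟩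
    rw [laplacian_congr he, laplacian_sub hH.contDiffAt hw.contDiffAt, laplacian_invLap hD hg hgs,
      hΔH x (by linarith), hη1 x (by linarith)]
    ring
  exact ⟨contDiff_iff_contDiffAt.2 fun x => (hloc x).1, fun x => (hloc x).2⟩

end LimitEquation

section Existence

variable {D : ℕ}

/-- Bounded solutions with limit `n` at infinity, monotone in `n`. -/
theorem exists_monotone_solutions (hD : 3 ≤ D) {f : ℝ → ℝ} (hf : ContDiffOn ℝ 1 f (Ici 0))
    (hf0 : f 0 = 0) (hfmono : MonotoneOn f (Ici 0)) {ρ ψ : Euc D → ℝ} (hρ : ContDiff ℝ 1 ρ)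
    (hρ0 : ∀ x, 0 ≤ ρ x) (hψ : ContDiff ℝ 2 ψ) (hψΔ : ∀ x, laplacian ψ x ≤ -ρ x)
    (hψ0 : Tendsto ψ (cocompact (Euc D)) (𝓝 0)) :
    ∃ V : ℕ → Euc D → ℝ, (∀ n, ContDiff ℝ 2 (V n)) ∧ (∀ n x, 0 ≤ V n x) ∧
      (∀ n x, laplacian (V n) x = ρ x * f (V n x)) ∧ (∀ x, Monotone fun n => V n x) ∧
      ∀ (n : ℕ) x, (n : ℝ) - f n * ψ x ≤ V n x := by
  obtain ⟨χ, hχC, hχs, hχI, hχm, hχ1⟩ := exists_cutoff_sequence (D := D)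
  have hD0 : 0 < D := by omega
  have hfn : ∀ t, 0 ≤ t → 0 ≤ f t := fun t ht => hf0 ▸ hfmono (by simp) ht ht
  have hσ0 : ∀ k x, 0 ≤ ρ x * χ k x := fun k x => mul_nonneg (hρ0 x) (hχI k x).1
  have hex : ∀ n k : ℕ, ∃ u : Euc D → ℝ, ContDiff ℝ 2 u ∧ (∀ x, u x ∈ Icc 0 (n : ℝ)) ∧
      (∀ x, laplacian u x = ρ x * χ k x * f (u x)) ∧ Tendsto u (cocompact (Euc D)) (𝓝 (n : ℝ)) :=
    fun n k => exists_bounded_solution hD hf hf0 hfmono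
      (hρ.mul ((hχC k).of_le (by norm_num))) (hχs k).mul_left (hσ0 k) n.cast_nonneg
  choose U hUC hUI hUΔ hUl using hex
  have hanti : ∀ n x, Antitone fun k => U n k x := fun n x => antitone_nat_of_succ_le fun k =>
    solution_le_solution hD hf0 hfmono (hσ0 k)
      (fun x => mul_le_mul_of_nonneg_left (hχm k x) (hρ0 x)) (hUC n (k + 1)) (hUC n k)
      (fun x => (hUI n k x).1) (hUΔ n (k + 1)) (hUΔ n k) (hUl n (k + 1)) (hUl n k) le_rfl x
  have hbdd : ∀ n x, BddBelow (range fun k => U n k x) := fun n x =>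
    ⟨0, by rintro _ ⟨k, rfl⟩; exact (hUI n k x).1⟩
  have hlim : ∀ n x, Tendsto (fun k => U n k x) atTop (𝓝 (⨅ k, U n k x)) := fun n x =>
    tendsto_atTop_ciInf (hanti n x) (hbdd n x)
  have hsol : ∀ n : ℕ, ContDiff ℝ 2 (fun x => ⨅ k, U n k x) ∧
      ∀ x, laplacian (fun x => ⨅ k, U n k x) x = ρ x * f (⨅ k, U n k x) := fun n => by
    refine solution_of_tendsto hD hf hf0 hfmono hρ (hUC n) (fun k x => (hUI n k x).1) (fun R => ?_)
      (fun R => ⟨n, fun k x _ => (hUI n k x).2⟩) (hlim n)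
    obtain ⟨j, hj⟩ := exists_nat_ge (R ^ 2)
    filter_upwards [eventually_ge_atTop j] with k hk x hx
    have h1 : ‖x‖ ^ 2 ≤ k := by
      have h2 : (j : ℝ) ≤ k := by exact_mod_cast hk
      have h3 : ‖x‖ ^ 2 ≤ R ^ 2 := by gcongr
      linarith
    rw [hUΔ, hχ1 k x h1, mul_one]
  refine ⟨fun n x => ⨅ k, U n k x, fun n => (hsol n).1, fun n x => le_ciInf fun k => (hUI n k x).1,
    fun n => (hsol n).2, fun x => monotone_nat_of_le_succ fun n => ?_,
    fun n x => le_ciInf fun k => ?_⟩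
  · refine ciInf_mono (hbdd n x) fun k => ?_
    exact solution_le_solution hD hf0 hfmono (hσ0 k) (fun _ => le_rfl) (hUC n k) (hUC (n + 1) k)
      (fun x => (hUI (n + 1) k x).1) (hUΔ n k) (hUΔ (n + 1) k) (hUl n k) (hUl (n + 1) k)
      (by push_cast; linarith) x
  · have hfψ : ContDiff ℝ 2 fun x => f n * ψ x := contDiff_const.mul hψ
    have hwC : ContDiff ℝ 2 fun x => (n : ℝ) - f n * ψ x := contDiff_const.sub hfψ
    have hwl : Tendsto (fun x => (n : ℝ) - f n * ψ x - U n k x) (cocompact (Euc D)) (𝓝 0) := by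
      have h := ((hψ0.const_mul (f n)).const_sub (n : ℝ)).sub (hUl n k)
      simpa using h
    have h := nonpos_of_laplacian_nonneg hD0 (hwC.sub (hUC n k)) (fun x _ => by
      rw [laplacian_sub hwC.contDiffAt (hUC n k).contDiffAt,
        laplacian_sub contDiff_const.contDiffAt hfψ.contDiffAt, laplacian_const,
        laplacian_const_mul _ hψ.contDiffAt, hUΔ]
      have h1 : f (U n k x) ≤ f n := hfmono (hUI n k x).1 (mem_Ici.2 n.cast_nonneg) (hUI n k x).2
      have h2 : ρ x * χ k x * f (U n k x) ≤ ρ x * 1 * f n :=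
        mul_le_mul (mul_le_mul_of_nonneg_left (hχI k x).2 (hρ0 x)) h1 (hfn _ (hUI n k x).1)
          (by simpa using hρ0 x)
      have h3 : f n * laplacian ψ x ≤ f n * -ρ x :=
        mul_le_mul_of_nonneg_left (hψΔ x) (hfn _ n.cast_nonneg)
      linarith) (eventually_le_of_tendsto_sub le_rfl hwl) x
    linarith

/-- Nonnegative solutions that are large at infinity are positive. -/
theorem pos_of_solution (hD : 3 ≤ D) {f : ℝ → ℝ} (hf : ContDiffOn ℝ 1 f (Ici 0))
    (hf0 : f 0 = 0) (hfmono : MonotoneOn f (Ici 0)) {ρ : Euc D → ℝ} (hρ : Continuous ρ)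
    {u : Euc D → ℝ} (hu : ContDiff ℝ 2 u) (hu0 : ∀ x, 0 ≤ u x)
    (hΔ : ∀ x, laplacian u x = ρ x * f (u x)) (hl : Tendsto u (cocompact (Euc D)) atTop)
    (x : Euc D) : 0 < u x := by
  have hD0 : 0 < D := by omega
  obtain ⟨R₀, hR₀⟩ : ∃ R : ℝ, ∀ y : Euc D, R ≤ ‖y‖ → 1 ≤ u y := by
    have := hl.eventually (eventually_ge_atTop 1)
    rw [← Metric.cobounded_eq_cocompact, ← comap_norm_atTop] at this
    obtain ⟨s, hs, hs'⟩ := this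
    obtain ⟨R, hR⟩ := mem_atTop_sets.mp hs
    exact ⟨R, fun y hy => hs' (hR _ hy)⟩
  set R := max R₀ ‖x‖ with hR
  obtain ⟨L, hL⟩ : ∃ L : NNReal, LipschitzOnWith L f (Icc 0 1) :=
    (hf.mono Icc_subset_Ici_self).exists_lipschitzOnWith one_ne_zero (convex_Icc 0 1) isCompact_Icc
  have hfL : ∀ t ∈ Icc (0 : ℝ) 1, f t ≤ L * t := fun t ht => by
    have h := hL.dist_le_mul t ht 0 (by simp)
    rw [Real.dist_eq, Real.dist_eq, hf0, sub_zero, sub_zero, abs_of_nonneg ht.1] at h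
    exact (le_abs_self _).trans h
  obtain ⟨S, hS⟩ := (isCompact_closedBall (0 : Euc D) R).exists_bound_of_continuousOn hρ.continuousOn
  have hS0 : 0 ≤ S := (norm_nonneg _).trans (hS x (by simp [hR]))
  set κ : ℝ := S * L with hκ
  have hκ0 : 0 ≤ κ := by positivity
  set δ : ℝ := Real.exp (-(κ * R ^ 2)) with hδ
  have hδ0 : 0 < δ := Real.exp_pos _
  set β : ℝ → ℝ := fun s => δ * Real.exp (κ * s) with hβ
  have hβd : ∀ s, HasDerivAt β (κ * β s) s := fun s =>
    ((((hasDerivAt_id s).const_mul κ).exp).const_mul δ).congr_deriv (by simp [hβ]; ring)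
  have hβpos : ∀ s, 0 < β s := fun s => by positivity
  have hsC : ContDiff ℝ 2 fun y : Euc D => β (‖y‖ ^ 2) :=
    contDiff_const.mul (contDiff_const.mul contDiff_norm_sq_euc).exp
  have hβ1 : ∀ y : Euc D, ‖y‖ ≤ R → β (‖y‖ ^ 2) ≤ 1 := fun y hy => by
    simp only [hβ, hδ]
    rw [← Real.exp_add]
    refine Real.exp_le_one_iff.2 ?_
    have : κ * ‖y‖ ^ 2 ≤ κ * R ^ 2 := by gcongr
    linarith
  have h := nonpos_of_laplacian_nonneg_ball hD0 (R := R) (w := fun y => β (‖y‖ ^ 2) - u y)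
    (hsC.sub hu).continuous.continuousOn (fun y _ _ => (hsC.sub hu).contDiffAt)
    (fun y hy hw => by
      have hyR : ‖y‖ ≤ R := (mem_ball_zero_iff.1 hy).le
      rw [laplacian_sub hsC.contDiffAt hu.contDiffAt, hΔ,
        laplacian_comp_norm_sq (β := β) (β' := fun s => κ * β s) (b := κ * (κ * β (‖y‖ ^ 2)))
          (Eventually.of_forall hβd) ((hβd _).const_mul κ)]
      have hb := hβpos (‖y‖ ^ 2)
      have hD1 : (1 : ℝ) ≤ D := by exact_mod_cast hD0
      have h1 : f (u y) ≤ L * β (‖y‖ ^ 2) :=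
        (hfmono (hu0 y) (mem_Ici.2 hb.le) (by linarith)).trans (hfL _ ⟨hb.le, hβ1 y hyR⟩)
      have h2 : ρ y ≤ S := (le_abs_self _).trans (hS y (by simpa using hyR))
      have h3 : ρ y * f (u y) ≤ S * (L * β (‖y‖ ^ 2)) :=
        mul_le_mul h2 h1 (hf0 ▸ hfmono (by simp) (hu0 y) (hu0 y)) hS0
      have h4 : S * (L * β (‖y‖ ^ 2)) = κ * β (‖y‖ ^ 2) := by rw [hκ]; ring
      have h5 : 0 ≤ 4 * (κ * (κ * β (‖y‖ ^ 2))) * ‖y‖ ^ 2 := by positivity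
      have h6 : 1 * (κ * β (‖y‖ ^ 2)) ≤ D * (κ * β (‖y‖ ^ 2)) := by gcongr
      have h7 : 0 ≤ κ * β (‖y‖ ^ 2) := by positivity
      nlinarith)
    (fun y hy => by
      have hyR : ‖y‖ = R := by simpa using hy
      have h1 := hR₀ y (by rw [hyR]; exact le_max_left _ _)
      have h2 := hβ1 y hyR.le
      linarith) x (by simp [hR])
  linarith [hβpos (‖x‖ ^ 2)]

/-- Existence of an entire large solution. -/
theorem exists_isELS (hD : 3 ≤ D) {f : ℝ → ℝ} (hf : ContDiffOn ℝ 1 f (Ici 0)) (hf0 : f 0 = 0)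
    (hfpos : ∀ t : ℝ, 0 < t → 0 < f t)
    (hKO : ∃ b : ℝ, 0 < b ∧
      IntegrableOn (fun s => 1 / Real.sqrt (∫ t in (0:ℝ)..s, f t)) (Ici b))
    (hfmono : MonotoneOn f (Ici 0)) {ρ : Euc D → ℝ} (hρ : ContDiff ℝ 1 ρ) (hρpos : ∀ x, 0 < ρ x)
    {α : ℝ} (hα : 2 < α) (hρpow : ∀ x : Euc D, 1 ≤ ‖x‖ → ρ x = ‖x‖ ^ (-α)) :
    ∃ u, IsELS ρ f u := by
  obtain ⟨ψ, hψ, hψΔ, hψ0⟩ := exists_superharmonic_barrier hD hρ.continuous hα hρpow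
  obtain ⟨V, hVC, hV0, hVΔ, hVm, hVl⟩ :=
    exists_monotone_solutions hD hf hf0 hfmono hρ (fun x => (hρpos x).le) hψ hψΔ hψ0
  have hbd : ∀ R : ℝ, ∃ C, ∀ n x, ‖x‖ ≤ R → V n x ≤ C := fun R => by
    obtain ⟨C, hC⟩ := exists_kellerOsserman_bound hf.continuousOn hfpos hfmono hKO hρ.continuous
      hρpos (le_max_right R 0)
    exact ⟨C, fun n x hx => hC (V n) (hVC n) (hVΔ n) x (hx.trans (le_max_left _ _))⟩
  have hbdd : ∀ x, BddAbove (range fun n => V n x) := fun x => by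
    obtain ⟨C, hC⟩ := hbd ‖x‖
    exact ⟨C, by rintro _ ⟨n, rfl⟩; exact hC n x le_rfl⟩
  obtain ⟨hu, hΔ⟩ := solution_of_tendsto hD hf hf0 hfmono hρ hVC hV0
    (fun R => Eventually.of_forall fun n x _ => hVΔ n x) hbd
    (fun x => tendsto_atTop_ciSup (hVm x) (hbdd x))
  have hle : ∀ n x, V n x ≤ ⨆ n, V n x := fun n x => le_ciSup (hbdd x) n
  have hl : Tendsto (fun x => ⨆ n, V n x) (cocompact (Euc D)) atTop := by
    refine tendsto_atTop.2 fun b => ?_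
    obtain ⟨n, hn⟩ := exists_nat_gt b
    have h := (hψ0.const_mul (f n)).const_sub (n : ℝ)
    filter_upwards [h.eventually (lt_mem_nhds (by simpa using hn))] with x hx
    exact hx.le.trans ((hVl n x).trans (hle n x))
  exact ⟨_, hu, pos_of_solution hD hf hf0 hfmono hρ.continuous hu
    (fun x => (hV0 0 x).trans (hle 0 x)) hΔ hl, hΔ, hl⟩

end Existence

/-- Under (SA) with `f` nondecreasing and `ρ(x) = |x|^{-α}` for
`|x| ≥ 1` (`α > 2`), there exists exactly one entire large solution. -/
theorem stmt5 (D : ℕ) (hD : 3 ≤ D)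
    (f : ℝ → ℝ) (ρ : EuclideanSpace ℝ (Fin D) → ℝ)
    (hf : ContDiffOn ℝ 1 f (Ici 0)) (hf0 : f 0 = 0)
    (hfpos : ∀ t : ℝ, 0 < t → 0 < f t)
    (hKO : ∃ b : ℝ, 0 < b ∧
      IntegrableOn (fun s => 1 / Real.sqrt (∫ t in (0:ℝ)..s, f t)) (Ici b))
    (hρ : ContDiff ℝ 1 ρ) (hρpos : ∀ x, 0 < ρ x)
    (hHρ : Tendsto (fun x : EuclideanSpace ℝ (Fin D) =>
      ∫ y : EuclideanSpace ℝ (Fin D), ‖x - y‖ ^ (2 - (D:ℝ)) * ρ y) (cocompact _) (nhds 0))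
    (hfmono : MonotoneOn f (Ici 0))
    (α : ℝ) (hα : 2 < α)
    (hρpow : ∀ x : EuclideanSpace ℝ (Fin D), 1 ≤ ‖x‖ → ρ x = ‖x‖ ^ (-α)) :
    ∃! u : EuclideanSpace ℝ (Fin D) → ℝ, IsELS ρ f u := by
  obtain ⟨u, hu⟩ := exists_isELS hD hf hf0 hfpos hKO hfmono hρ hρpos hα hρpow
  exact ⟨u, hu, fun v hv => funext fun x => le_antisymm
    (isELS_le hD hfpos hfmono hρpos hα hρpow hu hv x)
    (isELS_le hD hfpos hfmono hρpos hα hρpow hv hu x)⟩
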